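/- Let X be a weakly irreducible, critical multitype Galton-Watson tree whose offspring law has all exponential moments finite (Q{e^{ηN} | a} < ∞ for all a ∈ 𝒳 and η > 0), conditioned to have exactly n vertices. Then, as n → ∞ along integers n with P{|T| = n} > 0, the empirical offspring measure M_X satisfies a large deviation principle in ℳ(𝒳 × 𝒳*) with speed n and the convex good rate function J, where J(ν) = H(ν ∥ ν₁ ⊗ 𝒬) if ν is shift-invariant and J(ν) = ∞ otherwise. -/

import Mathlib

open scoped ENNReal NNReal BigOperators
open Filter

/-- Finite rooted planar trees with vertex types in `𝒳`. -/
inductive PTree (𝒳 : Type*) where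
  | node : 𝒳 → List (PTree 𝒳) → PTree 𝒳

namespace PTree

variable {𝒳 : Type*}

/-- The type of the root. -/
def root : PTree 𝒳 → 𝒳
  | node a _ => a

/-- The list of subtrees rooted at the children of the root (left to right). -/
def children : PTree 𝒳 → List (PTree 𝒳)
  | node _ ts => ts

/-- The types of the children of the root, from left to right. -/
def childLabels (t : PTree 𝒳) : List 𝒳 := t.children.map root

/-- The list of all subtrees `X^v`, `v` a vertex of the tree. -/
def subtrees : PTree 𝒳 → List (PTree 𝒳)
  | node a ts => node a ts :: (ts.attach.map (fun s => subtrees s.1)).flatten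
decreasing_by
  have := List.sizeOf_lt_of_mem s.2
  simp only [PTree.node.sizeOf_spec]
  omega

/-- Number of vertices. -/
def size (t : PTree 𝒳) : ℕ := t.subtrees.length

/-- The vertices at depth exactly `k`, as subtrees, from left to right. -/
def atDepth : ℕ → PTree 𝒳 → List (PTree 𝒳)
  | 0, t => [t]
  | (k+1), node _ ts => (ts.attach.map (fun s => atDepth k s.1)).flatten

/-- Truncation of a tree at height `k` (keeping the generations `0,…,k`). -/
def trunc : ℕ → PTree 𝒳 → PTree 𝒳
  | 0, node a _ => node a []
  | (k+1), node a ts => node a (ts.attach.map (fun s => trunc k s.1))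

/-- The height of a tree (largest `k` such that generation `k` is nonempty). -/
def height : PTree 𝒳 → ℕ
  | node _ [] => 0
  | node _ (t :: ts) => ((t :: ts).attach.map (fun s => height s.1)).foldr max 0 + 1
decreasing_by
  have := List.sizeOf_lt_of_mem s.2
  simp only [PTree.node.sizeOf_spec] at *
  omega

/-- The largest offspring number in the tree. -/
def maxDeg : PTree 𝒳 → ℕ
  | node _ ts => max ts.length (((ts.attach.map (fun s => maxDeg s.1)).foldr max 0))
decreasing_by
  have := List.sizeOf_lt_of_mem s.2
  simp only [PTree.node.sizeOf_spec] at *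
  omega

end PTree
noncomputable instance {𝒳 : Type*} : DecidableEq (PTree 𝒳) := Classical.decEq _

/-- Extended-real logarithm of an extended nonnegative real. -/
noncomputable def elog (x : ℝ≥0∞) : EReal :=
  if x = 0 then ⊥ else if x = ∞ then ⊤ else ((Real.log x.toReal : ℝ) : EReal)

open Classical in
/-- Relative entropy `H(ν ‖ ρ)` of two (probability) vectors on a countable set,
with value `∞` if `ν` is not absolutely continuous with respect to `ρ`.  (For
probability vectors each summand below is nonnegative and the sum equals
`∑ ν a log (ν a / ρ a)`.) -/
noncomputable def relEnt {α : Type*} (ν ρ : α → ℝ) : ℝ≥0∞ :=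
  if ∀ a, ρ a = 0 → ν a = 0 then
    ∑' a, ENNReal.ofReal (ν a * Real.log (ν a / ρ a) + ρ a - ν a)
  else ∞

/-- The Cramér rate function `I_p(x) = sup_λ {λx - log ∑ p(n) e^{λn}}`. -/
noncomputable def cramerRate (p : ℕ → ℝ) (x : ℝ) : EReal :=
  ⨆ lam : ℝ, ((lam * x - Real.log (∑' n : ℕ, p n * Real.exp (lam * n)) : ℝ) : EReal)

/-- Total mass `P{|T| = n}` assigned by the weight `w` to trees with `n` vertices. -/
noncomputable def treeMass {𝒳 : Type*} (w : PTree 𝒳 → ℝ) (n : ℕ) : ℝ≥0∞ :=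
  ∑' t : PTree 𝒳, if t.size = n then ENNReal.ofReal (w t) else 0

open Classical in
/-- Conditional probability of the event `E` given `{|T| = n}`, for the (sub)probability
weight `w` on finite planar trees.  -/
noncomputable def condP {𝒳 : Type*} (w : PTree 𝒳 → ℝ) (n : ℕ) (E : Set (PTree 𝒳)) : ℝ≥0∞ :=
  (∑' t : PTree 𝒳, if t.size = n ∧ t ∈ E then ENNReal.ofReal (w t) else 0) / treeMass w n

/-- The set of sizes having positive probability. -/
noncomputable def sizeSupport {𝒳 : Type*} (w : PTree 𝒳 → ℝ) : Set ℕ := {n | 0 < treeMass w n}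
section Multitype

variable {𝒳 : Type*} [Fintype 𝒳] [DecidableEq 𝒳]

/-- The weight of a typed tree under the multitype Galton-Watson law with initial
distribution `μ0` and offspring kernel `𝒬` (an offspring `c ∈ 𝒳*` is recorded as the
list of types of the children from left to right):
`μ0(root) ∏_v 𝒬{C(v) | type v}`. -/
noncomputable def mgwWeight (μ0 : 𝒳 → ℝ) (𝒬 : 𝒳 → List 𝒳 → ℝ) (t : PTree 𝒳) : ℝ :=
  μ0 t.root * (t.subtrees.map (fun s => 𝒬 s.root s.childLabels)).prod

/-- The multiplicity `m(a,c)` of the symbol `a` in `c ∈ 𝒳*`. -/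
def mult (a : 𝒳) (c : List 𝒳) : ℕ := c.count a

/-- The empirical offspring measure `M_X` of a typed tree. -/
noncomputable def empOff (t : PTree 𝒳) : 𝒳 × List 𝒳 → ℝ := fun x =>
  ((t.subtrees.filter (fun s => s.root = x.1 ∧ s.childLabels = x.2)).length : ℝ) / t.size

/-- The `𝒳`-marginal `ν₁` of a measure on `𝒳 × 𝒳*`. -/
noncomputable def marg1 (ν : 𝒳 × List 𝒳 → ℝ) (a : 𝒳) : ℝ := ∑' c : List 𝒳, ν (a, c)

/-- Shift-invariance: `ν₁(a) = ∑_{(b,c)} m(a,c) ν(b,c)` for all `a`. -/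
def ShiftInv (ν : 𝒳 × List 𝒳 → ℝ) : Prop :=
  ∀ a : 𝒳, marg1 ν a = ∑' x : 𝒳 × List 𝒳, (mult a x.2 : ℝ) * ν x

/-- Membership in `ℳ(𝒳 × 𝒳*)`: a probability measure with finite mean offspring
number. -/
structure IsOffMeasure (ν : 𝒳 × List 𝒳 → ℝ) : Prop where
  nonneg : ∀ x, 0 ≤ ν x
  hasSum : HasSum ν 1
  moment : Summable (fun x : 𝒳 × List 𝒳 => (x.2.length : ℝ) * ν x)

/-- The space `ℳ(𝒳 × 𝒳*)`. -/
def MSpace (𝒳 : Type*) [Fintype 𝒳] [DecidableEq 𝒳] :=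
  {ν : 𝒳 × List 𝒳 → ℝ // IsOffMeasure ν}

/-- The test functions defining the topology of `ℳ(𝒳 × 𝒳*)`: all bounded functions
together with the functions `(b,c) ↦ m(a,c) 𝟙_{b₀}(b)`, `a, b₀ ∈ 𝒳`. -/
def offTests (𝒳 : Type*) [Fintype 𝒳] [DecidableEq 𝒳] : Set ((𝒳 × List 𝒳) → ℝ) :=
  {f | ∃ M : ℝ, ∀ x, |f x| ≤ M} ∪
    {f | ∃ a b₀ : 𝒳, f = fun x => (mult a x.2 : ℝ) * (if x.1 = b₀ then 1 else 0)}

/-- The topology of `ℳ(𝒳 × 𝒳*)`: the smallest topology making `ν ↦ ∫ f dν`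
continuous for every test function `f`. -/
noncomputable instance : TopologicalSpace (MSpace 𝒳) :=
  TopologicalSpace.induced
    (fun ν : MSpace 𝒳 => fun f : offTests 𝒳 => ∑' x, ν.1 x * f.1 x) Pi.topologicalSpace

open Classical in
/-- The rate function `J(ν) = H(ν ‖ ν₁ ⊗ 𝒬)` for shift-invariant `ν`, `∞` otherwise. -/
noncomputable def offRate (𝒬 : 𝒳 → List 𝒳 → ℝ) (ν : 𝒳 × List 𝒳 → ℝ) : ℝ≥0∞ :=
  if ShiftInv ν then relEnt ν (fun x => marg1 ν x.1 * 𝒬 x.1 x.2) else ∞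

/-- The expected offspring matrix `A(a,b) = ∑_c 𝒬{c | b} m(a,c)` (with values in
`[0,∞]`). -/
noncomputable def meanMat (𝒬 : 𝒳 → List 𝒳 → ℝ) : Matrix 𝒳 𝒳 ℝ≥0∞ :=
  Matrix.of fun a b => ∑' c : List 𝒳, ENNReal.ofReal (𝒬 b c) * (mult a c : ℝ≥0∞)

/-- `A* = ∑_{k ≥ 1} A^k`. -/
noncomputable def matStar (A : Matrix 𝒳 𝒳 ℝ≥0∞) : Matrix 𝒳 𝒳 ℝ≥0∞ :=
  Matrix.of fun a b => ∑' k : ℕ, (A ^ (k + 1)) a b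

/-- Weak irreducibility of a nonnegative matrix with respect to a partition of `𝒳`
into recurrent states `Xr` and transient states `Xt`. -/
structure WeaklyIrred (A : Matrix 𝒳 𝒳 ℝ≥0∞) (Xr Xt : Finset 𝒳) : Prop where
  compl : ∀ a, a ∈ Xr ↔ a ∉ Xt
  npty : Xr.Nonempty
  rec_pos : ∀ a b, b ∈ Xr → 0 < matStar A a b
  trans_zero : ∀ a b, b ∈ Xt → a = b ∨ a ∈ Xr → matStar A a b = 0

/-- The real expected offspring matrix. -/
noncomputable def meanMatR (𝒬 : 𝒳 → List 𝒳 → ℝ) : Matrix 𝒳 𝒳 ℝ :=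
  Matrix.of fun a b => ∑' c : List 𝒳, 𝒬 b c * (mult a c : ℝ)

/-- Criticality: the Perron-Frobenius eigenvalue of the expected offspring matrix is
`1`; equivalently (for weakly irreducible matrices) there is a strictly positive right
eigenvector with eigenvalue `1`. -/
def CriticalKernel (𝒬 : 𝒳 → List 𝒳 → ℝ) : Prop :=
  ∃ u : 𝒳 → ℝ, (∀ a, 0 < u a) ∧ ∀ a, ∑ b, meanMatR 𝒬 a b * u b = u a

/-- The uniform bound on the number of transient offspring. -/
def BoundedTransient (𝒬 : 𝒳 → List 𝒳 → ℝ) (Xt : Finset 𝒳) : Prop :=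
  ∃ B : ℕ, ∀ b c, 𝒬 b c ≠ 0 → c.countP (fun a => decide (a ∈ Xt)) ≤ B

end Multitype

set_option linter.unusedSectionVars false
set_option linter.unusedDecidableInType false
set_option linter.unusedFintypeInType false

namespace PTree

variable {𝒳 : Type*}

theorem induct {P : PTree 𝒳 → Prop} (h : ∀ a ts, (∀ t ∈ ts, P t) → P (node a ts)) :
    ∀ t, P t
  | node a ts => h a ts fun t ht => induct h t
termination_by t => sizeOf t
decreasing_by
  have := List.sizeOf_lt_of_mem ht
  simp only [PTree.node.sizeOf_spec]
  omega

theorem subtrees_node (a : 𝒳) (ts : List (PTree 𝒳)) :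
    (node a ts).subtrees = node a ts :: (ts.map subtrees).flatten := by
  rw [subtrees]
  congr 2
  exact List.attach_map_val (l := ts) (f := subtrees)

theorem size_node (a : 𝒳) (ts : List (PTree 𝒳)) :
    (node a ts).size = 1 + (ts.map size).sum := by
  rw [size, subtrees_node, List.length_cons, List.length_flatten, List.map_map, add_comm]
  rfl

theorem size_pos (t : PTree 𝒳) : 0 < t.size := by
  cases t with
  | node a ts => rw [size_node]; omega

theorem self_mem_subtrees (t : PTree 𝒳) : t ∈ t.subtrees := by
  cases t with
  | node a ts => rw [subtrees_node]; simp

/-- The sum of `f (type of v, offspring of v)` over the vertices `v` of a tree. -/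
def vsum {M : Type*} [AddCommMonoid M] (f : 𝒳 × List 𝒳 → M) (t : PTree 𝒳) : M :=
  (t.subtrees.map fun s => f (s.root, s.childLabels)).sum

/-- The product of `K (type of v) (offspring of v)` over the vertices `v` of a tree. -/
def vprod {M : Type*} [CommMonoid M] (K : 𝒳 → List 𝒳 → M) (t : PTree 𝒳) : M :=
  (t.subtrees.map fun s => K s.root s.childLabels).prod

@[simp] theorem root_node (a : 𝒳) (ts : List (PTree 𝒳)) : (node a ts).root = a := rfl
@[simp] theorem children_node (a : 𝒳) (ts : List (PTree 𝒳)) : (node a ts).children = ts := rfl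
@[simp] theorem childLabels_node (a : 𝒳) (ts : List (PTree 𝒳)) :
    (node a ts).childLabels = ts.map root := rfl

theorem vsum_node {M : Type*} [AddCommMonoid M] (f : 𝒳 × List 𝒳 → M) (a : 𝒳)
    (ts : List (PTree 𝒳)) :
    vsum f (node a ts) = f (a, ts.map root) + (ts.map (vsum f)).sum := by
  rw [vsum, subtrees_node, List.map_cons, List.sum_cons, List.map_flatten, List.sum_flatten,
    List.map_map, List.map_map]
  rfl

theorem vprod_node {M : Type*} [CommMonoid M] (K : 𝒳 → List 𝒳 → M) (a : 𝒳)
    (ts : List (PTree 𝒳)) :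
    vprod K (node a ts) = K a (ts.map root) * (ts.map (vprod K)).prod := by
  rw [vprod, subtrees_node, List.map_cons, List.prod_cons, List.map_flatten, List.prod_flatten,
    List.map_map, List.map_map]
  rfl

theorem vsum_one (t : PTree 𝒳) : vsum (fun _ => (1 : ℝ)) t = t.size := by
  simp [vsum, size]

theorem vsum_const (c : ℝ) (t : PTree 𝒳) : vsum (fun _ => c) t = t.size * c := by
  simp [vsum, size]

theorem vsum_add (f g : 𝒳 × List 𝒳 → ℝ) (t : PTree 𝒳) :
    vsum (fun x => f x + g x) t = vsum f t + vsum g t := by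
  simp [vsum, List.sum_map_add]

theorem map_vsum {M N F : Type*} [AddCommMonoid M] [AddCommMonoid N] [FunLike F M N]
    [AddMonoidHomClass F M N] (L : F) (f : 𝒳 × List 𝒳 → M) (t : PTree 𝒳) :
    L (vsum f t) = vsum (fun x => L (f x)) t := by
  simp only [vsum, map_list_sum, List.map_map]
  rfl

theorem vprod_mul {M : Type*} [CommMonoid M] (K K' : 𝒳 → List 𝒳 → M) (t : PTree 𝒳) :
    vprod (fun a c => K a c * K' a c) t = vprod K t * vprod K' t := by
  simp [vprod, List.prod_map_mul]

theorem vprod_exp (H : 𝒳 × List 𝒳 → ℝ) (t : PTree 𝒳) :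
    vprod (fun a c => ENNReal.ofReal (Real.exp (H (a, c)))) t
      = ENNReal.ofReal (Real.exp (vsum H t)) := by
  unfold vprod vsum
  induction t.subtrees with
  | nil => simp
  | cons s l ih =>
    rw [List.map_cons, List.map_cons, List.prod_cons, List.sum_cons, ih, Real.exp_add,
      ENNReal.ofReal_mul (Real.exp_pos _).le]

theorem vprod_ofReal (Q : 𝒳 → List 𝒳 → ℝ) (hQ : ∀ a c, 0 ≤ Q a c) (t : PTree 𝒳) :
    ENNReal.ofReal (vprod Q t) = vprod (fun a c => ENNReal.ofReal (Q a c)) t := by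
  unfold vprod
  induction t.subtrees with
  | nil => simp
  | cons s l ih =>
    rw [List.map_cons, List.map_cons, List.prod_cons, List.prod_cons, ← ih,
      ENNReal.ofReal_mul (hQ _ _)]

theorem vsum_length (t : PTree 𝒳) :
    vsum (fun x => (x.2.length : ℝ)) t = t.size - 1 := by
  induction t using induct with
  | h a ts ih =>
    rw [vsum_node, size_node]
    have : (ts.map (vsum fun x => (x.2.length : ℝ))).sum
        = (ts.map (fun t => (t.size : ℝ))).sum - ts.length := by
      clear * - ih
      induction ts with
      | nil => simp
      | cons t ts ih' =>
        simp only [List.map_cons, List.sum_cons, List.length_cons]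
        rw [ih t (by simp), ih' fun s hs => ih s (by simp [hs])]
        push_cast; ring
    rw [this]
    simp only [List.length_map]
    push_cast
    simp only [List.map_map]
    simp only [Function.comp_def]
    ring

theorem vsum_count [DecidableEq 𝒳] (a : 𝒳) (t : PTree 𝒳) :
    vsum (fun x => (x.2.count a : ℝ)) t
      = vsum (fun x => if x.1 = a then (1 : ℝ) else 0) t - if t.root = a then 1 else 0 := by
  induction t using induct with
  | h b ts ih =>
    rw [vsum_node, vsum_node]
    have : ((ts.map root).count a : ℝ) + (ts.map (vsum fun x => (x.2.count a : ℝ))).sum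
        = (ts.map (vsum fun x => if x.1 = a then (1 : ℝ) else 0)).sum := by
      induction ts with
      | nil => simp
      | cons t ts ih' =>
        simp only [List.map_cons, List.sum_cons, List.count_cons]
        rw [ih t (by simp), ← ih' fun s hs => ih s (by simp [hs])]
        push_cast
        by_cases h : t.root = a <;> simp [h] <;> ring
    rw [← this]
    by_cases h : b = a <;> simp [h]

/-- A tree is a root type together with the list of its children. -/
def equivNode (𝒳 : Type*) : 𝒳 × List (PTree 𝒳) ≃ PTree 𝒳 where
  toFun p := node p.1 p.2
  invFun t := (t.root, t.children)
  left_inv _ := rfl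
  right_inv t := by cases t; rfl

@[simp] theorem equivNode_apply (p : 𝒳 × List (PTree 𝒳)) :
    equivNode 𝒳 p = node p.1 p.2 := rfl

theorem mem_subtrees_children {a : 𝒳} {ts : List (PTree 𝒳)} {t s : PTree 𝒳} (ht : t ∈ ts)
    (hs : s ∈ t.subtrees) : s ∈ (node a ts).subtrees := by
  rw [subtrees_node]
  simp only [List.mem_cons, List.mem_flatten, List.mem_map]
  exact Or.inr ⟨_, ⟨t, ht, rfl⟩, hs⟩

theorem vprod_ne_zero_iff {K : 𝒳 → List 𝒳 → ℝ≥0∞} {t : PTree 𝒳} :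
    vprod K t ≠ 0 ↔ ∀ s ∈ t.subtrees, K s.root s.childLabels ≠ 0 := by
  simp [vprod, List.prod_eq_zero_iff]

theorem vprod_child_ne_zero {K : 𝒳 → List 𝒳 → ℝ≥0∞} {a : 𝒳} {ts : List (PTree 𝒳)}
    (h : vprod K (node a ts) ≠ 0) {t : PTree 𝒳} (ht : t ∈ ts) : vprod K t ≠ 0 := by
  rw [vprod_ne_zero_iff] at h ⊢
  exact fun s hs => h s (mem_subtrees_children ht hs)

theorem kernel_ne_zero {K : 𝒳 → List 𝒳 → ℝ≥0∞} {a : 𝒳} {ts : List (PTree 𝒳)}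
    (h : vprod K (node a ts) ≠ 0) : K a (ts.map root) ≠ 0 :=
  vprod_ne_zero_iff.1 h _ (self_mem_subtrees _)

end PTree

section TreeSums

variable {𝒳 : Type*} [DecidableEq 𝒳]

theorem tsum_list_eq {α : Type*} (h : List α → ℝ≥0∞) :
    ∑' ts, h ts = h [] + ∑' p : α × List α, h (p.1 :: p.2) := by
  let e : Option (α × List α) ≃ List α :=
    { toFun := fun o => o.elim [] fun p => p.1 :: p.2
      invFun := fun l => match l with
        | [] => none
        | t :: ts => some (t, ts)
      left_inv := by rintro (_ | ⟨_, _⟩) <;> rfl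
      right_inv := by rintro (_ | ⟨_, _⟩) <;> rfl }
  rw [← e.tsum_eq, ENNReal.tsum_eq_add_tsum_ite (none : Option (α × List α)),
    ← (Option.some_injective (α × List α)).tsum_eq]
  · simp [e]
  · intro o ho
    cases o with
    | none => simp at ho
    | some p => exact ⟨p, rfl⟩

/-- The total weight of the lists with prescribed labels factorizes. -/
theorem tsum_list_map_eq {α : Type*} (r : α → 𝒳) (v : α → ℝ≥0∞) (c : List 𝒳) :
    ∑' ts : List α, (if ts.map r = c then (ts.map v).prod else 0)
      = (c.map fun b => ∑' t, if r t = b then v t else 0).prod := by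
  induction c with
  | nil => rw [tsum_list_eq]; simp
  | cons b c ih =>
    rw [tsum_list_eq, List.map_cons, List.prod_cons, ← ih]
    simp only [List.map_nil, List.nil_eq, reduceCtorEq, if_false, zero_add, List.map_cons,
      List.cons.injEq, List.prod_cons]
    rw [ENNReal.tsum_prod', ← ENNReal.tsum_mul_right]
    refine tsum_congr fun t => ?_
    rw [← ENNReal.tsum_mul_left]
    refine tsum_congr fun ts => ?_
    by_cases h1 : r t = b <;> by_cases h2 : ts.map r = c <;> simp [h1, h2]

/-- Recursive decomposition at the root of a sum over trees. -/
theorem tsum_tree_root (K : 𝒳 → List 𝒳 → ℝ≥0∞) (v : PTree 𝒳 → ℝ≥0∞) (a : 𝒳) :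
    ∑' t : PTree 𝒳, (if t.root = a then K a t.childLabels * (t.children.map v).prod else 0)
      = ∑' c, K a c * (c.map fun b => ∑' t : PTree 𝒳, if t.root = b then v t else 0).prod := by
  rw [← (PTree.equivNode 𝒳).tsum_eq, ENNReal.tsum_prod', tsum_eq_single a]
  · simp only [← tsum_list_map_eq]
    simp only [PTree.equivNode_apply, PTree.root_node, if_true,
      PTree.childLabels_node, PTree.children_node, ← ENNReal.tsum_mul_left]
    rw [ENNReal.tsum_comm]
    refine tsum_congr fun ts => ?_
    rw [tsum_eq_single (ts.map PTree.root)]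
    · simp
    · intro c hc
      simp [hc.symm]
  · intro b hb
    simp [hb]

/-- The total weight of the trees with root type `a`. -/
noncomputable def treeSum (K : 𝒳 → List 𝒳 → ℝ≥0∞) (a : 𝒳) : ℝ≥0∞ :=
  ∑' t : PTree 𝒳, if t.root = a then t.vprod K else 0

theorem treeSum_eq (K : 𝒳 → List 𝒳 → ℝ≥0∞) (a : 𝒳) :
    treeSum K a = ∑' c, K a c * (c.map (treeSum K)).prod := by
  unfold treeSum
  rw [← tsum_tree_root]
  refine tsum_congr fun t => ?_
  cases t with
  | node b ts =>
    by_cases h : b = a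
    · subst h; simp [PTree.vprod_node]
    · simp [h]

/-- A substochastic kernel gives total weight at most one to finite trees. -/
theorem treeSum_le_one (K : 𝒳 → List 𝒳 → ℝ≥0∞) (hK : ∀ a, ∑' c, K a c ≤ 1) (a : 𝒳) :
    treeSum K a ≤ 1 := by
  have key : ∀ (n : ℕ) (a : 𝒳), ∑' t : PTree 𝒳, (if t.root = a then
      (if t.size ≤ n then t.vprod K else 0) else 0) ≤ 1 := by
    intro n
    induction n with
    | zero =>
      intro a
      have : ∀ t : PTree 𝒳, ¬ t.size ≤ 0 := fun t => by have := t.size_pos; omega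
      simp [this]
    | succ n ih =>
      intro a
      calc _ ≤ ∑' t : PTree 𝒳, (if t.root = a then K a t.childLabels *
            (t.children.map fun t => if t.size ≤ n then t.vprod K else 0).prod else 0) := by
            refine ENNReal.tsum_le_tsum fun t => ?_
            cases t with
            | node b ts =>
              by_cases h : b = a
              · subst h
                by_cases h2 : (PTree.node b ts).size ≤ n + 1
                · simp only [PTree.root_node, if_true, h2, PTree.vprod_node,
                    PTree.childLabels_node, PTree.children_node]
                  refine le_of_eq ?_
                  congr 2
                  refine List.map_congr_left fun t ht => ?_
                  have : t.size ≤ n := by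
                    rw [PTree.size_node] at h2
                    have := List.single_le_sum (l := ts.map PTree.size) (by simp) t.size
                      (List.mem_map_of_mem ht)
                    omega
                  simp [this]
                · simp [h2]
              · simp [h]
        _ = _ := tsum_tree_root _ _ _
        _ ≤ ∑' c, K a c := by
            refine ENNReal.tsum_le_tsum fun c => ?_
            calc _ ≤ K a c * 1 := by
                  gcongr
                  induction c with
                  | nil => simp
                  | cons b c ihc =>
                    rw [List.map_cons, List.prod_cons]
                    exact mul_le_one' (ih b) ihc
              _ = _ := mul_one _
        _ ≤ 1 := hK a
  unfold treeSum
  rw [ENNReal.tsum_eq_iSup_sum]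
  refine iSup_le fun s => ?_
  calc _ ≤ ∑ t ∈ s, (if t.root = a then
      (if t.size ≤ s.sup PTree.size then t.vprod K else 0) else 0) := by
        refine Finset.sum_le_sum fun t ht => ?_
        have : t.size ≤ s.sup PTree.size := Finset.le_sup ht
        simp [this]
    _ ≤ _ := ENNReal.sum_le_tsum _
    _ ≤ 1 := key _ a

end TreeSums

section Entropy

variable {𝒳 : Type*} [Fintype 𝒳] [DecidableEq 𝒳]

theorem hasSum_prod_fintype {β : Type*} {g : 𝒳 × β → ℝ} {s : 𝒳 → ℝ}
    (h : ∀ a, HasSum (fun c => g (a, c)) (s a)) : HasSum g (∑ a, s a) := by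
  have h1 : ∀ a ∈ Finset.univ, HasSum (fun x : 𝒳 × β => if x.1 = a then g x else 0) (s a) := by
    intro a _
    rw [← (Prod.mk_right_injective a).hasSum_iff]
    · simpa [Function.comp_def] using h a
    · rintro ⟨b, c⟩ hx
      have : b ≠ a := by
        rintro rfl
        exact hx ⟨c, rfl⟩
      simp [this]
  simpa using hasSum_sum h1

/-- A function `H` such that the kernel `𝒬 e^H` is substochastic. -/
def SubTilt (𝒬 : 𝒳 → List 𝒳 → ℝ) (H : 𝒳 × List 𝒳 → ℝ) : Prop :=
  ∀ a, ∑' c, ENNReal.ofReal (𝒬 a c) * ENNReal.ofReal (Real.exp (H (a, c))) ≤ 1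

namespace IsOffMeasure

variable {ν : 𝒳 × List 𝒳 → ℝ}

theorem summable_fiber (h : IsOffMeasure ν) (a : 𝒳) : Summable fun c => ν (a, c) :=
  h.hasSum.summable.comp_injective (Prod.mk_right_injective a)

theorem hasSum_marg1 (h : IsOffMeasure ν) (a : 𝒳) : HasSum (fun c => ν (a, c)) (marg1 ν a) :=
  (h.summable_fiber a).hasSum

theorem marg1_nonneg (h : IsOffMeasure ν) (a : 𝒳) : 0 ≤ marg1 ν a :=
  tsum_nonneg fun _ => h.nonneg _

theorem sum_marg1 (h : IsOffMeasure ν) : ∑ a, marg1 ν a = 1 :=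
  (hasSum_prod_fintype h.hasSum_marg1).unique h.hasSum

theorem hasSum_mul_fst (h : IsOffMeasure ν) (u : 𝒳 → ℝ) :
    HasSum (fun x => ν x * u x.1) (∑ a, marg1 ν a * u a) :=
  hasSum_prod_fintype fun a => (h.hasSum_marg1 a).mul_right (u a)

theorem hasSum_marg1_mul (ν : 𝒳 × List 𝒳 → ℝ) {k : 𝒳 × List 𝒳 → ℝ} {u : 𝒳 → ℝ}
    (hk : ∀ a, HasSum (fun c => k (a, c)) (u a)) :
    HasSum (fun x => marg1 ν x.1 * k x) (∑ a, marg1 ν a * u a) :=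
  hasSum_prod_fintype fun a => (hk a).mul_left _

theorem summable_of_bounded (h : IsOffMeasure ν) {f : 𝒳 × List 𝒳 → ℝ} {C : ℝ}
    (hf : ∀ x, |f x| ≤ C * (1 + x.2.length)) : Summable fun x => ν x * f x := by
  refine Summable.of_norm_bounded (g := fun x => C * (ν x + x.2.length * ν x))
    ((h.hasSum.summable.add h.moment).mul_left C) fun x => ?_
  rw [Real.norm_eq_abs, abs_mul, abs_of_nonneg (h.nonneg x)]
  nlinarith [mul_le_mul_of_nonneg_left (hf x) (h.nonneg x)]

end IsOffMeasure

theorem mul_le_entropy_add {p r z : ℝ} (hp : 0 ≤ p) (hr : 0 ≤ r) (hpr : r = 0 → p = 0) :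
    p * z ≤ (p * Real.log (p / r) + r - p) + (r * Real.exp z - r) := by
  rcases hp.eq_or_lt with rfl | hp
  · simp; positivity
  · have hr' : 0 < r := lt_of_le_of_ne hr fun h => hp.ne' (hpr h.symm)
    have hx : 0 < r * Real.exp z / p := by positivity
    have h1 := Real.log_le_sub_one_of_pos hx
    rw [Real.log_div (by positivity) hp.ne', Real.log_mul hr'.ne' (Real.exp_pos z).ne',
      Real.log_exp] at h1
    rw [Real.log_div hp.ne' hr'.ne']
    have h2 := mul_le_mul_of_nonneg_left h1 hp.le
    have h3 : p * (r * Real.exp z / p - 1) = r * Real.exp z - p := by field_simp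
    rw [h3] at h2
    nlinarith

theorem entropy_term_nonneg {p r : ℝ} (hp : 0 ≤ p) (hr : 0 ≤ r) (hpr : r = 0 → p = 0) :
    0 ≤ p * Real.log (p / r) + r - p := by
  have := mul_le_entropy_add (z := 0) hp hr hpr
  simpa using this

variable {𝒬 : 𝒳 → List 𝒳 → ℝ}

theorem SubTilt.summable (h𝒬 : ∀ a c, 0 ≤ 𝒬 a c) {H : 𝒳 × List 𝒳 → ℝ} (hH : SubTilt 𝒬 H)
    (a : 𝒳) : Summable (fun c => 𝒬 a c * Real.exp (H (a, c))) ∧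
      ∑' c, 𝒬 a c * Real.exp (H (a, c)) ≤ 1 := by
  have h0 : ∀ c, 0 ≤ 𝒬 a c * Real.exp (H (a, c)) :=
    fun c => mul_nonneg (h𝒬 a c) (Real.exp_pos _).le
  have h1 := hH a
  simp only [← ENNReal.ofReal_mul (h𝒬 a _)] at h1
  have hs : Summable (fun c => 𝒬 a c * Real.exp (H (a, c))) := by
    have := ENNReal.summable_toReal (ne_top_of_le_ne_top ENNReal.one_ne_top h1)
    simpa [ENNReal.toReal_ofReal, h0] using this
  refine ⟨hs, ?_⟩
  rw [← ENNReal.ofReal_tsum_of_nonneg h0 hs] at h1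
  exact ENNReal.ofReal_le_one.1 h1

/-- Easy half of the variational formula for the relative entropy. -/
theorem tilt_le_relEnt (h𝒬 : ∀ a c, 0 ≤ 𝒬 a c) (h𝒬1 : ∀ a, HasSum (𝒬 a) 1)
    {ν : 𝒳 × List 𝒳 → ℝ} (hν : IsOffMeasure ν) {H : 𝒳 × List 𝒳 → ℝ} (hH : SubTilt 𝒬 H)
    (hs : Summable fun x => ν x * H x) :
    ENNReal.ofReal (∑' x, ν x * H x) ≤ relEnt ν (fun x => marg1 ν x.1 * 𝒬 x.1 x.2) := by
  unfold relEnt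
  split_ifs with hac
  swap
  · exact le_top
  set ρ : 𝒳 × List 𝒳 → ℝ := fun x => marg1 ν x.1 * 𝒬 x.1 x.2 with hρ
  have hρ0 : ∀ x, 0 ≤ ρ x := fun x => mul_nonneg (hν.marg1_nonneg _) (h𝒬 _ _)
  set h : 𝒳 × List 𝒳 → ℝ := fun x => ν x * Real.log (ν x / ρ x) + ρ x - ν x
  have hh0 : ∀ x, 0 ≤ h x := fun x => entropy_term_nonneg (hν.nonneg x) (hρ0 x) (hac x)
  by_cases htop : ∑' x, ENNReal.ofReal (h x) = ∞
  · exact htop ▸ le_top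
  have hsum : Summable h := by
    have := ENNReal.summable_toReal htop
    simpa [ENNReal.toReal_ofReal, hh0] using this
  change _ ≤ ∑' x, ENNReal.ofReal (h x)
  rw [← ENNReal.ofReal_tsum_of_nonneg hh0 hsum]
  refine ENNReal.ofReal_le_ofReal ?_
  have hρsum : HasSum ρ 1 := by
    have := IsOffMeasure.hasSum_marg1_mul ν (k := fun x => 𝒬 x.1 x.2) (u := fun _ => 1) h𝒬1
    simpa [hν.sum_marg1] using this
  have hexp := IsOffMeasure.hasSum_marg1_mul ν
    (k := fun x => 𝒬 x.1 x.2 * Real.exp (H x)) (fun a => (hH.summable h𝒬 a).1.hasSum)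
  have hle : ∑ a, marg1 ν a * (∑' c, 𝒬 a c * Real.exp (H (a, c))) ≤ 1 := by
    rw [← hν.sum_marg1]
    refine Finset.sum_le_sum fun a _ => ?_
    exact mul_le_of_le_one_right (hν.marg1_nonneg a) (hH.summable h𝒬 a).2
  have hfin := (hsum.hasSum.add (hexp.sub hρsum))
  have := hasSum_le (fun x => ?_) hs.hasSum hfin
  · linarith
  · have := mul_le_entropy_add (z := H x) (hν.nonneg x) (hρ0 x) (hac x)
    simp only [hρ, h] at this ⊢
    linarith

/-- Finite tilts: the function `g` on the finite set `B`, compensated. -/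
theorem exists_subTilt_finset (h𝒬 : ∀ a c, 0 ≤ 𝒬 a c) (h𝒬1 : ∀ a, HasSum (𝒬 a) 1)
    {ν : 𝒳 × List 𝒳 → ℝ} (hν : IsOffMeasure ν) (B : Finset (𝒳 × List 𝒳))
    (g : 𝒳 × List 𝒳 → ℝ) :
    ∃ H : 𝒳 × List 𝒳 → ℝ, (∃ M, ∀ x, |H x| ≤ M) ∧ SubTilt 𝒬 H ∧
      ∑' x, ν x * H x = ∑ x ∈ B, (ν x * g x
        - marg1 ν x.1 * 𝒬 x.1 x.2 * (Real.exp (g x) - 1)) := by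
  set G : 𝒳 × List 𝒳 → ℝ := fun x => if x ∈ B then g x else 0
  set k : 𝒳 × List 𝒳 → ℝ := fun x => 𝒬 x.1 x.2 * (Real.exp (G x) - 1) with hk
  have hk0 : ∀ x ∉ B, k x = 0 := fun x hx => by simp [k, G, hx]
  set U : 𝒳 → ℝ := fun a => ∑' c, k (a, c) with hU
  have hks : ∀ a, HasSum (fun c => k (a, c)) (U a) := by
    intro a
    refine (summable_of_ne_finset_zero (s := B.image Prod.snd) fun c hc => hk0 _ ?_).hasSum
    exact fun h => hc (Finset.mem_image_of_mem Prod.snd h)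
  refine ⟨fun x => G x - U x.1, ⟨∑ x ∈ B, |g x| + ∑ a, |U a|, fun x => ?_⟩, fun a => ?_, ?_⟩
  · refine (abs_sub _ _).trans (add_le_add ?_ ?_)
    · by_cases hx : x ∈ B
      · simp only [G, hx, if_true]
        exact Finset.single_le_sum (f := fun x => |g x|) (fun _ _ => abs_nonneg _) hx
      · simp only [G, hx, if_false, abs_zero]
        exact Finset.sum_nonneg fun _ _ => abs_nonneg _
    · exact Finset.single_le_sum (f := fun a => |U a|) (fun _ _ => abs_nonneg _)
        (Finset.mem_univ _)
  · have h1 : HasSum (fun c => 𝒬 a c * Real.exp (G (a, c) - U a))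
        ((1 + U a) * Real.exp (-U a)) := by
      have := ((h𝒬1 a).add (hks a)).mul_right (Real.exp (-U a))
      refine this.congr_fun fun c => ?_
      rw [sub_eq_add_neg, Real.exp_add]
      simp only [k]
      ring
    simp only [← ENNReal.ofReal_mul (h𝒬 a _)]
    rw [← ENNReal.ofReal_tsum_of_nonneg
      (fun c => mul_nonneg (h𝒬 a c) (Real.exp_pos _).le) h1.summable, h1.tsum_eq]
    refine ENNReal.ofReal_le_one.2 ?_
    rw [Real.exp_neg, ← div_eq_mul_inv, div_le_one (Real.exp_pos _), add_comm]
    exact Real.add_one_le_exp _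
  · have h1 : HasSum (fun x => ν x * G x) (∑ x ∈ B, ν x * g x) := by
      have : HasSum (fun x => ν x * G x) (∑ x ∈ B, ν x * G x) :=
        hasSum_sum_of_ne_finset_zero fun x hx => by simp [G, hx]
      have h0 : ∑ x ∈ B, ν x * G x = ∑ x ∈ B, ν x * g x :=
        Finset.sum_congr rfl fun x hx => by simp [G, hx]
      rwa [h0] at this
    have h2 := hν.hasSum_mul_fst U
    have h3 := IsOffMeasure.hasSum_marg1_mul ν hks
    have h4 : HasSum (fun x : 𝒳 × List 𝒳 => marg1 ν x.1 * k x) (∑ x ∈ B, marg1 ν x.1 * k x) :=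
      hasSum_sum_of_ne_finset_zero fun x hx => by simp [hk0 x hx]
    rw [← h4.unique h3] at h2
    have h5 := h1.sub h2
    simp only [mul_sub] at h5 ⊢
    rw [h5.tsum_eq, ← Finset.sum_sub_distrib]
    refine Finset.sum_congr rfl fun x hx => ?_
    simp only [k, G, hx, if_true]
    ring

/-- Hard half of the variational formula for the relative entropy. -/
theorem exists_subTilt_of_lt_relEnt (h𝒬 : ∀ a c, 0 ≤ 𝒬 a c) (h𝒬1 : ∀ a, HasSum (𝒬 a) 1)
    {ν : 𝒳 × List 𝒳 → ℝ} (hν : IsOffMeasure ν) {α : ℝ}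
    (hα : ENNReal.ofReal α < relEnt ν (fun x => marg1 ν x.1 * 𝒬 x.1 x.2)) :
    ∃ H : 𝒳 × List 𝒳 → ℝ, (∃ M, ∀ x, |H x| ≤ M) ∧ SubTilt 𝒬 H ∧ α < ∑' x, ν x * H x := by
  suffices h : ∃ (B : Finset (𝒳 × List 𝒳)) (g : 𝒳 × List 𝒳 → ℝ),
      α < ∑ x ∈ B, (ν x * g x - marg1 ν x.1 * 𝒬 x.1 x.2 * (Real.exp (g x) - 1)) by
    obtain ⟨B, g, hB⟩ := h
    obtain ⟨H, h1, h2, h3⟩ := exists_subTilt_finset h𝒬 h𝒬1 hν B g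
    exact ⟨H, h1, h2, h3 ▸ hB⟩
  unfold relEnt at hα
  split_ifs at hα with hac
  · rw [ENNReal.tsum_eq_iSup_sum, lt_iSup_iff] at hα
    obtain ⟨B, hB⟩ := hα
    have hρ0 : ∀ x : 𝒳 × List 𝒳, 0 ≤ marg1 ν x.1 * 𝒬 x.1 x.2 :=
      fun x => mul_nonneg (hν.marg1_nonneg _) (h𝒬 _ _)
    rw [← ENNReal.ofReal_sum_of_nonneg
      (fun x _ => entropy_term_nonneg (hν.nonneg x) (hρ0 x) (hac x))] at hB
    have hB' := lt_of_not_ge fun h => (ENNReal.ofReal_le_ofReal h).not_gt hB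
    set ρ : 𝒳 × List 𝒳 → ℝ := fun x => marg1 ν x.1 * 𝒬 x.1 x.2 with hρ
    set gT : ℝ → 𝒳 × List 𝒳 → ℝ := fun T x => if ν x = 0 then -T else Real.log (ν x / ρ x)
      with hgT
    have hlim : Tendsto (fun T => ∑ x ∈ B, (ν x * gT T x - ρ x * (Real.exp (gT T x) - 1)))
        atTop (nhds (∑ x ∈ B, (ν x * Real.log (ν x / ρ x) + ρ x - ν x))) := by
      refine tendsto_finsetSum _ fun x _ => ?_
      by_cases hx : ν x = 0
      · simp only [hgT, hx, if_true, zero_mul, zero_add, zero_sub, sub_zero]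
        have := ((Real.tendsto_exp_neg_atTop_nhds_zero.sub_const 1).const_mul (ρ x)).neg
        simpa using this
      · simp only [hgT, hx, if_false]
        have h1 : ρ x ≠ 0 := fun h => hx (hac x h)
        have h2 : 0 < ν x / ρ x := div_pos ((hν.nonneg x).lt_of_ne' hx) ((hρ0 x).lt_of_ne' h1)
        rw [Real.exp_log h2]
        refine tendsto_const_nhds.congr fun _ => ?_
        field_simp
        ring
    obtain ⟨T, hT⟩ := (hlim.eventually (lt_mem_nhds hB')).exists
    exact ⟨B, gT T, hT⟩
  · push Not at hac
    obtain ⟨x, hx0, hx⟩ := hac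
    refine ⟨{x}, fun _ => (α + 1) / ν x, ?_⟩
    rw [Finset.sum_singleton, hx0]
    field_simp
    simp

end Entropy

section OffSpace

variable {𝒳 : Type*} [Fintype 𝒳] [DecidableEq 𝒳]

/-- Linear growth of a function of the offspring. -/
def LinGrowth (C : ℝ) (f : 𝒳 × List 𝒳 → ℝ) : Prop := ∀ x, |f x| ≤ C * (1 + x.2.length)

theorem linGrowth_of_bounded {M : ℝ} {f : 𝒳 × List 𝒳 → ℝ} (h : ∀ x, |f x| ≤ M) :
    LinGrowth M f := by
  intro x
  have h0 : 0 ≤ M := (abs_nonneg _).trans (h x)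
  have : (0 : ℝ) ≤ x.2.length := Nat.cast_nonneg _
  nlinarith [h x]

theorem exists_linGrowth {f : 𝒳 × List 𝒳 → ℝ} (hf : f ∈ offTests 𝒳) : ∃ C, LinGrowth C f := by
  rcases hf with ⟨M, hM⟩ | ⟨a, b, rfl⟩
  · exact ⟨M, linGrowth_of_bounded hM⟩
  · refine ⟨1, fun x => ?_⟩
    have h1 : (mult a x.2 : ℝ) ≤ x.2.length := by
      exact_mod_cast List.count_le_length
    have h2 : (0 : ℝ) ≤ mult a x.2 := Nat.cast_nonneg _
    dsimp only
    split_ifs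
    · rw [mul_one, abs_of_nonneg h2]; linarith
    · simp; positivity

/-- The function `len · 1_{len ≥ ℓ}`. -/
noncomputable def tailLen (ℓ : ℕ) (x : 𝒳 × List 𝒳) : ℝ :=
  if ℓ ≤ x.2.length then x.2.length else 0

theorem tailLen_nonneg (ℓ : ℕ) (x : 𝒳 × List 𝒳) : 0 ≤ tailLen ℓ x := by
  unfold tailLen; split_ifs <;> positivity

theorem linGrowth_tailLen (ℓ : ℕ) : LinGrowth 1 (tailLen ℓ : 𝒳 × List 𝒳 → ℝ) := by
  intro x
  have : (0 : ℝ) ≤ x.2.length := Nat.cast_nonneg _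
  unfold tailLen
  split_ifs
  · rw [abs_of_nonneg this]; linarith
  · simp; linarith

/-- The finite set of offspring with fewer than `ℓ` children. -/
noncomputable def shortOff (𝒳 : Type*) [Fintype 𝒳] (ℓ : ℕ) : Finset (𝒳 × List 𝒳) :=
  (Set.finite_univ.prod (List.finite_length_lt 𝒳 ℓ)).toFinset

theorem mem_shortOff {ℓ : ℕ} {x : 𝒳 × List 𝒳} : x ∈ shortOff 𝒳 ℓ ↔ x.2.length < ℓ := by
  simp [shortOff]

theorem summable_mul_of_linGrowth {p f : 𝒳 × List 𝒳 → ℝ} {C : ℝ} (hp : ∀ x, 0 ≤ p x)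
    (hs : Summable fun x => p x * (1 + x.2.length)) (hf : LinGrowth C f) :
    Summable fun x => p x * f x := by
  refine Summable.of_norm_bounded (hs.mul_left C) fun x => ?_
  rw [Real.norm_eq_abs, abs_mul, abs_of_nonneg (hp x)]
  nlinarith [mul_le_mul_of_nonneg_left (hf x) (hp x)]

theorem abs_tsum_sub_sum_shortOff_le {p f : 𝒳 × List 𝒳 → ℝ} {C δ : ℝ} (hp : ∀ x, 0 ≤ p x)
    (hs : Summable fun x => p x * (1 + x.2.length)) (hC : 0 ≤ C) (hf : LinGrowth C f) {ℓ : ℕ}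
    (hℓ : 1 ≤ ℓ) (htail : ∑' x, p x * tailLen ℓ x ≤ δ) :
    |∑' x, p x * f x - ∑ x ∈ shortOff 𝒳 ℓ, p x * f x| ≤ 2 * C * δ := by
  have h1 := (summable_mul_of_linGrowth hp hs hf).hasSum
  have h2 : HasSum (fun x => if x ∈ shortOff 𝒳 ℓ then p x * f x else 0)
      (∑ x ∈ shortOff 𝒳 ℓ, p x * f x) := by
    have : HasSum (fun x => if x ∈ shortOff 𝒳 ℓ then p x * f x else 0)
        (∑ x ∈ shortOff 𝒳 ℓ, if x ∈ shortOff 𝒳 ℓ then p x * f x else 0) :=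
      hasSum_sum_of_ne_finset_zero fun x hx => if_neg hx
    rwa [Finset.sum_congr rfl fun x hx => if_pos hx] at this
  have h3 := (summable_mul_of_linGrowth hp hs (linGrowth_tailLen ℓ)).hasSum.mul_left (2 * C)
  have hb : ∀ x, ‖p x * f x - (if x ∈ shortOff 𝒳 ℓ then p x * f x else 0)‖
      ≤ 2 * C * (p x * tailLen ℓ x) := by
    intro x
    split_ifs with hx
    · simp only [sub_self, norm_zero]
      exact mul_nonneg (by positivity) (mul_nonneg (hp x) (tailLen_nonneg _ _))
    · rw [mem_shortOff, not_lt] at hx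
      rw [sub_zero, Real.norm_eq_abs, abs_mul, abs_of_nonneg (hp x)]
      have h4 : (1 : ℝ) ≤ x.2.length := by exact_mod_cast hℓ.trans hx
      have h5 : |f x| ≤ 2 * C * x.2.length := (hf x).trans (by nlinarith)
      simp only [tailLen, hx, if_true]
      nlinarith [mul_le_mul_of_nonneg_left h5 (hp x)]
  rw [← (h1.sub h2).tsum_eq, ← Real.norm_eq_abs]
  refine (tsum_of_norm_bounded h3 hb).trans ?_
  gcongr

namespace IsOffMeasure

theorem summable_weight {ν : 𝒳 × List 𝒳 → ℝ} (h : IsOffMeasure ν) :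
    Summable fun x => ν x * (1 + (x.2.length : ℝ)) := by
  refine h.summable_of_bounded (C := 1) fun x => ?_
  rw [abs_of_nonneg (by positivity), one_mul]

theorem summable_mul {ν : 𝒳 × List 𝒳 → ℝ} (h : IsOffMeasure ν) {f : 𝒳 × List 𝒳 → ℝ} {C : ℝ}
    (hf : LinGrowth C f) : Summable fun x => ν x * f x := h.summable_of_bounded hf

end IsOffMeasure

namespace MSpace

/-- The integral of `f` with respect to `ν`. -/
noncomputable def pair (f : 𝒳 × List 𝒳 → ℝ) (ν : MSpace 𝒳) : ℝ := ∑' x, ν.1 x * f x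

theorem continuous_pair {f : 𝒳 × List 𝒳 → ℝ} (hf : f ∈ offTests 𝒳) : Continuous (pair f) := by
  have h1 : Continuous fun ν : MSpace 𝒳 => fun g : offTests 𝒳 => ∑' x, ν.1 x * g.1 x :=
    continuous_induced_dom
  exact (continuous_apply (⟨f, hf⟩ : offTests 𝒳)).comp h1

theorem continuous_pair_of_bounded {f : 𝒳 × List 𝒳 → ℝ} {M : ℝ} (hf : ∀ x, |f x| ≤ M) :
    Continuous (pair f) := continuous_pair (Or.inl ⟨M, hf⟩)

theorem le_nhds_iff {l : Filter (MSpace 𝒳)} {ν : MSpace 𝒳} :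
    l ≤ nhds ν ↔ ∀ f ∈ offTests 𝒳, Tendsto (pair f) l (nhds (pair f ν)) := by
  rw [nhds_induced, ← tendsto_iff_comap, tendsto_pi_nhds]
  exact ⟨fun h f hf => h ⟨f, hf⟩, fun h f => h f.1 f.2⟩

theorem exists_tests {O : Set (MSpace 𝒳)} {ν : MSpace 𝒳} (hO : O ∈ nhds ν) :
    ∃ (I : Finset (offTests 𝒳)) (δ : ℝ), 0 < δ ∧
      ∀ ν' : MSpace 𝒳, (∀ f ∈ I, |pair f.1 ν' - pair f.1 ν| < δ) → ν' ∈ O := by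
  rw [mem_nhds_induced] at hO
  obtain ⟨u, hu, huO⟩ := hO
  rw [nhds_pi, Filter.mem_pi] at hu
  obtain ⟨I, hI, t, ht, htu⟩ := hu
  have : ∀ f : offTests 𝒳, ∃ δ > 0, Metric.ball (pair f.1 ν) δ ⊆ t f :=
    fun f => Metric.mem_nhds_iff.1 (ht f)
  choose d hd hdt using this
  obtain ⟨δ, hδ, hδ'⟩ : ∃ δ > 0, ∀ f ∈ hI.toFinset, δ ≤ d f := by
    rcases hI.toFinset.eq_empty_or_nonempty with h | h
    · exact ⟨1, one_pos, by simp [h]⟩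
    · obtain ⟨f, hf, hmin⟩ := hI.toFinset.exists_min_image d h
      exact ⟨d f, hd f, hmin⟩
  refine ⟨hI.toFinset, δ, hδ, fun ν' h => huO (htu fun f hf => hdt f ?_)⟩
  have hf' := hI.mem_toFinset.2 hf
  rw [Metric.mem_ball, Real.dist_eq]
  exact (h f hf').trans_le (hδ' f hf')

/-- The defect of shift-invariance at `a`. -/
noncomputable def defect (a : 𝒳) (ν : MSpace 𝒳) : ℝ :=
  marg1 ν.1 a - ∑' x : 𝒳 × List 𝒳, (mult a x.2 : ℝ) * ν.1 x

theorem shiftInv_iff (ν : MSpace 𝒳) : ShiftInv ν.1 ↔ ∀ a, defect a ν = 0 :=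
  forall_congr' fun _ => sub_eq_zero.symm

theorem linGrowth_mult (a : 𝒳) : LinGrowth 1 (fun x : 𝒳 × List 𝒳 => (mult a x.2 : ℝ)) := by
  intro x
  have h1 : (mult a x.2 : ℝ) ≤ x.2.length := by exact_mod_cast List.count_le_length
  have h2 : (0 : ℝ) ≤ mult a x.2 := Nat.cast_nonneg _
  rw [abs_of_nonneg h2]; linarith

theorem defect_eq (a : 𝒳) (ν : MSpace 𝒳) :
    defect a ν = pair (fun x => if x.1 = a then 1 else 0) ν -
      ∑ b, pair (fun x => (mult a x.2 : ℝ) * (if x.1 = b then 1 else 0)) ν := by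
  unfold defect
  congr 1
  · have := (ν.2.hasSum_mul_fst (fun b => if b = a then 1 else 0)).tsum_eq
    simpa [pair] using this.symm
  · have h : ∀ b ∈ Finset.univ, HasSum
        (fun x : 𝒳 × List 𝒳 => ν.1 x * ((mult a x.2 : ℝ) * (if x.1 = b then 1 else 0)))
        (pair (fun x => (mult a x.2 : ℝ) * (if x.1 = b then 1 else 0)) ν) := by
      intro b _
      obtain ⟨C, hC⟩ := exists_linGrowth (𝒳 := 𝒳)
        (f := fun x => (mult a x.2 : ℝ) * (if x.1 = b then 1 else 0)) (Or.inr ⟨a, b, rfl⟩)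
      exact (ν.2.summable_mul hC).hasSum
    rw [← (hasSum_sum h).tsum_eq]
    refine tsum_congr fun x => ?_
    simp [mul_comm]

theorem continuous_defect (a : 𝒳) : Continuous (defect a : MSpace 𝒳 → ℝ) := by
  rw [funext (defect_eq a)]
  refine (continuous_pair_of_bounded (M := 1) fun x => ?_).sub
    (continuous_finsetSum _ fun b _ => continuous_pair (Or.inr ⟨a, b, rfl⟩))
  split_ifs <;> simp

/-- Measures with prescribed tails of the offspring number. -/
def tailSet (𝒳 : Type*) [Fintype 𝒳] [DecidableEq 𝒳] (ℓ : ℕ → ℕ) : Set (MSpace 𝒳) :=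
  {ν | ∀ k : ℕ, pair (tailLen (ℓ k)) ν ≤ 1 / ((k : ℝ) + 1)}

theorem isCompact_tailSet {ℓ : ℕ → ℕ} (hℓ : ∀ k, 1 ≤ ℓ k) : IsCompact (tailSet 𝒳 ℓ) := by
  rw [isCompact_iff_ultrafilter_le_nhds]
  intro U hU
  have hUK : ∀ᶠ ν in (U : Filter (MSpace 𝒳)), ν ∈ tailSet 𝒳 ℓ := le_principal_iff.1 hU
  have hlim : ∀ x, ∃ p : ℝ, 0 ≤ p ∧
      Tendsto (fun ν : MSpace 𝒳 => ν.1 x) U (nhds p) := by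
    intro x
    have hmem : (U.map fun ν : MSpace 𝒳 => ν.1 x : Filter ℝ) ≤ 𝓟 (Set.Icc 0 1) := by
      rw [le_principal_iff]
      refine mem_map.2 (univ_mem' fun ν => ?_)
      exact ⟨ν.2.nonneg x, le_hasSum ν.2.hasSum x fun y _ => ν.2.nonneg y⟩
    obtain ⟨p, hp, hp'⟩ := isCompact_Icc.ultrafilter_le_nhds (U.map fun ν => ν.1 x) hmem
    exact ⟨p, hp.1, hp'⟩
  choose p hp0 hp using hlim
  have hfin : ∀ (A : Finset (𝒳 × List 𝒳)) (f : 𝒳 × List 𝒳 → ℝ),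
      Tendsto (fun ν : MSpace 𝒳 => ∑ x ∈ A, ν.1 x * f x) U (nhds (∑ x ∈ A, p x * f x)) :=
    fun A f => tendsto_finsetSum _ fun x _ => (hp x).mul_const _
  have hbd : ∀ (f : 𝒳 × List 𝒳 → ℝ) (C c : ℝ), (∀ x, 0 ≤ f x) → LinGrowth C f →
      (∀ ν ∈ tailSet 𝒳 ℓ, pair f ν ≤ c) → ∀ A : Finset (𝒳 × List 𝒳), ∑ x ∈ A, p x * f x ≤ c := by
    intro f C c hf0 hfC hc A
    refine le_of_tendsto (hfin A f) ?_
    filter_upwards [hUK] with ν hν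
    exact ((ν.2.summable_mul hfC).sum_le_tsum A
      fun x _ => mul_nonneg (ν.2.nonneg x) (hf0 x)).trans (hc ν hν)
  have hsumm : Summable fun x => p x * (1 + (x.2.length : ℝ)) := by
    refine summable_of_sum_le (c := 1 + ℓ 0 + 1)
      (fun x => mul_nonneg (hp0 x) (by positivity)) ?_
    refine hbd (fun x => 1 + x.2.length) 1 _ (fun x => by positivity)
      (fun x => by rw [abs_of_nonneg (by positivity), one_mul]) fun ν hν => ?_
    have h0 := hν 0
    have h1 : HasSum (fun x => ν.1 x * ((1 + ℓ 0) + tailLen (ℓ 0) x))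
        ((1 + ℓ 0) + pair (tailLen (ℓ 0)) ν) := by
      have := (ν.2.hasSum.mul_right (1 + (ℓ 0 : ℝ))).add
        (ν.2.summable_mul (linGrowth_tailLen (ℓ 0))).hasSum
      simpa [mul_add, pair] using this
    have h2 : pair (fun x => 1 + (x.2.length : ℝ)) ν ≤ (1 + ℓ 0) + pair (tailLen (ℓ 0)) ν := by
      refine hasSum_le (fun x => ?_) ν.2.summable_weight.hasSum h1
      refine mul_le_mul_of_nonneg_left ?_ (ν.2.nonneg x)
      unfold tailLen
      split_ifs with h
      · have : (0 : ℝ) ≤ ℓ 0 := Nat.cast_nonneg _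
        linarith
      · have : (x.2.length : ℝ) ≤ ℓ 0 := by exact_mod_cast (not_le.1 h).le
        linarith
    have h3 : (1 : ℝ) / ((0 : ℕ) + 1) = 1 := by norm_num
    rw [h3] at h0
    linarith
  have hptail : ∀ k : ℕ, ∑' x, p x * tailLen (ℓ k) x ≤ 1 / ((k : ℝ) + 1) := by
    intro k
    refine (summable_mul_of_linGrowth hp0 hsumm (linGrowth_tailLen _)).tsum_le_of_sum_le ?_
    exact hbd _ 1 _ (tailLen_nonneg _) (linGrowth_tailLen _) fun ν hν => hν k
  have hconv : ∀ (f : 𝒳 × List 𝒳 → ℝ) (C : ℝ), LinGrowth C f →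
      Tendsto (pair f) U (nhds (∑' x, p x * f x)) := by
    intro f C hfC
    have hfC' : LinGrowth |C| f := fun x =>
      (hfC x).trans (mul_le_mul_of_nonneg_right (le_abs_self C) (by positivity))
    rw [Metric.tendsto_nhds]
    intro ε hε
    obtain ⟨k, hk⟩ : ∃ k : ℕ, 4 * |C| / (ε / 2) < k + 1 := by
      obtain ⟨k, hk⟩ := exists_nat_gt (4 * |C| / (ε / 2))
      exact ⟨k, by linarith⟩
    have hk' : 4 * |C| * (1 / ((k : ℝ) + 1)) < ε / 2 := by
      rw [div_lt_iff₀ (by positivity)] at hk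
      rw [mul_one_div, div_lt_iff₀ (by positivity)]
      linarith
    filter_upwards [hUK, (Metric.tendsto_nhds.1 (hfin (shortOff 𝒳 (ℓ k)) f)) (ε / 2)
      (by positivity)] with ν hν h1
    have h2 := abs_tsum_sub_sum_shortOff_le ν.2.nonneg ν.2.summable_weight (abs_nonneg C) hfC'
      (hℓ k) (hν k)
    have h3 := abs_tsum_sub_sum_shortOff_le hp0 hsumm (abs_nonneg C) hfC' (hℓ k) (hptail k)
    rw [Real.dist_eq] at h1 ⊢
    unfold pair
    rw [abs_lt] at h1 ⊢
    rw [abs_le] at h2 h3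
    constructor <;> linarith [h2.1, h2.2, h3.1, h3.2, h1.1, h1.2]
  have h1 : HasSum p 1 := by
    have hs : Summable p := by
      simpa using summable_mul_of_linGrowth (f := fun _ => 1) (C := 1) hp0 hsumm
        (linGrowth_of_bounded (by simp))
    have h2 := hconv (fun _ => 1) 1 (linGrowth_of_bounded (by simp))
    have h3 : ∀ ν : MSpace 𝒳, pair (fun _ => 1) ν = 1 := fun ν => by
      simpa [pair] using ν.2.hasSum.tsum_eq
    rw [funext h3] at h2
    have h4 := tendsto_nhds_unique h2 tendsto_const_nhds
    simp only [mul_one] at h4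
    exact h4 ▸ hs.hasSum
  have hoff : IsOffMeasure p := by
    refine ⟨hp0, h1, ?_⟩
    have := summable_mul_of_linGrowth (f := fun x => (x.2.length : ℝ)) (C := 1) hp0 hsumm
      (fun x => by rw [abs_of_nonneg (by positivity)]; linarith)
    simpa [mul_comm] using this
  refine ⟨⟨p, hoff⟩, hptail, le_nhds_iff.2 fun f hf => ?_⟩
  obtain ⟨C, hC⟩ := exists_linGrowth hf
  exact hconv f C hC

end MSpace

end OffSpace

section RateFunction

variable {𝒳 : Type*} [Fintype 𝒳] [DecidableEq 𝒳] {𝒬 : 𝒳 → List 𝒳 → ℝ}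

open MSpace

theorem exists_subTilt_tailLen (h𝒬 : ∀ a c, 0 ≤ 𝒬 a c) (h𝒬1 : ∀ a, HasSum (𝒬 a) 1)
    (hexp : ∀ (a : 𝒳) (η : ℝ), 0 < η →
      Summable (fun c : List 𝒳 => 𝒬 a c * Real.exp (η * c.length))) {η : ℝ} (hη : 0 < η) :
    ∃ ℓ : ℕ, 1 ≤ ℓ ∧ SubTilt 𝒬 (fun x => η * tailLen ℓ x - 1) := by
  have hle : ∀ (ℓ : ℕ) (a : 𝒳) (c : List 𝒳),
      𝒬 a c * Real.exp (η * tailLen ℓ (a, c)) ≤ 𝒬 a c * Real.exp (η * c.length) := by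
    intro ℓ a c
    refine mul_le_mul_of_nonneg_left (Real.exp_le_exp.2 ?_) (h𝒬 a c)
    refine mul_le_mul_of_nonneg_left ?_ hη.le
    unfold tailLen
    split_ifs <;> simp
  have h0 : ∀ (ℓ : ℕ) (a : 𝒳) (c : List 𝒳), 0 ≤ 𝒬 a c * Real.exp (η * tailLen ℓ (a, c)) :=
    fun ℓ a c => mul_nonneg (h𝒬 a c) (Real.exp_pos _).le
  have hlim : ∀ a, Tendsto (fun ℓ : ℕ => ∑' c, 𝒬 a c * Real.exp (η * tailLen ℓ (a, c))) atTop
      (nhds 1) := by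
    intro a
    rw [← (h𝒬1 a).tsum_eq]
    refine tendsto_tsum_of_dominated_convergence (hexp a η hη) (fun c => ?_) ?_
    · refine tendsto_const_nhds.congr' ?_
      filter_upwards [eventually_gt_atTop c.length] with ℓ hℓ
      simp [tailLen, not_le.2 hℓ]
    · refine Eventually.of_forall fun ℓ c => ?_
      rw [Real.norm_eq_abs, abs_of_nonneg (h0 ℓ a c)]
      exact hle ℓ a c
  have he : (1 : ℝ) < Real.exp 1 := Real.one_lt_exp_iff.2 one_pos
  have hev := eventually_all.2 fun a => (hlim a).eventually (ge_mem_nhds he)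
  obtain ⟨ℓ, h1, hℓ⟩ := ((eventually_ge_atTop 1).and hev).exists
  refine ⟨ℓ, h1, fun a => ?_⟩
  have hs : Summable fun c => 𝒬 a c * Real.exp (η * tailLen ℓ (a, c)) :=
    Summable.of_nonneg_of_le (h0 ℓ a) (hle ℓ a) (hexp a η hη)
  have hs' : HasSum (fun c => 𝒬 a c * Real.exp (η * tailLen ℓ (a, c) - 1))
      ((∑' c, 𝒬 a c * Real.exp (η * tailLen ℓ (a, c))) * Real.exp (-1)) := by
    refine (hs.hasSum.mul_right (Real.exp (-1))).congr_fun fun c => ?_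
    rw [sub_eq_add_neg, Real.exp_add, mul_assoc]
  simp only [← ENNReal.ofReal_mul (h𝒬 a _)]
  rw [← ENNReal.ofReal_tsum_of_nonneg
    (fun c => mul_nonneg (h𝒬 a c) (Real.exp_pos _).le) hs'.summable, hs'.tsum_eq]
  refine ENNReal.ofReal_le_one.2 ?_
  rw [Real.exp_neg, ← div_eq_mul_inv, div_le_one (Real.exp_pos _)]
  exact hℓ a

theorem linGrowth_subTilt_tailLen {η : ℝ} (hη : 0 < η) (ℓ : ℕ) :
    LinGrowth (η + 1) (fun x : 𝒳 × List 𝒳 => η * tailLen ℓ x - 1) := by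
  intro x
  have h1 : tailLen ℓ x ≤ x.2.length := by
    unfold tailLen
    split_ifs <;> simp
  have h2 := tailLen_nonneg ℓ x
  have h3 : (0 : ℝ) ≤ x.2.length := Nat.cast_nonneg _
  rw [abs_le]
  constructor <;> nlinarith [mul_le_mul_of_nonneg_left h1 hη.le, mul_nonneg hη.le h2]

theorem pair_le_of_offRate_le (h𝒬 : ∀ a c, 0 ≤ 𝒬 a c) (h𝒬1 : ∀ a, HasSum (𝒬 a) 1)
    {ν : MSpace 𝒳} {H : 𝒳 × List 𝒳 → ℝ} {C : ℝ} (hH : SubTilt 𝒬 H) (hC : LinGrowth C H)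
    {c : ℝ≥0∞} (hν : offRate 𝒬 ν.1 ≤ c) : ENNReal.ofReal (pair H ν) ≤ c := by
  refine le_trans ?_ hν
  unfold offRate
  split_ifs
  · exact tilt_le_relEnt h𝒬 h𝒬1 ν.2 hH (ν.2.summable_mul hC)
  · exact le_top

theorem offRate_le_iff (h𝒬 : ∀ a c, 0 ≤ 𝒬 a c) (h𝒬1 : ∀ a, HasSum (𝒬 a) 1)
    {ν : MSpace 𝒳} {c : ℝ≥0∞} (hc : c ≠ ∞) :
    offRate 𝒬 ν.1 ≤ c ↔ (∀ a, defect a ν = 0) ∧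
      ∀ H : 𝒳 × List 𝒳 → ℝ, (∃ M, ∀ x, |H x| ≤ M) → SubTilt 𝒬 H →
        ENNReal.ofReal (pair H ν) ≤ c := by
  constructor
  · intro h
    refine ⟨?_, fun H hM hH => ?_⟩
    · rw [← shiftInv_iff]
      by_contra hn
      unfold offRate at h
      rw [if_neg hn] at h
      exact hc (top_le_iff.1 h)
    · obtain ⟨M, hM⟩ := hM
      exact pair_le_of_offRate_le h𝒬 h𝒬1 hH (linGrowth_of_bounded hM) h
  · rintro ⟨h1, h2⟩
    unfold offRate
    rw [if_pos ((shiftInv_iff ν).2 h1)]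
    by_contra! h
    rw [← ENNReal.ofReal_toReal hc] at h
    obtain ⟨H, hM, hH, hlt⟩ := exists_subTilt_of_lt_relEnt h𝒬 h𝒬1 ν.2 h
    have h3 := h2 H hM hH
    rw [ENNReal.ofReal_le_iff_le_toReal hc] at h3
    exact absurd hlt (not_lt.2 h3)

theorem isClosed_offRate_le (h𝒬 : ∀ a c, 0 ≤ 𝒬 a c) (h𝒬1 : ∀ a, HasSum (𝒬 a) 1) (c : ℝ≥0∞) :
    IsClosed {ν : MSpace 𝒳 | offRate 𝒬 ν.1 ≤ c} := by
  by_cases hc : c = ∞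
  · simp [hc]
  · simp only [offRate_le_iff h𝒬 h𝒬1 hc, Set.ofPred_and, Set.ofPred_forall]
    refine (isClosed_iInter fun a => isClosed_eq (continuous_defect a) continuous_const).inter ?_
    refine isClosed_iInter fun H => isClosed_iInter fun hM => isClosed_iInter fun _ => ?_
    obtain ⟨M, hM⟩ := hM
    exact isClosed_le (ENNReal.continuous_ofReal.comp (continuous_pair_of_bounded hM))
      continuous_const

theorem isCompact_offRate_le (h𝒬 : ∀ a c, 0 ≤ 𝒬 a c) (h𝒬1 : ∀ a, HasSum (𝒬 a) 1)
    (hexp : ∀ (a : 𝒳) (η : ℝ), 0 < η →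
      Summable (fun c : List 𝒳 => 𝒬 a c * Real.exp (η * c.length))) {c : ℝ≥0∞} (hc : c ≠ ∞) :
    IsCompact {ν : MSpace 𝒳 | offRate 𝒬 ν.1 ≤ c} := by
  have hη : ∀ k : ℕ, 0 < ((k : ℝ) + 1) * (c.toReal + 1) := fun k =>
    mul_pos (by positivity) (by have := c.toReal_nonneg; linarith)
  choose ℓ hℓ1 hℓ using fun k : ℕ => exists_subTilt_tailLen h𝒬 h𝒬1 hexp (hη k)
  refine (isCompact_tailSet hℓ1).of_isClosed_subset (isClosed_offRate_le h𝒬 h𝒬1 c) ?_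
  intro ν hν k
  have h1 := pair_le_of_offRate_le h𝒬 h𝒬1 (hℓ k) (linGrowth_subTilt_tailLen (hη k) _) hν
  rw [ENNReal.ofReal_le_iff_le_toReal hc] at h1
  have h2 : pair (fun x => ((k : ℝ) + 1) * (c.toReal + 1) * tailLen (ℓ k) x - 1) ν
      = ((k : ℝ) + 1) * (c.toReal + 1) * pair (tailLen (ℓ k)) ν - 1 := by
    have h3 := ((ν.2.summable_mul (linGrowth_tailLen (ℓ k))).hasSum.mul_left
      (((k : ℝ) + 1) * (c.toReal + 1))).sub ν.2.hasSum
    refine Eq.trans (tsum_congr fun x => ?_) h3.tsum_eq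
    ring
  rw [h2] at h1
  rw [le_div_iff₀ (by positivity)]
  have h4 : 0 < c.toReal + 1 := by have := c.toReal_nonneg; linarith
  by_contra! h5
  nlinarith [mul_lt_mul_of_pos_right h5 h4]

theorem offRate_convex (h𝒬 : ∀ a c, 0 ≤ 𝒬 a c) (h𝒬1 : ∀ a, HasSum (𝒬 a) 1)
    (ν ν' : MSpace 𝒳) (θ : ℝ) (h0 : 0 ≤ θ) (h1 : θ ≤ 1)
    (h : IsOffMeasure (fun x => θ * ν.1 x + (1 - θ) * ν'.1 x)) :
    offRate 𝒬 (fun x => θ * ν.1 x + (1 - θ) * ν'.1 x)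
      ≤ ENNReal.ofReal θ * offRate 𝒬 ν.1 + ENNReal.ofReal (1 - θ) * offRate 𝒬 ν'.1 := by
  rcases h0.eq_or_lt with rfl | h0
  · simp
  rcases h1.eq_or_lt with rfl | h1
  · simp
  by_cases htop : offRate 𝒬 ν.1 = ∞
  · rw [htop, ENNReal.mul_top (by simpa using h0)]; simp
  by_cases htop' : offRate 𝒬 ν'.1 = ∞
  · rw [htop', ENNReal.mul_top (by simpa using h1)]; simp
  obtain ⟨m, hm⟩ : ∃ m : MSpace 𝒳, m.1 = fun x => θ * ν.1 x + (1 - θ) * ν'.1 x :=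
    ⟨⟨_, h⟩, rfl⟩
  rw [← hm]
  have hpair : ∀ {f : 𝒳 × List 𝒳 → ℝ} {C : ℝ}, LinGrowth C f →
      pair f m = θ * pair f ν + (1 - θ) * pair f ν' := by
    intro f C hf
    have h3 := ((ν.2.summable_mul hf).hasSum.mul_left θ).add
      ((ν'.2.summable_mul hf).hasSum.mul_left (1 - θ))
    refine Eq.trans (tsum_congr fun x => ?_) h3.tsum_eq
    rw [hm]
    ring
  have hν := (offRate_le_iff h𝒬 h𝒬1 htop).1 le_rfl
  have hν' := (offRate_le_iff h𝒬 h𝒬1 htop').1 le_rfl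
  refine (offRate_le_iff h𝒬 h𝒬1 (by finiteness)).2 ⟨fun a => ?_, fun H hM hH => ?_⟩
  · have e1 := hν.1 a
    have e2 := hν'.1 a
    rw [defect_eq] at e1 e2 ⊢
    rw [hpair (linGrowth_of_bounded (M := 1) fun x => by split_ifs <;> simp)]
    have : ∀ b, pair (fun x => (mult a x.2 : ℝ) * (if x.1 = b then 1 else 0))
        m = _ := fun b =>
      hpair (exists_linGrowth (𝒳 := 𝒳)
        (f := fun x => (mult a x.2 : ℝ) * (if x.1 = b then 1 else 0))
        (Or.inr ⟨a, b, rfl⟩)).choose_spec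
    simp only [this, Finset.sum_add_distrib, ← Finset.mul_sum]
    linear_combination θ * e1 + (1 - θ) * e2
  · have e1 := hν.2 H hM hH
    have e2 := hν'.2 H hM hH
    obtain ⟨M, hM⟩ := hM
    rw [hpair (linGrowth_of_bounded hM)]
    refine ENNReal.ofReal_add_le.trans ?_
    rw [ENNReal.ofReal_mul h0.le, ENNReal.ofReal_mul (by linarith)]
    gcongr

end RateFunction

section Empirical

variable {𝒳 : Type*} [Fintype 𝒳] [DecidableEq 𝒳] {𝒬 : 𝒳 → List 𝒳 → ℝ}

open MSpace

theorem hasSum_length_filter_mul (L : List (PTree 𝒳)) (f : 𝒳 × List 𝒳 → ℝ) :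
    HasSum (fun x : 𝒳 × List 𝒳 =>
      ((L.filter (fun s => s.root = x.1 ∧ s.childLabels = x.2)).length : ℝ) * f x)
      (L.map fun s => f (s.root, s.childLabels)).sum := by
  induction L with
  | nil => simp
  | cons s l ih =>
    have h1 : HasSum (fun x : 𝒳 × List 𝒳 =>
        if s.root = x.1 ∧ s.childLabels = x.2 then f x else 0) (f (s.root, s.childLabels)) := by
      have := hasSum_single (f := fun x : 𝒳 × List 𝒳 =>
        if s.root = x.1 ∧ s.childLabels = x.2 then f x else 0) (s.root, s.childLabels)
        fun x hx => if_neg fun h => hx (Prod.ext h.1.symm h.2.symm)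
      simpa using this
    rw [List.map_cons, List.sum_cons]
    refine (h1.add ih).congr_fun fun x => ?_
    rw [List.filter_cons]
    by_cases h : s.root = x.1 ∧ s.childLabels = x.2
    · simp only [h, and_self, decide_true, if_true, List.length_cons]
      push_cast
      ring
    · simp [h]

theorem hasSum_empOff (t : PTree 𝒳) (f : 𝒳 × List 𝒳 → ℝ) :
    HasSum (fun x => empOff t x * f x) (t.vsum f / t.size) := by
  refine ((hasSum_length_filter_mul t.subtrees f).div_const (t.size : ℝ)).congr_fun fun x => ?_
  unfold empOff
  ring

theorem isOffMeasure_empOff (t : PTree 𝒳) : IsOffMeasure (empOff t) := by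
  have hpos : (0 : ℝ) < t.size := by exact_mod_cast t.size_pos
  refine ⟨fun x => by unfold empOff; positivity, ?_, ?_⟩
  · have := hasSum_empOff t fun _ => 1
    rw [PTree.vsum_one, div_self hpos.ne'] at this
    simpa using this
  · have := (hasSum_empOff t fun x => (x.2.length : ℝ)).summable
    simpa only [mul_comm] using this

/-- The empirical offspring measure as a point of `ℳ(𝒳 × 𝒳*)`. -/
noncomputable def empM (t : PTree 𝒳) : MSpace 𝒳 := ⟨empOff t, isOffMeasure_empOff t⟩

theorem pair_empM (t : PTree 𝒳) (f : 𝒳 × List 𝒳 → ℝ) : pair f (empM t) = t.vsum f / t.size :=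
  (hasSum_empOff t f).tsum_eq

theorem vsum_eq_size_mul_pair (t : PTree 𝒳) (f : 𝒳 × List 𝒳 → ℝ) :
    t.vsum f = t.size * pair f (empM t) := by
  have hpos : (0 : ℝ) < t.size := by exact_mod_cast t.size_pos
  rw [pair_empM]
  field_simp

theorem defect_empM (a : 𝒳) (t : PTree 𝒳) :
    defect a (empM t) = (if t.root = a then 1 else 0) / t.size := by
  have h1 : marg1 (empM t).1 a = pair (fun x => if x.1 = a then 1 else 0) (empM t) := by
    have := ((empM t).2.hasSum_mul_fst (fun b => if b = a then 1 else 0)).tsum_eq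
    simpa [pair] using this.symm
  have h2 : ∑' x : 𝒳 × List 𝒳, (mult a x.2 : ℝ) * (empM t).1 x
      = pair (fun x => (x.2.count a : ℝ)) (empM t) :=
    tsum_congr fun x => mul_comm _ _
  rw [defect, h1, h2, pair_empM, pair_empM, PTree.vsum_count]
  ring

/-- The kernel with values in `[0, ∞]`. -/
noncomputable def offK (𝒬 : 𝒳 → List 𝒳 → ℝ) (a : 𝒳) (c : List 𝒳) : ℝ≥0∞ := ENNReal.ofReal (𝒬 a c)

theorem ofReal_mgwWeight (h𝒬 : ∀ a c, 0 ≤ 𝒬 a c) {μ0 : 𝒳 → ℝ} (hμ0 : ∀ a, 0 ≤ μ0 a)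
    (t : PTree 𝒳) : ENNReal.ofReal (mgwWeight μ0 𝒬 t)
      = ENNReal.ofReal (μ0 t.root) * t.vprod (offK 𝒬) := by
  unfold mgwWeight
  rw [ENNReal.ofReal_mul (hμ0 _)]
  congr 1
  exact PTree.vprod_ofReal 𝒬 h𝒬 t

theorem treeSum_offK_mul_exp (H : 𝒳 × List 𝒳 → ℝ) (a : 𝒳) :
    treeSum (fun a c => offK 𝒬 a c * ENNReal.ofReal (Real.exp (H (a, c)))) a
      = ∑' t : PTree 𝒳, if t.root = a then
        t.vprod (offK 𝒬) * ENNReal.ofReal (Real.exp (t.vsum H)) else 0 := by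
  unfold treeSum
  refine tsum_congr fun t => ?_
  rw [PTree.vprod_mul, PTree.vprod_exp]

theorem tsum_weight_exp_le_one (h𝒬 : ∀ a c, 0 ≤ 𝒬 a c) {μ0 : 𝒳 → ℝ} (hμ0 : ∀ a, 0 ≤ μ0 a)
    (hμ1 : ∑ a, μ0 a = 1) {H : 𝒳 × List 𝒳 → ℝ} (hH : SubTilt 𝒬 H) :
    ∑' t : PTree 𝒳, ENNReal.ofReal (mgwWeight μ0 𝒬 t) * ENNReal.ofReal (Real.exp (t.vsum H))
      ≤ 1 := by
  have h1 : ∀ t : PTree 𝒳, ENNReal.ofReal (mgwWeight μ0 𝒬 t) * ENNReal.ofReal (Real.exp (t.vsum H))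
      = ∑ a, ENNReal.ofReal (μ0 a) * (if t.root = a then
        t.vprod (offK 𝒬) * ENNReal.ofReal (Real.exp (t.vsum H)) else 0) := by
    intro t
    rw [Finset.sum_eq_single t.root (fun b _ hb => by rw [if_neg hb.symm, mul_zero])
      (fun h => absurd (Finset.mem_univ _) h), if_pos rfl, ofReal_mgwWeight h𝒬 hμ0, mul_assoc]
  simp only [h1]
  rw [Summable.tsum_finsetSum fun _ _ => ENNReal.summable]
  simp only [ENNReal.tsum_mul_left, ← treeSum_offK_mul_exp]
  calc ∑ a, ENNReal.ofReal (μ0 a) * treeSum (fun a c => offK 𝒬 a c *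
        ENNReal.ofReal (Real.exp (H (a, c)))) a
      ≤ ∑ a, ENNReal.ofReal (μ0 a) * 1 := by
        gcongr with a
        exact treeSum_le_one _ hH a
    _ = 1 := by
        simp only [mul_one]
        rw [← ENNReal.ofReal_sum_of_nonneg fun a _ => hμ0 a, hμ1, ENNReal.ofReal_one]

open Classical in
/-- The (unnormalized) probability that the tree has `n` vertices and its empirical
offspring measure lies in `s`. -/
noncomputable def empMass (w : PTree 𝒳 → ℝ) (n : ℕ) (s : Set (MSpace 𝒳)) : ℝ≥0∞ :=
  ∑' t : PTree 𝒳, if t.size = n ∧ empM t ∈ s then ENNReal.ofReal (w t) else 0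

theorem condP_eq (w : PTree 𝒳 → ℝ) (n : ℕ) (s : Set (MSpace 𝒳)) :
    condP w n {t | ∃ h : IsOffMeasure (empOff t), (⟨empOff t, h⟩ : MSpace 𝒳) ∈ s}
      = empMass w n s / treeMass w n := by
  have : {t | ∃ h : IsOffMeasure (empOff t), (⟨empOff t, h⟩ : MSpace 𝒳) ∈ s}
      = {t | empM t ∈ s} := by
    ext t
    exact ⟨fun h => h.2, fun h => ⟨isOffMeasure_empOff t, h⟩⟩
  rw [this]
  rfl

theorem empMass_mono (w : PTree 𝒳 → ℝ) (n : ℕ) {s s' : Set (MSpace 𝒳)} (h : s ⊆ s') :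
    empMass w n s ≤ empMass w n s' := by
  refine ENNReal.tsum_le_tsum fun t => ?_
  split_ifs with h1 h2 h2
  · exact le_rfl
  · exact absurd ⟨h1.1, h h1.2⟩ h2
  · exact zero_le
  · exact le_rfl

theorem empMass_le_treeMass (w : PTree 𝒳 → ℝ) (n : ℕ) (s : Set (MSpace 𝒳)) :
    empMass w n s ≤ treeMass w n := by
  refine ENNReal.tsum_le_tsum fun t => ?_
  split_ifs with h1 h2 h2
  · exact le_rfl
  · exact absurd h1.1 h2
  · exact zero_le
  · exact le_rfl

theorem empMass_iUnion_le {ι : Type*} (w : PTree 𝒳 → ℝ) (n : ℕ) (s : ι → Set (MSpace 𝒳)) :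
    empMass w n (⋃ i, s i) ≤ ∑' i, empMass w n (s i) := by
  unfold empMass
  rw [ENNReal.tsum_comm]
  refine ENNReal.tsum_le_tsum fun t => ?_
  split_ifs with h
  · obtain ⟨i, hi⟩ := Set.mem_iUnion.1 h.2
    refine le_trans ?_ (ENNReal.le_tsum i)
    rw [if_pos ⟨h.1, hi⟩]
  · exact zero_le

theorem empMass_union_le (w : PTree 𝒳 → ℝ) (n : ℕ) (s s' : Set (MSpace 𝒳)) :
    empMass w n (s ∪ s') ≤ empMass w n s + empMass w n s' := by
  rw [Set.union_eq_iUnion]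
  refine (empMass_iUnion_le w n _).trans ?_
  rw [tsum_fintype, Fintype.sum_bool]
  rfl

theorem empMass_le_exp (h𝒬 : ∀ a c, 0 ≤ 𝒬 a c) {μ0 : 𝒳 → ℝ} (hμ0 : ∀ a, 0 ≤ μ0 a)
    (hμ1 : ∑ a, μ0 a = 1) {H : 𝒳 × List 𝒳 → ℝ} (hH : SubTilt 𝒬 H) {s : Set (MSpace 𝒳)} {α : ℝ}
    (hs : ∀ ν ∈ s, α ≤ pair H ν) (n : ℕ) :
    empMass (mgwWeight μ0 𝒬) n s ≤ ENNReal.ofReal (Real.exp (-(n * α))) := by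
  have h1 : empMass (mgwWeight μ0 𝒬) n s ≤ ENNReal.ofReal (Real.exp (-(n * α))) *
      ∑' t : PTree 𝒳, ENNReal.ofReal (mgwWeight μ0 𝒬 t) *
        ENNReal.ofReal (Real.exp (t.vsum H)) := by
    rw [← ENNReal.tsum_mul_left]
    refine ENNReal.tsum_le_tsum fun t => ?_
    split_ifs with h
    · have h2 : 1 ≤ ENNReal.ofReal (Real.exp (-(n * α))) * ENNReal.ofReal (Real.exp (t.vsum H)) := by
        rw [← ENNReal.ofReal_mul (Real.exp_pos _).le, ← Real.exp_add, ENNReal.one_le_ofReal,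
          Real.one_le_exp_iff, vsum_eq_size_mul_pair, h.1]
        have := mul_le_mul_of_nonneg_left (hs _ h.2) (Nat.cast_nonneg (α := ℝ) n)
        linarith
      calc ENNReal.ofReal (mgwWeight μ0 𝒬 t) = ENNReal.ofReal (mgwWeight μ0 𝒬 t) * 1 :=
            (mul_one _).symm
        _ ≤ ENNReal.ofReal (mgwWeight μ0 𝒬 t) * (ENNReal.ofReal (Real.exp (-(n * α))) *
            ENNReal.ofReal (Real.exp (t.vsum H))) := by gcongr
        _ = _ := by ring
    · exact zero_le
  refine h1.trans ?_
  calc _ ≤ ENNReal.ofReal (Real.exp (-(n * α))) * 1 := by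
        gcongr
        exact tsum_weight_exp_le_one h𝒬 hμ0 hμ1 hH
    _ = _ := mul_one _

/-- Exponential tightness. -/
theorem exists_tailSet_compl_le (h𝒬 : ∀ a c, 0 ≤ 𝒬 a c) (h𝒬1 : ∀ a, HasSum (𝒬 a) 1)
    (hexp : ∀ (a : 𝒳) (η : ℝ), 0 < η →
      Summable (fun c : List 𝒳 => 𝒬 a c * Real.exp (η * c.length)))
    {μ0 : 𝒳 → ℝ} (hμ0 : ∀ a, 0 ≤ μ0 a) (hμ1 : ∑ a, μ0 a = 1) {α : ℝ} (hα : 0 ≤ α) :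
    ∃ K : Set (MSpace 𝒳), IsCompact K ∧ ∀ n : ℕ, 1 ≤ n →
      empMass (mgwWeight μ0 𝒬) n Kᶜ ≤ ENNReal.ofReal (Real.exp (-(n * α))) := by
  have hη : ∀ k : ℕ, 0 < ((k : ℝ) + 1) * (α + k + 2) := fun k => by positivity
  choose ℓ hℓ1 hℓ using fun k : ℕ => exists_subTilt_tailLen h𝒬 h𝒬1 hexp (hη k)
  refine ⟨tailSet 𝒳 ℓ, isCompact_tailSet hℓ1, fun n hn => ?_⟩
  have hK : (tailSet 𝒳 ℓ)ᶜ = ⋃ k : ℕ, {ν | 1 / ((k : ℝ) + 1) < pair (tailLen (ℓ k)) ν} := by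
    ext ν
    simp [tailSet]
  rw [hK]
  refine (empMass_iUnion_le _ _ _).trans ?_
  have hbd : ∀ k : ℕ, empMass (mgwWeight μ0 𝒬) n {ν | 1 / ((k : ℝ) + 1) < pair (tailLen (ℓ k)) ν}
      ≤ ENNReal.ofReal (Real.exp (-(n * α))) * ENNReal.ofReal ((1 / 2) ^ (k + 1)) := by
    intro k
    refine (empMass_le_exp h𝒬 hμ0 hμ1 (hℓ k) (α := α + k + 1) (fun ν hν => ?_) n).trans ?_
    · have h2 : pair (fun x => ((k : ℝ) + 1) * (α + k + 2) * tailLen (ℓ k) x - 1) ν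
          = ((k : ℝ) + 1) * (α + k + 2) * pair (tailLen (ℓ k)) ν - 1 := by
        have h3 := ((ν.2.summable_mul (linGrowth_tailLen (ℓ k))).hasSum.mul_left
          (((k : ℝ) + 1) * (α + k + 2))).sub ν.2.hasSum
        refine Eq.trans (tsum_congr fun x => ?_) h3.tsum_eq
        ring
      rw [h2]
      have h4 : 1 / ((k : ℝ) + 1) < pair (tailLen (ℓ k)) ν := hν
      rw [div_lt_iff₀ (by positivity)] at h4
      have h5 : 0 < α + k + 2 := by positivity
      nlinarith [mul_lt_mul_of_pos_right h4 h5]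
    · rw [← ENNReal.ofReal_mul (Real.exp_pos _).le]
      refine ENNReal.ofReal_le_ofReal ?_
      have h1 : Real.exp (-1) ≤ 1 / 2 := by
        rw [Real.exp_neg, one_div]
        exact inv_anti₀ two_pos (by have := Real.add_one_le_exp (1 : ℝ); linarith)
      have h2 : Real.exp (-((k : ℝ) + 1)) ≤ (1 / 2) ^ (k + 1) := by
        have : Real.exp (-((k : ℝ) + 1)) = Real.exp (-1) ^ (k + 1) := by
          rw [← Real.exp_nat_mul]
          congr 1
          push_cast
          ring
        rw [this]
        exact pow_le_pow_left₀ (Real.exp_pos _).le h1 _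
      have h3 : Real.exp (-(n * (α + k + 1))) ≤ Real.exp (-(n * α)) * Real.exp (-((k : ℝ) + 1)) := by
        rw [← Real.exp_add]
        refine Real.exp_le_exp.2 ?_
        have h4 : (1 : ℝ) ≤ n := by exact_mod_cast hn
        have h5 : (0 : ℝ) ≤ k := Nat.cast_nonneg k
        nlinarith
      exact h3.trans (mul_le_mul_of_nonneg_left h2 (Real.exp_pos _).le)
  refine (ENNReal.tsum_le_tsum hbd).trans ?_
  rw [ENNReal.tsum_mul_left, ← ENNReal.ofReal_tsum_of_nonneg (fun k => by positivity)
    ((summable_nat_add_iff 1).2 summable_geometric_two)]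
  have h6 : ∑' k : ℕ, ((1 : ℝ) / 2) ^ (k + 1) = 1 := by
    simp only [pow_succ]
    rw [tsum_mul_right, tsum_geometric_two]
    norm_num
  rw [h6, ENNReal.ofReal_one, mul_one]

/-- The upper bound for the unnormalized masses. -/
theorem empMass_upper_bound (h𝒬 : ∀ a c, 0 ≤ 𝒬 a c) (h𝒬1 : ∀ a, HasSum (𝒬 a) 1)
    (hexp : ∀ (a : 𝒳) (η : ℝ), 0 < η →
      Summable (fun c : List 𝒳 => 𝒬 a c * Real.exp (η * c.length)))
    {μ0 : 𝒳 → ℝ} (hμ0 : ∀ a, 0 ≤ μ0 a) (hμ1 : ∑ a, μ0 a = 1) {α : ℝ} (hα : 0 ≤ α)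
    {F : Set (MSpace 𝒳)} (hF : IsClosed F) (hFα : ∀ ν ∈ F, ENNReal.ofReal α < offRate 𝒬 ν.1) :
    ∃ C : ℕ, ∀ᶠ n : ℕ in atTop, empMass (mgwWeight μ0 𝒬) n F
      ≤ C * ENNReal.ofReal (Real.exp (-(n * α))) := by
  obtain ⟨K, hK, hKc⟩ := exists_tailSet_compl_le h𝒬 h𝒬1 hexp hμ0 hμ1 hα
  have hKF : ∃ C : ℕ, ∀ᶠ n : ℕ in atTop, empMass (mgwWeight μ0 𝒬) n (K ∩ F)
      ≤ C * ENNReal.ofReal (Real.exp (-(n * α))) := by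
    refine (hK.inter_right hF).induction_on (p := fun s => ∃ C : ℕ, ∀ᶠ n : ℕ in atTop,
      empMass (mgwWeight μ0 𝒬) n s ≤ C * ENNReal.ofReal (Real.exp (-(n * α)))) ?_ ?_ ?_ ?_
    · exact ⟨0, Eventually.of_forall fun n => by simp [empMass]⟩
    · rintro s t hst ⟨C, hC⟩
      exact ⟨C, hC.mono fun n hn => (empMass_mono _ n hst).trans hn⟩
    · rintro s t ⟨C, hC⟩ ⟨D, hD⟩
      refine ⟨C + D, ?_⟩
      filter_upwards [hC, hD] with n h1 h2
      refine (empMass_union_le _ n s t).trans ?_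
      push_cast
      rw [add_mul]
      exact add_le_add h1 h2
    · intro ν hν
      have hlt := hFα ν hν.2
      by_cases hsh : ShiftInv ν.1
      · unfold offRate at hlt
        rw [if_pos hsh] at hlt
        obtain ⟨H, ⟨M, hM⟩, hH, hαH⟩ := exists_subTilt_of_lt_relEnt h𝒬 h𝒬1 ν.2 hlt
        refine ⟨{ν' | α < pair H ν'}, mem_nhdsWithin_of_mem_nhds
          ((isOpen_lt continuous_const (continuous_pair_of_bounded hM)).mem_nhds hαH), 1, ?_⟩
        refine Eventually.of_forall fun n => ?_
        rw [Nat.cast_one, one_mul]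
        exact empMass_le_exp h𝒬 hμ0 hμ1 hH (fun ν' h => le_of_lt h) n
      · rw [shiftInv_iff] at hsh
        push Not at hsh
        obtain ⟨a, ha⟩ := hsh
        refine ⟨{ν' | |defect a ν| / 2 < |defect a ν'|}, mem_nhdsWithin_of_mem_nhds
          ((isOpen_lt continuous_const (continuous_defect a).abs).mem_nhds ?_), 0, ?_⟩
        · exact half_lt_self (abs_pos.2 ha)
        · obtain ⟨N, hN⟩ := exists_nat_gt (1 / (|defect a ν| / 2))
          filter_upwards [eventually_ge_atTop (max N 1)] with n hn
          have hz : empMass (mgwWeight μ0 𝒬) n {ν' | |defect a ν| / 2 < |defect a ν'|} = 0 := by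
            refine ENNReal.tsum_eq_zero.2 fun t => if_neg ?_
            rintro ⟨h1, h2⟩
            have h3 : |defect a ν| / 2 < |defect a (empM t)| := h2
            have hnpos : (0 : ℝ) < n := by
              exact_mod_cast (le_of_max_le_right hn)
            have h4 : |defect a (empM t)| ≤ 1 / n := by
              rw [defect_empM, abs_div, h1, Nat.abs_cast]
              gcongr
              split_ifs <;> simp
            have h5 : (N : ℝ) ≤ n := by exact_mod_cast (le_of_max_le_left hn)
            have h6 : 0 < |defect a ν| / 2 := by
              have := abs_pos.2 ha
              positivity
            have h7 : |defect a ν| / 2 < 1 / n := h3.trans_le h4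
            rw [lt_div_iff₀ hnpos] at h7
            rw [div_lt_iff₀ h6] at hN
            nlinarith
          rw [hz]
          exact zero_le
  obtain ⟨C, hC⟩ := hKF
  refine ⟨C + 1, ?_⟩
  filter_upwards [hC, eventually_ge_atTop 1] with n h1 h2
  calc empMass (mgwWeight μ0 𝒬) n F ≤ empMass (mgwWeight μ0 𝒬) n (K ∩ F ∪ Kᶜ) := by
        refine empMass_mono _ n fun ν hν => ?_
        by_cases h : ν ∈ K
        · exact Or.inl ⟨h, hν⟩
        · exact Or.inr h
    _ ≤ _ := empMass_union_le _ n _ _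
    _ ≤ _ := add_le_add h1 (hKc n h2)
    _ = _ := by push_cast; ring

end Empirical

section Structure

variable {𝒳 : Type*} [Fintype 𝒳] [DecidableEq 𝒳] {𝒬 : 𝒳 → List 𝒳 → ℝ}

/-- `a` is a possible type of a child of a vertex of type `b`. -/
def OffStep (𝒬 : 𝒳 → List 𝒳 → ℝ) (b a : 𝒳) : Prop := ∃ c, offK 𝒬 b c ≠ 0 ∧ a ∈ c

theorem meanMat_ne_zero {a b : 𝒳} : meanMat 𝒬 a b ≠ 0 ↔ OffStep 𝒬 b a := by
  unfold meanMat OffStep offK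
  simp only [Matrix.of_apply, ne_eq, ENNReal.tsum_eq_zero, not_forall, mul_eq_zero, not_or,
    Nat.cast_eq_zero, mult, List.count_eq_zero, not_not]

theorem transGen_of_pow_ne_zero {k : ℕ} {a b : 𝒳} (h : (meanMat 𝒬 ^ (k + 1)) a b ≠ 0) :
    Relation.TransGen (OffStep 𝒬) b a := by
  induction k generalizing b with
  | zero =>
    rw [zero_add, pow_one] at h
    exact .single (meanMat_ne_zero.1 h)
  | succ k ih =>
    rw [pow_succ, Matrix.mul_apply] at h
    obtain ⟨c, -, hc⟩ := Finset.exists_ne_zero_of_sum_ne_zero h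
    exact .head (meanMat_ne_zero.1 (right_ne_zero_of_mul hc)) (ih (left_ne_zero_of_mul hc))

theorem exists_pow_ne_zero_of_transGen {a b : 𝒳} (h : Relation.TransGen (OffStep 𝒬) b a) :
    ∃ k : ℕ, (meanMat 𝒬 ^ (k + 1)) a b ≠ 0 := by
  induction h with
  | single h => exact ⟨0, by rw [zero_add, pow_one]; exact meanMat_ne_zero.2 h⟩
  | @tail c d _ h ih =>
    obtain ⟨k, hk⟩ := ih
    refine ⟨k + 1, ?_⟩
    rw [pow_succ', Matrix.mul_apply]
    refine fun h0 => ?_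
    rw [Finset.sum_eq_zero_iff] at h0
    exact mul_ne_zero (meanMat_ne_zero.2 h) hk (h0 c (Finset.mem_univ _))

theorem matStar_ne_zero {a b : 𝒳} :
    matStar (meanMat 𝒬) a b ≠ 0 ↔ Relation.TransGen (OffStep 𝒬) b a := by
  unfold matStar
  simp only [Matrix.of_apply, ne_eq, ENNReal.tsum_eq_zero, not_forall]
  exact ⟨fun ⟨k, hk⟩ => transGen_of_pow_ne_zero hk, fun h => exists_pow_ne_zero_of_transGen h⟩

theorem sum_count_eq_countP (E : Finset 𝒳) (c : List 𝒳) :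
    ∑ a ∈ E, c.count a = c.countP (fun a => decide (a ∈ E)) := by
  induction c with
  | nil => simp
  | cons b c ih =>
    simp only [List.count_cons, List.countP_cons, Finset.sum_add_distrib, ih]
    simp

theorem sum_eigenvector_eq (h𝒬 : ∀ a c, 0 ≤ 𝒬 a c)
    (hexp : ∀ (a : 𝒳) (η : ℝ), 0 < η →
      Summable (fun c : List 𝒳 => 𝒬 a c * Real.exp (η * c.length)))
    {u : 𝒳 → ℝ} (hu : ∀ a, ∑ b, meanMatR 𝒬 a b * u b = u a) (E : Finset 𝒳) :
    (∀ b, Summable fun c : List 𝒳 => 𝒬 b c * (c.countP (fun a => decide (a ∈ E)) : ℝ)) ∧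
    ∑ a ∈ E, u a
      = ∑ b, u b * ∑' c : List 𝒳, 𝒬 b c * (c.countP (fun a => decide (a ∈ E)) : ℝ) := by
  have hs : ∀ a b, Summable fun c : List 𝒳 => 𝒬 b c * (mult a c : ℝ) := by
    intro a b
    refine Summable.of_nonneg_of_le (fun c => mul_nonneg (h𝒬 b c) (Nat.cast_nonneg _))
      (fun c => mul_le_mul_of_nonneg_left ?_ (h𝒬 b c)) (hexp b 1 one_pos)
    have h1 : (mult a c : ℝ) ≤ c.length := by exact_mod_cast List.count_le_length
    have h2 := Real.add_one_le_exp (1 * (c.length : ℝ))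
    linarith
  have hsE : ∀ b, HasSum (fun c : List 𝒳 => 𝒬 b c * (c.countP (fun a => decide (a ∈ E)) : ℝ))
      (∑ a ∈ E, meanMatR 𝒬 a b) := by
    intro b
    refine (hasSum_sum fun a (_ : a ∈ E) => (hs a b).hasSum).congr_fun fun c => ?_
    rw [← sum_count_eq_countP, Nat.cast_sum, Finset.mul_sum]
    rfl
  refine ⟨fun b => (hsE b).summable, ?_⟩
  simp only [fun b => (hsE b).tsum_eq]
  rw [← Finset.sum_congr rfl fun a _ => hu a, Finset.sum_comm]
  refine Finset.sum_congr rfl fun b _ => ?_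
  rw [Finset.mul_sum]
  exact Finset.sum_congr rfl fun a _ => mul_comm _ _

/-- A type admitting a finite tree of positive weight. -/
def Terminable (𝒬 : 𝒳 → List 𝒳 → ℝ) (a : 𝒳) : Prop :=
  ∃ t : PTree 𝒳, t.root = a ∧ t.vprod (offK 𝒬) ≠ 0

theorem exists_trees_of_terminable {c : List 𝒳} (h : ∀ a ∈ c, Terminable 𝒬 a) :
    ∃ ts : List (PTree 𝒳), ts.map PTree.root = c ∧ (ts.map (PTree.vprod (offK 𝒬))).prod ≠ 0 := by
  induction c with
  | nil => exact ⟨[], rfl, by simp⟩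
  | cons a c ih =>
    obtain ⟨ts, h1, h2⟩ := ih fun b hb => h b (List.mem_cons_of_mem _ hb)
    obtain ⟨t, h3, h4⟩ := h a List.mem_cons_self
    exact ⟨t :: ts, by simp [h1, h3], by simpa using ⟨h4, by simpa using h2⟩⟩

theorem terminable_of_offspring {b : 𝒳} {c : List 𝒳} (hc : offK 𝒬 b c ≠ 0)
    (h : ∀ a ∈ c, Terminable 𝒬 a) : Terminable 𝒬 b := by
  obtain ⟨ts, h1, h2⟩ := exists_trees_of_terminable h
  refine ⟨.node b ts, rfl, ?_⟩
  rw [PTree.vprod_node, h1]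
  exact mul_ne_zero hc h2

theorem offK_ne_zero {b : 𝒳} {c : List 𝒳} : offK 𝒬 b c ≠ 0 ↔ 0 < 𝒬 b c := by
  simp [offK]

/-- Children of a terminable vertex are terminable, by criticality. -/
theorem Terminable.of_step (h𝒬 : ∀ a c, 0 ≤ 𝒬 a c) (h𝒬1 : ∀ a, HasSum (𝒬 a) 1)
    (hexp : ∀ (a : 𝒳) (η : ℝ), 0 < η →
      Summable (fun c : List 𝒳 => 𝒬 a c * Real.exp (η * c.length)))
    (hcrit : CriticalKernel 𝒬) {b a : 𝒳} (hb : Terminable 𝒬 b) (hba : OffStep 𝒬 b a) :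
    Terminable 𝒬 a := by
  classical
  obtain ⟨u, hu0, hu⟩ := hcrit
  set E : Finset 𝒳 := Finset.univ.filter fun a => ¬ Terminable 𝒬 a with hE
  have hmem : ∀ a, a ∈ E ↔ ¬ Terminable 𝒬 a := by simp [hE]
  obtain ⟨hs, hid⟩ := sum_eigenvector_eq h𝒬 hexp hu E
  set e : 𝒳 → ℝ := fun b => ∑' c : List 𝒳, 𝒬 b c * (c.countP (fun a => decide (a ∈ E)) : ℝ)
  have he0 : ∀ b, 0 ≤ e b := fun b =>
    tsum_nonneg fun c => mul_nonneg (h𝒬 b c) (Nat.cast_nonneg _)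
  have he1 : ∀ b ∈ E, 1 ≤ e b := by
    intro b hb
    rw [← (h𝒬1 b).tsum_eq]
    refine (h𝒬1 b).summable.tsum_le_tsum (fun c => ?_) (hs b)
    rcases (h𝒬 b c).eq_or_lt with h | h
    · simp [← h]
    · refine le_mul_of_one_le_right h.le ?_
      have : ∃ a ∈ c, a ∈ E := by
        by_contra! hn
        exact (hmem b).1 hb (terminable_of_offspring (offK_ne_zero.2 h)
          fun a ha => not_not.1 fun h' => hn a ha ((hmem a).2 h'))
      obtain ⟨a, ha, haE⟩ := this
      exact_mod_cast List.countP_pos_iff.2 ⟨a, ha, by simpa using haE⟩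
  by_contra ha
  have hbE : b ∉ E := fun h => (hmem b).1 h hb
  have hpos : 0 < e b := by
    obtain ⟨c, hc, hac⟩ := hba
    have h1 : 0 < 𝒬 b c * (c.countP (fun a => decide (a ∈ E)) : ℝ) := by
      refine mul_pos (offK_ne_zero.1 hc) ?_
      exact_mod_cast List.countP_pos_iff.2 ⟨a, hac, by simpa using (hmem a).2 ha⟩
    exact h1.trans_le ((hs b).le_tsum c fun c' _ => mul_nonneg (h𝒬 b c') (Nat.cast_nonneg _))
  have h2 : ∑ a ∈ E, u a + u b * e b ≤ ∑ b, u b * e b := by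
    calc ∑ a ∈ E, u a + u b * e b ≤ ∑ a ∈ E, u a * e a + u b * e b := by
          gcongr with a ha
          exact le_mul_of_one_le_right (hu0 a).le (he1 a ha)
      _ = ∑ a ∈ insert b E, u a * e a := by rw [Finset.sum_insert hbE, add_comm]
      _ ≤ ∑ b, u b * e b := Finset.sum_le_univ_sum_of_nonneg fun a =>
          mul_nonneg (hu0 a).le (he0 a)
  have h3 := mul_pos (hu0 b) hpos
  linarith

theorem WeaklyIrred.transGen {Xr Xt : Finset 𝒳} (hWI : WeaklyIrred (meanMat 𝒬) Xr Xt) {b : 𝒳}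
    (hb : b ∈ Xr) (a : 𝒳) : Relation.TransGen (OffStep 𝒬) b a :=
  matStar_ne_zero.1 (hWI.rec_pos a b hb).ne'

theorem WeaklyIrred.mem_trans {Xr Xt : Finset 𝒳} (hWI : WeaklyIrred (meanMat 𝒬) Xr Xt) {b a : 𝒳}
    (hb : b ∈ Xt) (h : Relation.TransGen (OffStep 𝒬) b a) : a ∈ Xt ∧ a ≠ b := by
  have h1 := matStar_ne_zero.2 h
  constructor
  · by_contra ha
    exact h1 (hWI.trans_zero a b hb (Or.inr ((hWI.compl a).2 ha)))
  · rintro rfl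
    exact h1 (hWI.trans_zero a a hb (Or.inl rfl))

/-- Trees with transient root have bounded size. -/
theorem WeaklyIrred.exists_size_le {Xr Xt : Finset 𝒳} (hWI : WeaklyIrred (meanMat 𝒬) Xr Xt)
    (htrans : BoundedTransient 𝒬 Xt) :
    ∃ N : ℕ, ∀ t : PTree 𝒳, t.root ∈ Xt → t.vprod (offK 𝒬) ≠ 0 → t.size ≤ N := by
  obtain ⟨B, hB⟩ := htrans
  let r : 𝒳 → 𝒳 → Prop := fun a b => b ∈ Xt ∧ Relation.TransGen (OffStep 𝒬) b a
  have : IsTrans 𝒳 r := ⟨fun a b c h1 h2 => ⟨h2.1, h2.2.trans h1.2⟩⟩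
  have : Std.Irrefl r := ⟨fun a h => (hWI.mem_trans h.1 h.2).2 rfl⟩
  have hwf : WellFounded r := Finite.wellFounded_of_trans_of_irrefl r
  have key : ∀ b, b ∈ Xt → ∃ N : ℕ, ∀ t : PTree 𝒳, t.root = b → t.vprod (offK 𝒬) ≠ 0 →
      t.size ≤ N := by
    intro b
    induction b using hwf.induction with
    | h b ih =>
      intro hb
      have : ∀ a, ∃ N : ℕ, r a b → ∀ t : PTree 𝒳, t.root = a → t.vprod (offK 𝒬) ≠ 0 →
          t.size ≤ N := by
        intro a
        by_cases h : r a b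
        · obtain ⟨N, hN⟩ := ih a h (hWI.mem_trans h.1 h.2).1
          exact ⟨N, fun _ => hN⟩
        · exact ⟨0, fun h' => absurd h' h⟩
      choose N hN using this
      refine ⟨1 + B * ∑ a, N a, fun t htb ht => ?_⟩
      cases t with
      | node b' ts =>
        obtain rfl : b' = b := htb
        have hc := PTree.kernel_ne_zero ht
        have hstep : ∀ t ∈ ts, r t.root b' := fun t ht' =>
          ⟨hb, .single ⟨_, hc, List.mem_map_of_mem ht'⟩⟩
        have hlen : ts.length ≤ B := by
          have h1 := hB b' _ (offK_ne_zero.1 hc).ne'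
          rw [List.countP_eq_length.2] at h1
          · simpa using h1
          · intro a ha
            obtain ⟨t, ht', rfl⟩ := List.mem_map.1 ha
            simpa using (hWI.mem_trans hb (hstep t ht').2).1
        rw [PTree.size_node]
        have h2 : (ts.map PTree.size).sum ≤ (ts.map PTree.size).length • ∑ a, N a := by
          refine List.sum_le_card_nsmul _ _ fun k hk => ?_
          obtain ⟨t, ht', rfl⟩ := List.mem_map.1 hk
          exact (hN t.root (hstep t ht') t rfl (PTree.vprod_child_ne_zero ht ht')).trans
            (Finset.single_le_sum (f := N) (fun _ _ => Nat.zero_le _) (Finset.mem_univ _))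
        rw [List.length_map, smul_eq_mul] at h2
        have h3 := Nat.mul_le_mul_right (∑ a, N a) hlen
        omega
  have : ∀ b, ∃ N : ℕ, b ∈ Xt → ∀ t : PTree 𝒳, t.root = b → t.vprod (offK 𝒬) ≠ 0 →
      t.size ≤ N := by
    intro b
    by_cases h : b ∈ Xt
    · obtain ⟨N, hN⟩ := key b h
      exact ⟨N, fun _ => hN⟩
    · exact ⟨0, fun h' => absurd h' h⟩
  choose N hN using this
  exact ⟨∑ a, N a, fun t ht ht' => (hN _ ht t rfl ht').trans
    (Finset.single_le_sum (f := N) (fun _ _ => Nat.zero_le _) (Finset.mem_univ _))⟩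

theorem WeaklyIrred.terminable {Xr Xt : Finset 𝒳} (hWI : WeaklyIrred (meanMat 𝒬) Xr Xt)
    (h𝒬 : ∀ a c, 0 ≤ 𝒬 a c) (h𝒬1 : ∀ a, HasSum (𝒬 a) 1)
    (hexp : ∀ (a : 𝒳) (η : ℝ), 0 < η →
      Summable (fun c : List 𝒳 => 𝒬 a c * Real.exp (η * c.length)))
    (hcrit : CriticalKernel 𝒬) {b : 𝒳} (hb : b ∈ Xr) (hbt : Terminable 𝒬 b) (a : 𝒳) :
    Terminable 𝒬 a := by
  have h := hWI.transGen hb a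
  induction h with
  | single h => exact hbt.of_step h𝒬 h𝒬1 hexp hcrit h
  | tail _ h ih => exact ih.of_step h𝒬 h𝒬1 hexp hcrit h

/-- Some recurrent vertex has at least two recurrent children. -/
theorem WeaklyIrred.exists_two_recurrent {Xr Xt : Finset 𝒳}
    (hWI : WeaklyIrred (meanMat 𝒬) Xr Xt)
    (h𝒬 : ∀ a c, 0 ≤ 𝒬 a c) (h𝒬1 : ∀ a, HasSum (𝒬 a) 1)
    (hexp : ∀ (a : 𝒳) (η : ℝ), 0 < η →
      Summable (fun c : List 𝒳 => 𝒬 a c * Real.exp (η * c.length)))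
    (hcrit : CriticalKernel 𝒬) (hterm : ∀ a, Terminable 𝒬 a) :
    ∃ b ∈ Xr, ∃ c, offK 𝒬 b c ≠ 0 ∧ 2 ≤ c.countP (fun a => decide (a ∈ Xr)) := by
  by_contra! hno
  obtain ⟨u, hu0, hu⟩ := hcrit
  obtain ⟨hs, hid⟩ := sum_eigenvector_eq h𝒬 hexp hu Xr
  set e : 𝒳 → ℝ := fun b => ∑' c : List 𝒳, 𝒬 b c * (c.countP (fun a => decide (a ∈ Xr)) : ℝ)
  have hle : ∀ b ∈ Xr, ∀ c, 𝒬 b c * (c.countP (fun a => decide (a ∈ Xr)) : ℝ) ≤ 𝒬 b c := by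
    intro b hb c
    rcases (h𝒬 b c).eq_or_lt with h | h
    · simp [← h]
    · refine mul_le_of_le_one_right h.le ?_
      exact_mod_cast Nat.lt_succ_iff.1 (hno b hb c (offK_ne_zero.2 h))
  have he1 : ∀ b ∈ Xr, e b ≤ 1 := by
    intro b hb
    rw [← (h𝒬1 b).tsum_eq]
    exact (hs b).tsum_le_tsum (hle b hb) (h𝒬1 b).summable
  have het : ∀ b ∉ Xr, e b = 0 := by
    intro b hb
    have hbt : b ∈ Xt := by
      by_contra h
      exact hb ((hWI.compl b).2 h)
    refine (tsum_congr fun c => ?_).trans tsum_zero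
    rcases (h𝒬 b c).eq_or_lt with h | h
    · simp [← h]
    · have : c.countP (fun a => decide (a ∈ Xr)) = 0 := by
        rw [List.countP_eq_zero]
        intro a ha hr
        have h1 := (hWI.mem_trans hbt (.single ⟨c, offK_ne_zero.2 h, ha⟩)).1
        exact (hWI.compl a).1 (by simpa using hr) h1
      simp [this]
  have hid' : ∑ a ∈ Xr, u a = ∑ a ∈ Xr, u a * e a := by
    rw [hid]
    refine (Finset.sum_subset (Finset.subset_univ Xr) fun b _ hb => ?_).symm
    have h := het b hb
    simp only [e] at h
    rw [h, mul_zero]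
  have heq : ∀ b ∈ Xr, e b = 1 := by
    intro b hb
    refine le_antisymm (he1 b hb) ?_
    by_contra! hlt
    have : ∑ a ∈ Xr, u a * e a < ∑ a ∈ Xr, u a :=
      Finset.sum_lt_sum (fun a ha => mul_le_of_le_one_right (hu0 a).le (he1 a ha))
        ⟨b, hb, mul_lt_of_lt_one_right (hu0 b) hlt⟩
    linarith
  have hone : ∀ b ∈ Xr, ∀ c, offK 𝒬 b c ≠ 0 → ∃ a ∈ c, a ∈ Xr := by
    intro b hb c hc
    by_contra! hn
    have h0 : c.countP (fun a => decide (a ∈ Xr)) = 0 := by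
      rw [List.countP_eq_zero]
      intro a ha
      simpa using hn a ha
    have : e b < ∑' c, 𝒬 b c := by
      refine (hs b).tsum_lt_tsum (i := c) (hle b hb) ?_ (h𝒬1 b).summable
      rw [h0, Nat.cast_zero, mul_zero]
      exact offK_ne_zero.1 hc
    rw [heq b hb, (h𝒬1 b).tsum_eq] at this
    exact lt_irrefl _ this
  have hzero : ∀ t : PTree 𝒳, t.root ∈ Xr → t.vprod (offK 𝒬) = 0 := by
    intro t
    induction t using PTree.induct with
    | h b ts ih =>
      intro hb
      by_contra hne
      obtain ⟨a, ha, har⟩ := hone b hb _ (PTree.kernel_ne_zero hne)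
      obtain ⟨t, ht, rfl⟩ := List.mem_map.1 ha
      exact PTree.vprod_child_ne_zero hne ht (ih t ht har)
  obtain ⟨b, hb⟩ := hWI.npty
  obtain ⟨t, rfl, ht⟩ := hterm b
  exact ht (hzero t hb)

end Structure

section Contexts

variable {𝒳 : Type*} [DecidableEq 𝒳] {E : Type*} [NormedAddCommGroup E]

/-- Total `K`-weight of the trees with root type `a` and `n` vertices for which the vertex sum
of `f` is within `ρ` of `Φ`. -/
noncomputable def ballMass (K : 𝒳 → List 𝒳 → ℝ≥0∞) (f : 𝒳 × List 𝒳 → E) (a : 𝒳) (n : ℕ) (Φ : E)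
    (ρ : ℝ) : ℝ≥0∞ :=
  ∑' t : PTree 𝒳, if t.root = a ∧ t.size = n ∧ ‖t.vsum f - Φ‖ ≤ ρ then t.vprod K else 0

/-- `φ` inserts a tree with root type `b` into a fixed tree with root type `a`; this adds
`s` vertices, shifts the vertex sum of `f` by `Ψ` and multiplies the weight by `ω`. -/
structure IsTreeContext (K : 𝒳 → List 𝒳 → ℝ≥0∞) (f : 𝒳 × List 𝒳 → E) (b a : 𝒳) (s : ℕ) (Ψ : E)
    (ω : ℝ≥0∞) (φ : PTree 𝒳 → PTree 𝒳) : Prop where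
  inj : Function.Injective φ
  root : ∀ t, t.root = b → (φ t).root = a
  size : ∀ t, t.root = b → (φ t).size = t.size + s
  vsum : ∀ t, t.root = b → (φ t).vsum f = t.vsum f + Ψ
  vprod : ∀ t, t.root = b → (φ t).vprod K = ω * t.vprod K

variable {K : 𝒳 → List 𝒳 → ℝ≥0∞} {f : 𝒳 × List 𝒳 → E}

theorem IsTreeContext.id (a : 𝒳) : IsTreeContext K f a a 0 0 1 id :=
  ⟨Function.injective_id, fun _ h => h, fun _ _ => rfl, fun _ _ => (add_zero _).symm,
    fun _ _ => (one_mul _).symm⟩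

theorem IsTreeContext.comp {a b d : 𝒳} {s s' : ℕ} {Ψ Ψ' : E} {ω ω' : ℝ≥0∞}
    {φ φ' : PTree 𝒳 → PTree 𝒳} (h : IsTreeContext K f b a s Ψ ω φ)
    (h' : IsTreeContext K f d b s' Ψ' ω' φ') :
    IsTreeContext K f d a (s' + s) (Ψ' + Ψ) (ω * ω') (φ ∘ φ') where
  inj := h.inj.comp h'.inj
  root t ht := h.root _ (h'.root t ht)
  size t ht := by rw [Function.comp, h.size _ (h'.root t ht), h'.size t ht, add_assoc]
  vsum t ht := by rw [Function.comp, h.vsum _ (h'.root t ht), h'.vsum t ht, add_assoc]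
  vprod t ht := by rw [Function.comp, h.vprod _ (h'.root t ht), h'.vprod t ht, mul_assoc]

theorem IsTreeContext.iterate {a : 𝒳} {s : ℕ} {Ψ : E} {ω : ℝ≥0∞} {φ : PTree 𝒳 → PTree 𝒳}
    (h : IsTreeContext K f a a s Ψ ω φ) (k : ℕ) :
    IsTreeContext K f a a (k * s) (k • Ψ) (ω ^ k) φ^[k] := by
  induction k with
  | zero => simpa using IsTreeContext.id a
  | succ k ih =>
    have := h.comp ih
    rw [Function.iterate_succ', Nat.succ_mul, succ_nsmul, pow_succ']
    exact this

theorem IsTreeContext.node {a b : 𝒳} (ts₁ ts₂ : List (PTree 𝒳)) :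
    IsTreeContext K f b a (1 + (ts₁.map PTree.size).sum + (ts₂.map PTree.size).sum)
      (f (a, ts₁.map PTree.root ++ b :: ts₂.map PTree.root) + (ts₁.map (PTree.vsum f)).sum
        + (ts₂.map (PTree.vsum f)).sum)
      (K a (ts₁.map PTree.root ++ b :: ts₂.map PTree.root) * (ts₁.map (PTree.vprod K)).prod
        * (ts₂.map (PTree.vprod K)).prod)
      (fun t => .node a (ts₁ ++ t :: ts₂)) where
  inj t t' h := by simpa using h
  root _ _ := rfl
  size t _ := by
    rw [PTree.size_node]
    simp only [List.map_append, List.map_cons, List.sum_append, List.sum_cons]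
    ring
  vsum t ht := by
    rw [PTree.vsum_node]
    simp only [List.map_append, List.map_cons, List.sum_append, List.sum_cons, ht]
    abel
  vprod t ht := by
    rw [PTree.vprod_node]
    simp only [List.map_append, List.map_cons, List.prod_append, List.prod_cons, ht]
    ring

theorem IsTreeContext.ballMass_le {a b : 𝒳} {s : ℕ} {Ψ : E} {ω : ℝ≥0∞} {φ : PTree 𝒳 → PTree 𝒳}
    (h : IsTreeContext K f b a s Ψ ω φ) (n : ℕ) (Φ : E) (ρ : ℝ) :
    ω * ballMass K f b n Φ ρ ≤ ballMass K f a (n + s) (Φ + Ψ) ρ := by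
  unfold ballMass
  refine le_trans ?_ (ENNReal.tsum_comp_le_tsum_of_injective h.inj _)
  rw [← ENNReal.tsum_mul_left]
  refine ENNReal.tsum_le_tsum fun t => ?_
  split_ifs with h1 h2 h2
  · rw [h.vprod t h1.1]
  · refine absurd ⟨h.root t h1.1, by rw [h.size t h1.1, h1.2.1], ?_⟩ h2
    rw [h.vsum t h1.1, add_sub_add_right_eq_sub]
    exact h1.2.2
  · simp
  · simp

theorem IsTreeContext.treeSum_le {a b : 𝒳} {s : ℕ} {Ψ : E} {ω : ℝ≥0∞} {φ : PTree 𝒳 → PTree 𝒳}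
    (h : IsTreeContext K f b a s Ψ ω φ) : ω * treeSum K b ≤ treeSum K a := by
  unfold treeSum
  refine le_trans ?_ (ENNReal.tsum_comp_le_tsum_of_injective h.inj _)
  rw [← ENNReal.tsum_mul_left]
  refine ENNReal.tsum_le_tsum fun t => ?_
  split_ifs with h1 h2 h2
  · rw [h.vprod t h1]
  · exact absurd (h.root t h1) h2
  · simp
  · simp

theorem ballMass_mono {a : 𝒳} {n : ℕ} {Φ Φ' : E} {ρ ρ' : ℝ} (h : ‖Φ - Φ'‖ + ρ ≤ ρ') :
    ballMass K f a n Φ ρ ≤ ballMass K f a n Φ' ρ' := by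
  refine ENNReal.tsum_le_tsum fun t => ?_
  split_ifs with h1 h2 h2
  · exact le_rfl
  · refine absurd ⟨h1.1, h1.2.1, ?_⟩ h2
    calc ‖t.vsum f - Φ'‖ = ‖(t.vsum f - Φ) + (Φ - Φ')‖ := by abel_nf
      _ ≤ ‖t.vsum f - Φ‖ + ‖Φ - Φ'‖ := norm_add_le _ _
      _ ≤ ρ' := by linarith [h1.2.2]
  · simp
  · simp

theorem ballMass_ne_zero {t : PTree 𝒳} (ht : t.vprod K ≠ 0) {ρ : ℝ} (hρ : 0 ≤ ρ) :
    ballMass K f t.root t.size (t.vsum f) ρ ≠ 0 := by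
  unfold ballMass
  rw [ne_eq, ENNReal.tsum_eq_zero, not_forall]
  exact ⟨t, by simpa [hρ] using ht⟩

end Contexts

section Gadget

variable {𝒳 : Type*} [Fintype 𝒳] [DecidableEq 𝒳] {E : Type*} [NormedAddCommGroup E]
  {𝒬 : 𝒳 → List 𝒳 → ℝ} {f : 𝒳 × List 𝒳 → E}

theorem exists_treeContext_of_transGen (hterm : ∀ a, Terminable 𝒬 a) (f : 𝒳 × List 𝒳 → E)
    {a b : 𝒳} (h : Relation.TransGen (OffStep 𝒬) a b) :
    ∃ s Ψ ω φ, ω ≠ 0 ∧ IsTreeContext (offK 𝒬) f b a s Ψ ω φ := by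
  have step : ∀ {a b : 𝒳}, OffStep 𝒬 a b →
      ∃ s Ψ ω φ, ω ≠ 0 ∧ IsTreeContext (offK 𝒬) f b a s Ψ ω φ := by
    rintro a b ⟨c, hc, hb⟩
    obtain ⟨l₁, l₂, rfl⟩ := List.append_of_mem hb
    obtain ⟨ts₁, h1, h1'⟩ := exists_trees_of_terminable (c := l₁) fun a _ => hterm a
    obtain ⟨ts₂, h2, h2'⟩ := exists_trees_of_terminable (c := l₂) fun a _ => hterm a
    refine ⟨_, _, _, _, ?_, IsTreeContext.node ts₁ ts₂⟩
    rw [h1, h2]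
    exact mul_ne_zero (mul_ne_zero hc h1') h2'
  induction h with
  | single h => exact step h
  | tail _ h ih =>
    obtain ⟨s, Ψ, ω, φ, h0, hφ⟩ := ih
    obtain ⟨s', Ψ', ω', φ', h0', hφ'⟩ := step h
    exact ⟨_, _, _, _, mul_ne_zero h0 h0', hφ.comp hφ'⟩

theorem exists_append_of_two_le_countP {α : Type*} (p : α → Bool) {l : List α}
    (h : 2 ≤ l.countP p) :
    ∃ l₁ x l₂ y l₃, p x = true ∧ p y = true ∧ l = l₁ ++ x :: (l₂ ++ y :: l₃) := by
  induction l with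
  | nil => simp at h
  | cons z l ih =>
    by_cases hz : p z = true
    · rw [List.countP_cons_of_pos hz] at h
      have : 0 < l.countP p := by omega
      obtain ⟨y, hy, hpy⟩ := List.countP_pos_iff.1 this
      obtain ⟨l₂, l₃, rfl⟩ := List.append_of_mem hy
      exact ⟨[], z, l₂, y, l₃, hz, hpy, rfl⟩
    · rw [List.countP_cons_of_neg hz] at h
      obtain ⟨l₁, x, l₂, y, l₃, hx, hy, rfl⟩ := ih h
      exact ⟨z :: l₁, x, l₂, y, l₃, hx, hy, rfl⟩

/-- Two trees with recurrent root type `a` can be combined into a single one, so that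
`ballMass` is supermultiplicative up to bounded corrections. -/
theorem WeaklyIrred.exists_ballMass_mul_le {Xr Xt : Finset 𝒳}
    (hWI : WeaklyIrred (meanMat 𝒬) Xr Xt) (hterm : ∀ a, Terminable 𝒬 a)
    (htwo : ∃ b ∈ Xr, ∃ c, offK 𝒬 b c ≠ 0 ∧ 2 ≤ c.countP (fun a => decide (a ∈ Xr)))
    (f : 𝒳 × List 𝒳 → E) {a : 𝒳} (ha : a ∈ Xr) :
    ∃ (g : ℕ) (Ψ : E) (ω : ℝ≥0∞), ω ≠ 0 ∧ ∀ n₁ n₂ Φ₁ Φ₂ ρ₁ ρ₂,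
      ω * (ballMass (offK 𝒬) f a n₁ Φ₁ ρ₁ * ballMass (offK 𝒬) f a n₂ Φ₂ ρ₂)
        ≤ ballMass (offK 𝒬) f a (n₁ + n₂ + g) (Φ₁ + Φ₂ + Ψ) (ρ₁ + ρ₂) := by
  obtain ⟨b, hb, c, hc, hc2⟩ := htwo
  obtain ⟨l₁, x, l₂, y, l₃, hx, hy, rfl⟩ := exists_append_of_two_le_countP _ hc2
  obtain ⟨s₀, Ψ₀, ω₀, φ₀, h0, hφ₀⟩ :=
    exists_treeContext_of_transGen hterm f (hWI.transGen ha b)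
  obtain ⟨s₁, Ψ₁, ω₁, φ₁, h1, hφ₁⟩ :=
    exists_treeContext_of_transGen hterm f (hWI.transGen (by simpa using hx) a : _)
  obtain ⟨s₂, Ψ₂, ω₂, φ₂, h2, hφ₂⟩ :=
    exists_treeContext_of_transGen hterm f (hWI.transGen (by simpa using hy) a : _)
  obtain ⟨ts₁, hr₁, hp₁⟩ := exists_trees_of_terminable (c := l₁) fun a _ => hterm a
  obtain ⟨ts₂, hr₂, hp₂⟩ := exists_trees_of_terminable (c := l₂) fun a _ => hterm a
  obtain ⟨ts₃, hr₃, hp₃⟩ := exists_trees_of_terminable (c := l₃) fun a _ => hterm a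
  set F : PTree 𝒳 × PTree 𝒳 → PTree 𝒳 := fun p =>
    φ₀ (.node b (ts₁ ++ φ₁ p.1 :: (ts₂ ++ φ₂ p.2 :: ts₃))) with hF
  have hFi : Function.Injective F := by
    rintro ⟨t, t'⟩ ⟨u, u'⟩ h
    have h3 := hφ₀.inj h
    simp only [PTree.node.injEq, List.append_cancel_left_eq, List.cons.injEq, true_and,
      and_true] at h3
    rw [hφ₁.inj h3.1, hφ₂.inj h3.2]
  refine ⟨s₀ + s₁ + s₂ + 1 + (ts₁.map PTree.size).sum + (ts₂.map PTree.size).sum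
      + (ts₃.map PTree.size).sum,
    Ψ₀ + Ψ₁ + Ψ₂ + f (b, l₁ ++ x :: (l₂ ++ y :: l₃)) + (ts₁.map (PTree.vsum f)).sum
      + (ts₂.map (PTree.vsum f)).sum + (ts₃.map (PTree.vsum f)).sum,
    ω₀ * ω₁ * ω₂ * offK 𝒬 b (l₁ ++ x :: (l₂ ++ y :: l₃)) * (ts₁.map (PTree.vprod (offK 𝒬))).prod
      * (ts₂.map (PTree.vprod (offK 𝒬))).prod * (ts₃.map (PTree.vprod (offK 𝒬))).prod, ?_, ?_⟩
  · simp only [ne_eq, mul_eq_zero, not_or]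
    exact ⟨⟨⟨⟨⟨⟨h0, h1⟩, h2⟩, hc⟩, hp₁⟩, hp₂⟩, hp₃⟩
  intro n₁ n₂ Φ₁ Φ₂ ρ₁ ρ₂
  unfold ballMass
  refine le_trans ?_ (ENNReal.tsum_comp_le_tsum_of_injective hFi _)
  rw [ENNReal.tsum_prod', ← ENNReal.tsum_mul_right, ← ENNReal.tsum_mul_left]
  refine ENNReal.tsum_le_tsum fun t => ?_
  rw [← ENNReal.tsum_mul_left, ← ENNReal.tsum_mul_left]
  refine ENNReal.tsum_le_tsum fun u => ?_
  by_cases ht : t.root = a ∧ t.size = n₁ ∧ ‖t.vsum f - Φ₁‖ ≤ ρ₁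
  swap
  · simp [ht]
  by_cases hu : u.root = a ∧ u.size = n₂ ∧ ‖u.vsum f - Φ₂‖ ≤ ρ₂
  swap
  · simp [hu]
  have hroots : (ts₁ ++ φ₁ t :: (ts₂ ++ φ₂ u :: ts₃)).map PTree.root
      = l₁ ++ x :: (l₂ ++ y :: l₃) := by
    simp [hr₁, hr₂, hr₃, hφ₁.root t ht.1, hφ₂.root u hu.1]
  have hsize : (F (t, u)).size = n₁ + n₂ + (s₀ + s₁ + s₂ + 1 + (ts₁.map PTree.size).sum
      + (ts₂.map PTree.size).sum + (ts₃.map PTree.size).sum) := by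
    rw [hF, hφ₀.size _ rfl, PTree.size_node]
    simp only [List.map_append, List.map_cons, List.sum_append, List.sum_cons]
    rw [hφ₁.size t ht.1, hφ₂.size u hu.1, ht.2.1, hu.2.1]
    ring
  have hvsum : (F (t, u)).vsum f = t.vsum f + u.vsum f + (Ψ₀ + Ψ₁ + Ψ₂
      + f (b, l₁ ++ x :: (l₂ ++ y :: l₃)) + (ts₁.map (PTree.vsum f)).sum
      + (ts₂.map (PTree.vsum f)).sum + (ts₃.map (PTree.vsum f)).sum) := by
    rw [hF, hφ₀.vsum _ rfl, PTree.vsum_node, hroots]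
    simp only [List.map_append, List.map_cons, List.sum_append, List.sum_cons]
    rw [hφ₁.vsum t ht.1, hφ₂.vsum u hu.1]
    abel
  rw [if_pos ht, if_pos hu, if_pos]
  · rw [hF, hφ₀.vprod _ rfl, PTree.vprod_node, hroots]
    simp only [List.map_append, List.map_cons, List.prod_append, List.prod_cons]
    rw [hφ₁.vprod t ht.1, hφ₂.vprod u hu.1]
    apply le_of_eq
    ring
  · refine ⟨hφ₀.root _ rfl, hsize, ?_⟩
    rw [hvsum, add_sub_add_right_eq_sub, add_sub_add_comm]
    exact (norm_add_le _ _).trans (add_le_add ht.2.2 hu.2.2)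

end Gadget

section Achievable

variable {E : Type*} [NormedAddCommGroup E] [NormedSpace ℝ E]

/-- A family of masses of balls which is supermultiplicative up to bounded corrections. -/
structure SuperMult (m : ℕ → E → ℝ → ℝ≥0∞) : Prop where
  mono : ∀ {n Φ Φ' ρ ρ'}, ‖Φ - Φ'‖ + ρ ≤ ρ' → m n Φ ρ ≤ m n Φ' ρ'
  mul_le : ∃ (g : ℕ) (Ψ : E) (B : ℝ), 0 ≤ B ∧ ∀ n₁ n₂ Φ₁ Φ₂ ρ₁ ρ₂,
    ENNReal.ofReal (Real.exp (-B)) * (m n₁ Φ₁ ρ₁ * m n₂ Φ₂ ρ₂)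
      ≤ m (n₁ + n₂ + g) (Φ₁ + Φ₂ + Ψ) (ρ₁ + ρ₂)
  base : ∃ n Φ B, 0 ≤ B ∧ ENNReal.ofReal (Real.exp (-B)) ≤ m n Φ 0

/-- The pairs `(y, r)` such that `m n (n y)` decays no faster than `exp (-n r)` along some
sequence of `n`. -/
def achievable (m : ℕ → E → ℝ → ℝ≥0∞) : Set (E × ℝ) :=
  {p | 0 ≤ p.2 ∧ ∀ ε > 0, ∀ N : ℕ, ∃ n ≥ N,
    ENNReal.ofReal (Real.exp (-(n * (p.2 + ε)))) ≤ m n ((n : ℝ) • p.1) (ε * n)}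

theorem ofReal_exp_mul_ofReal_exp (x y : ℝ) :
    ENNReal.ofReal (Real.exp x) * ENNReal.ofReal (Real.exp y)
      = ENNReal.ofReal (Real.exp (x + y)) := by
  rw [← ENNReal.ofReal_mul (Real.exp_pos _).le, Real.exp_add]

theorem ofReal_exp_le {x y : ℝ} (h : x ≤ y) :
    ENNReal.ofReal (Real.exp x) ≤ ENNReal.ofReal (Real.exp y) :=
  ENNReal.ofReal_le_ofReal (Real.exp_le_exp.2 h)

theorem exists_ofReal_exp_le {ω : ℝ≥0∞} (h : ω ≠ 0) :
    ∃ B : ℝ, 0 ≤ B ∧ ENNReal.ofReal (Real.exp (-B)) ≤ ω := by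
  rcases eq_or_ne ω ∞ with rfl | ht
  · exact ⟨0, le_rfl, le_top⟩
  have hpos : 0 < ω.toReal := ENNReal.toReal_pos h ht
  refine ⟨max 0 (-Real.log ω.toReal), le_max_left _ _, ?_⟩
  rw [ENNReal.ofReal_le_iff_le_toReal ht, ← Real.le_log_iff_exp_le hpos]
  linarith [le_max_right 0 (-Real.log ω.toReal)]

variable {m : ℕ → E → ℝ → ℝ≥0∞}

theorem achievable_mono {y : E} {r r' : ℝ} (h : (y, r) ∈ achievable m) (hr : r ≤ r') :
    (y, r') ∈ achievable m := by
  refine ⟨h.1.trans hr, fun ε hε N => ?_⟩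
  obtain ⟨n, hn, h1⟩ := h.2 ε hε N
  refine ⟨n, hn, (ofReal_exp_le ?_).trans h1⟩
  gcongr

theorem SuperMult.isClosed_achievable (hm : SuperMult m) : IsClosed (achievable m) := by
  refine isClosed_of_closure_subset fun p hp => ?_
  rw [Metric.mem_closure_iff] at hp
  constructor
  · refine le_of_forall_pos_le_add fun ε hε => ?_
    obtain ⟨q, hq, hd⟩ := hp ε hε
    have h1 : dist p.2 q.2 < ε := (le_max_right _ _).trans_lt hd
    have := hq.1
    rw [Real.dist_eq, abs_lt] at h1
    linarith
  · intro ε hε N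
    obtain ⟨q, hq, hd⟩ := hp (ε / 2) (by positivity)
    have h1 : dist p.2 q.2 < ε / 2 := (le_max_right _ _).trans_lt hd
    have h2 : dist p.1 q.1 < ε / 2 := (le_max_left _ _).trans_lt hd
    rw [Real.dist_eq, abs_lt] at h1
    rw [dist_comm, dist_eq_norm] at h2
    obtain ⟨n, hn, h3⟩ := hq.2 (ε / 2) (by positivity) N
    refine ⟨n, hn, (ofReal_exp_le ?_).trans (h3.trans (hm.mono ?_))⟩
    · rw [neg_le_neg_iff]
      exact mul_le_mul_of_nonneg_left (by linarith) (Nat.cast_nonneg _)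
    · rw [← smul_sub, norm_smul, Real.norm_natCast]
      have : (n : ℝ) * ‖q.1 - p.1‖ ≤ n * (ε / 2) :=
        mul_le_mul_of_nonneg_left h2.le (Nat.cast_nonneg _)
      linarith

/-- Blocks of a fixed size `M` can be appended at exponential cost `M (r + ε)`. -/
theorem SuperMult.exists_block (hm : SuperMult m) {y : E} {r : ℝ} (h : (y, r) ∈ achievable m)
    {ε : ℝ} (hε : 0 < ε) (N : ℕ) :
    ∃ M ≥ N, 1 ≤ M ∧ ∀ k n Φ ρ,
      ENNReal.ofReal (Real.exp (-((k * M : ℕ) * (r + ε)))) * m n Φ ρ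
        ≤ m (n + k * M) (Φ + ((k * M : ℕ) : ℝ) • y) (ρ + ε * (k * M : ℕ)) := by
  obtain ⟨g, Ψ, B, hB, hsup⟩ := hm.mul_le
  obtain ⟨N', hN'⟩ := exists_nat_ge ((B + g * ‖y‖ + ‖Ψ‖) / (ε / 2))
  obtain ⟨n₁, hn₁, hn₁m⟩ := h.2 (ε / 2) (by positivity) (max (max N 1) N')
  have h1 : N ≤ n₁ := (le_max_left _ _).trans ((le_max_left _ _).trans hn₁)
  have h2 : 1 ≤ n₁ := (le_max_right N _).trans ((le_max_left _ _).trans hn₁)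
  have h3 : (N' : ℝ) ≤ n₁ := by exact_mod_cast (le_max_right _ _).trans hn₁
  have h4 : B + g * ‖y‖ + ‖Ψ‖ ≤ n₁ * (ε / 2) := by
    rw [div_le_iff₀ (by positivity)] at hN'
    exact hN'.trans (mul_le_mul_of_nonneg_right h3 (by positivity))
  have hr : 0 ≤ r := h.1
  have hg : (0 : ℝ) ≤ g := Nat.cast_nonneg g
  have hy : 0 ≤ (g : ℝ) * ‖y‖ := by positivity
  have hΨ := norm_nonneg Ψ
  refine ⟨n₁ + g, by omega, by omega, fun k => ?_⟩
  induction k with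
  | zero => intro n Φ ρ; simp
  | succ k ih =>
    intro n Φ ρ
    have step : ENNReal.ofReal (Real.exp (-((n₁ + g : ℕ) * (r + ε)))) *
          m (n + k * (n₁ + g)) (Φ + ((k * (n₁ + g) : ℕ) : ℝ) • y) (ρ + ε * (k * (n₁ + g) : ℕ))
        ≤ m (n + (k + 1) * (n₁ + g)) (Φ + (((k + 1) * (n₁ + g) : ℕ) : ℝ) • y)
          (ρ + ε * ((k + 1) * (n₁ + g) : ℕ)) := by
      set Φ' := Φ + ((k * (n₁ + g) : ℕ) : ℝ) • y
      set ρ' := ρ + ε * (k * (n₁ + g) : ℕ)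
      calc _ ≤ ENNReal.ofReal (Real.exp (-B)) *
              (m n₁ ((n₁ : ℝ) • y) (ε / 2 * n₁) * m (n + k * (n₁ + g)) Φ' ρ') := by
            rw [← mul_assoc]
            gcongr
            refine le_trans ?_ (mul_le_mul_right hn₁m _)
            rw [ofReal_exp_mul_ofReal_exp]
            apply ofReal_exp_le
            push_cast
            nlinarith [mul_nonneg hg hr, mul_nonneg hg hε.le]
        _ ≤ _ := hsup _ _ _ _ _ _
        _ ≤ _ := by
            have : n₁ + (n + k * (n₁ + g)) + g = n + (k + 1) * (n₁ + g) := by ring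
            rw [this]
            apply hm.mono
            have e : (n₁ : ℝ) • y + Φ' + Ψ - (Φ + (((k + 1) * (n₁ + g) : ℕ) : ℝ) • y)
                = Ψ - (g : ℝ) • y := by
              simp only [Φ']
              push_cast
              module
            have e2 : ‖Ψ - (g : ℝ) • y‖ ≤ ‖Ψ‖ + g * ‖y‖ := by
              refine (norm_sub_le _ _).trans ?_
              rw [norm_smul, Real.norm_natCast]
            rw [e]
            simp only [ρ']
            push_cast
            nlinarith [mul_nonneg hg hε.le]
    refine le_trans ?_ step
    refine le_trans (le_of_eq ?_) (mul_le_mul_right (ih n Φ ρ) _)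
    rw [← mul_assoc, ofReal_exp_mul_ofReal_exp]
    congr 3
    push_cast
    ring

theorem SuperMult.convex_achievable (hm : SuperMult m) : Convex ℝ (achievable m) := by
  rintro ⟨y₁, r₁⟩ h₁ ⟨y₂, r₂⟩ h₂ a b ha hb hab
  have hr₁ : 0 ≤ r₁ := h₁.1
  have hr₂ : 0 ≤ r₂ := h₂.1
  refine ⟨by simp only [Prod.smul_mk, Prod.mk_add_mk, smul_eq_mul]; positivity, fun ε hε N => ?_⟩
  simp only [Prod.smul_mk, Prod.mk_add_mk, smul_eq_mul]
  obtain ⟨n₀, Φ₀, B, hB, hbase⟩ := hm.base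
  obtain ⟨M₁, -, hM₁, hblock₁⟩ := hm.exists_block h₁ (half_pos hε) 0
  obtain ⟨M₂, -, hM₂, hblock₂⟩ := hm.exists_block h₂ (half_pos hε) 0
  set L : ℕ := M₁ * M₂ with hL
  have hL1 : (1 : ℝ) ≤ L := by exact_mod_cast Nat.mul_pos hM₁ hM₂
  set D : ℝ := B + ‖Φ₀‖ + (L + n₀) * (‖y₁‖ + ‖y₂‖) + (L + n₀) * (r₁ + r₂) with hD
  obtain ⟨p, hp⟩ := exists_nat_ge (max (N : ℝ) (D / (ε / 2)))
  have hpN : N ≤ p := by exact_mod_cast (le_max_left _ _).trans hp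
  have hpD : D ≤ p * (ε / 2) := by
    rw [← div_le_iff₀ (by positivity)]
    exact (le_max_right _ _).trans hp
  have hap : a * p ≤ p := mul_le_of_le_one_left (Nat.cast_nonneg _) (by linarith)
  have hap0 : 0 ≤ a * p := by positivity
  set p₁ : ℕ := ⌊a * p⌋₊ with hp₁
  have hf1 : (p₁ : ℝ) ≤ a * p := Nat.floor_le hap0
  have hf2 : a * p < p₁ + 1 := Nat.lt_floor_add_one _
  have hp₁p : p₁ ≤ p := by exact_mod_cast hf1.trans hap
  obtain ⟨p₂, hp₂⟩ := Nat.exists_eq_add_of_le hp₁p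
  have hsum : (p : ℝ) = p₁ + p₂ := by exact_mod_cast hp₂
  set n : ℕ := n₀ + M₂ * p₁ * M₁ + M₁ * p₂ * M₂ with hn
  have hnr : (n : ℝ) = n₀ + L * p₁ + L * p₂ := by
    rw [hn, hL]; push_cast; ring
  have hk₁ : ((M₂ * p₁ * M₁ : ℕ) : ℝ) = L * p₁ := by rw [hL]; push_cast; ring
  have hk₂ : ((M₁ * p₂ * M₂ : ℕ) : ℝ) = L * p₂ := by rw [hL]; push_cast; ring
  have hn₀ : (0 : ℝ) ≤ n₀ := Nat.cast_nonneg _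
  have hb' : b = 1 - a := by linarith
  have d1 : |L * p₁ - n * a| ≤ L + n₀ := by
    have : L * p₁ - n * a = -(L * (a * p - p₁)) - n₀ * a := by rw [hnr, hsum]; ring
    rw [this, abs_le]
    have h3 : (n₀ : ℝ) * a ≤ n₀ := mul_le_of_le_one_right hn₀ (by linarith)
    have h4 : 0 ≤ (n₀ : ℝ) * a := by positivity
    have h5 : (L : ℝ) * (a * p - p₁) ≤ L := mul_le_of_le_one_right (by linarith) (by linarith)
    have h6 : 0 ≤ (L : ℝ) * (a * p - p₁) := mul_nonneg (by linarith) (by linarith)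
    constructor <;> linarith
  have d2 : |L * p₂ - n * b| ≤ L + n₀ := by
    have : L * p₂ - n * b = L * (a * p - p₁) - n₀ * b := by rw [hnr, hsum, hb']; ring
    rw [this, abs_le]
    have h3 : (n₀ : ℝ) * b ≤ n₀ := mul_le_of_le_one_right hn₀ (by linarith)
    have h4 : 0 ≤ (n₀ : ℝ) * b := by positivity
    have h5 : (L : ℝ) * (a * p - p₁) ≤ L := mul_le_of_le_one_right (by linarith) (by linarith)
    have h6 : 0 ≤ (L : ℝ) * (a * p - p₁) := mul_nonneg (by linarith) (by linarith)
    constructor <;> linarith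
  have hpn : (p : ℝ) ≤ n := by
    have : (p : ℝ) ≤ L * p := le_mul_of_one_le_left p.cast_nonneg hL1
    rw [hnr]
    rw [hsum] at this ⊢
    linarith
  have hLp : L * (p₁ : ℝ) + L * p₂ ≤ n := by rw [hnr]; linarith
  have hpn2 : p * (ε / 2) ≤ n * (ε / 2) := by gcongr
  have hD1 : 0 ≤ (L + n₀ : ℝ) * (‖y₁‖ + ‖y₂‖) := by positivity
  have hD2 : 0 ≤ (L + n₀ : ℝ) * (r₁ + r₂) := by positivity
  have hΦ₀ := norm_nonneg Φ₀
  have hLpε : (L * (p₁ : ℝ) + L * p₂) * (ε / 2) ≤ n * (ε / 2) := by gcongr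
  refine ⟨n, hpN.trans (by exact_mod_cast hpn), ?_⟩
  have key := (mul_le_mul_right (hblock₁ (M₂ * p₁) n₀ Φ₀ 0)
    (ENNReal.ofReal (Real.exp (-((M₁ * p₂ * M₂ : ℕ) * (r₂ + ε / 2)))))).trans
    (hblock₂ (M₁ * p₂) _ _ _)
  rw [hk₁, hk₂] at key
  refine le_trans ?_ (key.trans (hm.mono ?_))
  · refine le_trans ?_ (mul_le_mul_right (mul_le_mul_right hbase _) _)
    rw [ofReal_exp_mul_ofReal_exp, ofReal_exp_mul_ofReal_exp]
    apply ofReal_exp_le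
    have e1 := mul_le_mul_of_nonneg_right (abs_le.1 d1).2 hr₁
    have e2 := mul_le_mul_of_nonneg_right (abs_le.1 d2).2 hr₂
    linarith
  · have e : Φ₀ + (L * p₁ : ℝ) • y₁ + (L * p₂ : ℝ) • y₂ - (n : ℝ) • (a • y₁ + b • y₂)
        = Φ₀ + (L * p₁ - n * a : ℝ) • y₁ + (L * p₂ - n * b : ℝ) • y₂ := by
      module
    rw [e]
    have e1 := norm_add₃_le (a := Φ₀) (b := (L * p₁ - n * a : ℝ) • y₁)
      (c := (L * p₂ - n * b : ℝ) • y₂)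
    rw [norm_smul, norm_smul, Real.norm_eq_abs, Real.norm_eq_abs] at e1
    have e2 := mul_le_mul_of_nonneg_right d1 (norm_nonneg y₁)
    have e3 := mul_le_mul_of_nonneg_right d2 (norm_nonneg y₂)
    linarith

end Achievable

section LowerMass

variable {𝒳 : Type*} [Fintype 𝒳] [DecidableEq 𝒳] {E : Type*} [NormedAddCommGroup E]
  [NormedSpace ℝ E] {𝒬 : 𝒳 → List 𝒳 → ℝ}

theorem WeaklyIrred.superMult {Xr Xt : Finset 𝒳}
    (hWI : WeaklyIrred (meanMat 𝒬) Xr Xt) (hterm : ∀ a, Terminable 𝒬 a)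
    (htwo : ∃ b ∈ Xr, ∃ c, offK 𝒬 b c ≠ 0 ∧ 2 ≤ c.countP (fun a => decide (a ∈ Xr)))
    (f : 𝒳 × List 𝒳 → E) {a : 𝒳} (ha : a ∈ Xr) : SuperMult (ballMass (offK 𝒬) f a) where
  mono := ballMass_mono
  mul_le := by
    obtain ⟨g, Ψ, ω, hω, h⟩ := hWI.exists_ballMass_mul_le hterm htwo f ha
    obtain ⟨B, hB, hBω⟩ := exists_ofReal_exp_le hω
    exact ⟨g, Ψ, B, hB, fun n₁ n₂ Φ₁ Φ₂ ρ₁ ρ₂ => (mul_le_mul_left hBω _).trans (h ..)⟩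
  base := by
    obtain ⟨t, rfl, ht⟩ := hterm a
    obtain ⟨B, hB, hBω⟩ := exists_ofReal_exp_le (ballMass_ne_zero (f := f) ht le_rfl)
    exact ⟨_, _, B, hB, hBω⟩

theorem exists_tree_of_mem_sizeSupport (h𝒬 : ∀ a c, 0 ≤ 𝒬 a c) {μ0 : 𝒳 → ℝ}
    (hμ0 : ∀ a, 0 ≤ μ0 a) {n : ℕ} (hn : n ∈ sizeSupport (mgwWeight μ0 𝒬)) :
    ∃ t : PTree 𝒳, t.size = n ∧ 0 < μ0 t.root ∧ t.vprod (offK 𝒬) ≠ 0 := by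
  have h : treeMass (mgwWeight μ0 𝒬) n ≠ 0 := ne_of_gt hn
  unfold treeMass at h
  rw [ne_eq, ENNReal.tsum_eq_zero, not_forall] at h
  obtain ⟨t, ht⟩ := h
  have hs : t.size = n := by
    by_contra h
    simp [h] at ht
  rw [if_pos hs, ofReal_mgwWeight h𝒬 hμ0] at ht
  exact ⟨t, hs, by simpa using left_ne_zero_of_mul ht, right_ne_zero_of_mul ht⟩

/-- An achievable pair gives a lower bound for the unconditional law along all sizes of positive
probability. -/
theorem WeaklyIrred.eventually_exp_le {Xr Xt : Finset 𝒳}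
    (hWI : WeaklyIrred (meanMat 𝒬) Xr Xt) (htrans : BoundedTransient 𝒬 Xt)
    (hterm : ∀ a, Terminable 𝒬 a)
    (htwo : ∃ b ∈ Xr, ∃ c, offK 𝒬 b c ≠ 0 ∧ 2 ≤ c.countP (fun a => decide (a ∈ Xr)))
    (h𝒬 : ∀ a c, 0 ≤ 𝒬 a c) {μ0 : 𝒳 → ℝ} (hμ0 : ∀ a, 0 ≤ μ0 a)
    (f : 𝒳 × List 𝒳 → E) {a : 𝒳} (ha : a ∈ Xr) {y : E} {r : ℝ}
    (hyr : (y, r) ∈ achievable (ballMass (offK 𝒬) f a)) {ε : ℝ} (hε : 0 < ε) :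
    ∀ᶠ n : ℕ in atTop ⊓ 𝓟 (sizeSupport (mgwWeight μ0 𝒬)),
      ENNReal.ofReal (Real.exp (-(n * (r + ε)))) ≤
        ∑' t : PTree 𝒳, if t.size = n ∧ ‖t.vsum f - (n : ℝ) • y‖ ≤ ε * n
          then ENNReal.ofReal (mgwWeight μ0 𝒬 t) else 0 := by
  set S := sizeSupport (mgwWeight μ0 𝒬)
  have hm := hWI.superMult hterm htwo f ha
  obtain ⟨N₀, hN₀⟩ := hWI.exists_size_le htrans
  obtain ⟨M, -, hM, hblock⟩ := hm.exists_block hyr (half_pos hε) 0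
  have hr : 0 ≤ r := hyr.1
  suffices H : ∀ i : Fin M, ∀ᶠ n : ℕ in atTop ⊓ 𝓟 S, n % M = i →
      ENNReal.ofReal (Real.exp (-(n * (r + ε)))) ≤
        ∑' t : PTree 𝒳, if t.size = n ∧ ‖t.vsum f - (n : ℝ) • y‖ ≤ ε * n
          then ENNReal.ofReal (mgwWeight μ0 𝒬 t) else 0 by
    filter_upwards [eventually_all.2 H] with n hn
    exact hn ⟨n % M, Nat.mod_lt _ hM⟩ rfl
  intro i
  by_cases hi : ∃ n > N₀, n ∈ S ∧ n % M = i
  swap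
  · push Not at hi
    rw [eventually_inf_principal]
    filter_upwards [eventually_gt_atTop N₀] with n hn hnS hni
    exact absurd hni (hi n hn hnS)
  obtain ⟨n₁, hn₁, hn₁S, hn₁i⟩ := hi
  obtain ⟨t₁, rfl, ht₁μ, ht₁⟩ := exists_tree_of_mem_sizeSupport h𝒬 hμ0 hn₁S
  have hroot : t₁.root ∈ Xr := by
    by_contra h
    refine absurd (hN₀ t₁ ?_ ht₁) (by omega)
    by_contra h'
    exact h ((hWI.compl _).2 h')
  obtain ⟨u, Ψu, ωu, φu, hωu, hφu⟩ :=
    exists_treeContext_of_transGen hterm f (hWI.transGen hroot a)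
  obtain ⟨v, Ψv, ωv, φv, hωv, hφv⟩ :=
    exists_treeContext_of_transGen hterm f (hWI.transGen ha t₁.root)
  have hloop := (hφv.comp hφu).iterate (M - 1)
  have hτ := (hloop.comp hφv).ballMass_le t₁.size (t₁.vsum f) 0
  set n₂ : ℕ := t₁.size + (v + (M - 1) * (u + v)) with hn₂
  set Φ₂ := t₁.vsum f + (Ψv + (M - 1) • (Ψu + Ψv)) with hΦ₂
  have hn₂u : n₂ + u = t₁.size + M * (u + v) := by
    obtain ⟨M', rfl⟩ := Nat.exists_eq_add_of_le hM
    rw [hn₂, Nat.add_sub_cancel_left]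
    ring
  set κ : ℝ≥0∞ := ENNReal.ofReal (μ0 t₁.root) * (ωu * ballMass (offK 𝒬) f a n₂ Φ₂ 0)
  have hκ : κ ≠ 0 := by
    refine mul_ne_zero (by simpa using ht₁μ) (mul_ne_zero hωu ?_)
    refine ne_bot_of_le_ne_bot (mul_ne_zero (mul_ne_zero ?_ hωv) ?_) hτ
    · exact pow_ne_zero _ (mul_ne_zero hωv hωu)
    · exact ballMass_ne_zero ht₁ le_rfl
  obtain ⟨B, hB, hBκ⟩ := exists_ofReal_exp_le hκ
  set D : ℝ := B + ‖Φ₂ + Ψu‖ + (n₂ + u : ℕ) * ‖y‖ with hD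
  obtain ⟨N₁, hN₁⟩ := exists_nat_ge (D / (ε / 2))
  rw [eventually_inf_principal]
  filter_upwards [eventually_ge_atTop (n₂ + u), eventually_ge_atTop N₁] with n hn hnN₁ hnS hni
  have hnD : D ≤ n * (ε / 2) := by
    rw [div_le_iff₀ (by positivity)] at hN₁
    exact hN₁.trans (mul_le_mul_of_nonneg_right (by exact_mod_cast hnN₁) (by positivity))
  obtain ⟨k, hk⟩ : ∃ k, n = n₂ + u + k * M := by
    have h1 : n₂ + u ≡ n [MOD M] := by
      rw [hn₂u, Nat.ModEq, Nat.add_mul_mod_self_left, hn₁i, hni]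
    obtain ⟨k, hk⟩ := (Nat.modEq_iff_dvd' hn).1 h1
    exact ⟨k, by rw [mul_comm, ← hk]; omega⟩
  have hkr : (n : ℝ) = (n₂ + u : ℕ) + (k * M : ℕ) := by exact_mod_cast hk
  have h1 := mul_le_mul_right (hφu.ballMass_le (n₂ + k * M) (Φ₂ + ((k * M : ℕ) : ℝ) • y)
    (0 + ε / 2 * (k * M : ℕ))) (ENNReal.ofReal (μ0 t₁.root))
  have h2 := mul_le_mul_right (mul_le_mul_right (hblock k n₂ Φ₂ 0) ωu)
    (ENNReal.ofReal (μ0 t₁.root))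
  have h3 : ENNReal.ofReal (μ0 t₁.root) * ballMass (offK 𝒬) f t₁.root (n₂ + k * M + u)
        (Φ₂ + ((k * M : ℕ) : ℝ) • y + Ψu) (0 + ε / 2 * (k * M : ℕ))
      ≤ ∑' t : PTree 𝒳, if t.size = n ∧ ‖t.vsum f - (n : ℝ) • y‖ ≤ ε * n
          then ENNReal.ofReal (mgwWeight μ0 𝒬 t) else 0 := by
    unfold ballMass
    rw [← ENNReal.tsum_mul_left]
    refine ENNReal.tsum_le_tsum fun t => ?_
    split_ifs with h4 h5 h5
    · rw [ofReal_mgwWeight h𝒬 hμ0, h4.1]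
    · refine absurd ⟨by rw [h4.2.1, hk]; ring, ?_⟩ h5
      have e : t.vsum f - (n : ℝ) • y = (t.vsum f - (Φ₂ + ((k * M : ℕ) : ℝ) • y + Ψu))
          + (Φ₂ + Ψu) - ((n₂ + u : ℕ) : ℝ) • y := by
        rw [hkr]; module
      rw [e]
      have e1 := norm_sub_le (t.vsum f - (Φ₂ + ((k * M : ℕ) : ℝ) • y + Ψu)
          + (Φ₂ + Ψu)) (((n₂ + u : ℕ) : ℝ) • y)
      have e2 := norm_add_le (t.vsum f - (Φ₂ + ((k * M : ℕ) : ℝ) • y + Ψu)) (Φ₂ + Ψu)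
      rw [norm_smul, Real.norm_natCast] at e1
      have e3 : ε / 2 * (k * M : ℕ) ≤ ε / 2 * n := by
        rw [hkr]
        exact mul_le_mul_of_nonneg_left (le_add_of_nonneg_left (Nat.cast_nonneg _)) (by positivity)
      linarith [h4.2.2]
    · simp
    · simp
  refine le_trans ?_ (h2.trans (h1.trans h3))
  have h4 : ENNReal.ofReal (Real.exp (-((k * M : ℕ) * (r + ε / 2)))) * κ
      = ENNReal.ofReal (μ0 t₁.root) * (ωu *
        (ENNReal.ofReal (Real.exp (-((k * M : ℕ) * (r + ε / 2))))
          * ballMass (offK 𝒬) f a n₂ Φ₂ 0)) := by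
    simp only [κ]; ring
  rw [← h4]
  refine le_trans ?_ (mul_le_mul_right hBκ _)
  rw [ofReal_exp_mul_ofReal_exp]
  apply ofReal_exp_le
  have h5 : ((k * M : ℕ) : ℝ) * (r + ε / 2) ≤ n * (r + ε / 2) := by
    rw [hkr]
    exact mul_le_mul_of_nonneg_right (le_add_of_nonneg_left (Nat.cast_nonneg _)) (by positivity)
  have h6 : B ≤ D := by
    have : 0 ≤ ‖Φ₂ + Ψu‖ + (n₂ + u : ℕ) * ‖y‖ := by positivity
    linarith
  linarith

end LowerMass

section Separation

variable {E : Type*} [NormedAddCommGroup E] [NormedSpace ℝ E]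

/-- A point outside a closed convex epigraph-like set can be separated by a non-vertical
hyperplane. -/
theorem exists_nonvertical_separation {A : Set (E × ℝ)} (hc : IsClosed A) (hv : Convex ℝ A)
    (hup : ∀ y r r', (y, r) ∈ A → r ≤ r' → (y, r') ∈ A) (hpos : ∀ p ∈ A, 0 ≤ p.2)
    {x : E × ℝ} (hx : x ∉ A) :
    ∃ (l : E →L[ℝ] ℝ) (c : ℝ), (∀ p ∈ A, l p.1 - p.2 ≤ c) ∧ c < l x.1 - x.2 := by
  obtain ⟨F, u, hF, hu⟩ := geometric_hahn_banach_closed_point hv hc hx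
  rcases A.eq_empty_or_nonempty with rfl | ⟨p₀, hp₀⟩
  · exact ⟨0, -x.2 - 1, by simp, by simp⟩
  set μ : E →L[ℝ] ℝ := F.comp (ContinuousLinearMap.inl ℝ E ℝ)
  set k : ℝ := F (0, 1)
  have hFeq : ∀ y r, F (y, r) = μ y + r * k := by
    intro y r
    have : (y, r) = ((y, 0) : E × ℝ) + r • ((0, 1) : E × ℝ) := by simp
    rw [this, map_add, map_smul]
    rfl
  have hk : k ≤ 0 := by
    by_contra! hk
    have h1 := hF (p₀.1, max p₀.2 ((u - μ p₀.1) / k)) (hup _ _ _ hp₀ (le_max_left _ _))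
    rw [hFeq] at h1
    have h2 : (u - μ p₀.1) / k * k ≤ max p₀.2 ((u - μ p₀.1) / k) * k :=
      mul_le_mul_of_nonneg_right (le_max_right _ _) hk.le
    rw [div_mul_cancel₀ _ hk.ne'] at h2
    linarith
  have hxu : u < μ x.1 + x.2 * k := hFeq x.1 x.2 ▸ hu
  rcases hk.lt_or_eq with hk | hk
  · refine ⟨(-k)⁻¹ • μ, (-k)⁻¹ * u, fun p hp => ?_, ?_⟩
    · have h1 := hF p hp
      rw [← Prod.mk.eta (p := p), hFeq] at h1
      have h2 : (-k)⁻¹ * μ p.1 - p.2 = (-k)⁻¹ * (μ p.1 + p.2 * k) := by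
        field_simp [hk.ne]
        ring
      rw [smul_apply, smul_eq_mul, h2]
      exact mul_le_mul_of_nonneg_left h1.le (inv_nonneg.2 (by linarith))
    · have h2 : (-k)⁻¹ * μ x.1 - x.2 = (-k)⁻¹ * (μ x.1 + x.2 * k) := by
        field_simp [hk.ne]
        ring
      rw [smul_apply, smul_eq_mul, h2]
      exact mul_lt_mul_of_pos_left hxu (inv_pos.2 (by linarith))
  · rw [hk, mul_zero, add_zero] at hxu
    obtain ⟨R, hR⟩ := exists_nat_gt (x.2 / (μ x.1 - u))
    rw [div_lt_iff₀ (by linarith)] at hR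
    refine ⟨(R : ℝ) • μ, R * u, fun p hp => ?_, ?_⟩
    · have h1 := hF p hp
      rw [← Prod.mk.eta (p := p), hFeq, hk, mul_zero, add_zero] at h1
      have := mul_le_mul_of_nonneg_left h1.le (Nat.cast_nonneg (α := ℝ) R)
      have := hpos p hp
      rw [smul_apply, smul_eq_mul]
      linarith
    · rw [smul_apply, smul_eq_mul]
      linarith

end Separation

section Membership

open MSpace

variable {𝒳 : Type*} [Fintype 𝒳] [DecidableEq 𝒳] {𝒬 : 𝒳 → List 𝒳 → ℝ}

theorem ofReal_exp_sum (L : 𝒳 → ℝ) (c : List 𝒳) :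
    (c.map fun b => ENNReal.ofReal (Real.exp (L b))).prod
      = ENNReal.ofReal (Real.exp (c.map L).sum) := by
  induction c with
  | nil => simp
  | cons b c ih => rw [List.map_cons, List.prod_cons, ih, ofReal_exp_mul_ofReal_exp,
      List.map_cons, List.sum_cons]

theorem sum_map_eq_sum_mult (L : 𝒳 → ℝ) (c : List 𝒳) :
    (c.map L).sum = ∑ a, L a * mult a c := by
  induction c with
  | nil => simp [mult]
  | cons b c ih =>
    rw [List.map_cons, List.sum_cons, ih]
    simp only [mult, List.count_cons, Nat.cast_add, mul_add, Finset.sum_add_distrib]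
    rw [add_comm]
    congr 1
    simp

/-- If all tilted tree sums are finite and nonzero, the tilt is bounded by the relative entropy
at shift-invariant measures. -/
theorem pair_le_relEnt_of_treeSum (h𝒬 : ∀ a c, 0 ≤ 𝒬 a c) (h𝒬1 : ∀ a, HasSum (𝒬 a) 1)
    {ν : MSpace 𝒳} (hν : ShiftInv ν.1) {G : 𝒳 × List 𝒳 → ℝ} {C : ℝ} (hG : LinGrowth C G)
    (hfin : ∀ b, treeSum (fun a c => offK 𝒬 a c * ENNReal.ofReal (Real.exp (G (a, c)))) b ≠ ∞)
    (hne : ∀ b, treeSum (fun a c => offK 𝒬 a c * ENNReal.ofReal (Real.exp (G (a, c)))) b ≠ 0) :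
    ENNReal.ofReal (pair G ν) ≤ relEnt ν.1 (fun x => marg1 ν.1 x.1 * 𝒬 x.1 x.2) := by
  set K := fun a c => offK 𝒬 a c * ENNReal.ofReal (Real.exp (G (a, c))) with hK
  set L : 𝒳 → ℝ := fun b => Real.log (treeSum K b).toReal
  have hL : ∀ b, treeSum K b = ENNReal.ofReal (Real.exp (L b)) := fun b => by
    rw [Real.exp_log (ENNReal.toReal_pos (hne b) (hfin b)), ENNReal.ofReal_toReal (hfin b)]
  set H : 𝒳 × List 𝒳 → ℝ := fun x => G x + (x.2.map L).sum - L x.1 with hH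
  have hsub : SubTilt 𝒬 H := by
    intro b
    have h1 : ∀ c, ENNReal.ofReal (𝒬 b c) * ENNReal.ofReal (Real.exp (H (b, c)))
        = ENNReal.ofReal (Real.exp (-L b)) * (K b c * (c.map (treeSum K)).prod) := by
      intro c
      rw [funext hL, ofReal_exp_sum, hK, hH]
      simp only [offK]
      rw [mul_assoc, ofReal_exp_mul_ofReal_exp, mul_left_comm, ofReal_exp_mul_ofReal_exp]
      ring_nf
    rw [tsum_congr h1, ENNReal.tsum_mul_left, ← treeSum_eq, hL, ofReal_exp_mul_ofReal_exp]
    simp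
  have hsum : HasSum (fun x => ν.1 x * H x) (pair G ν) := by
    have h1 : HasSum (fun x => ν.1 x * G x) (pair G ν) := (ν.2.summable_mul hG).hasSum
    have h2 : HasSum (fun x => ν.1 x * L x.1) (∑ a, marg1 ν.1 a * L a) :=
      ν.2.hasSum_mul_fst L
    have h3 : HasSum (fun x => ν.1 x * (x.2.map L).sum) (∑ a, marg1 ν.1 a * L a) := by
      have h4 : ∀ a ∈ Finset.univ, HasSum (fun x => L a * (ν.1 x * (mult a x.2 : ℝ)))
          (marg1 ν.1 a * L a) := by
        intro a _
        have h5 := (ν.2.summable_mul (linGrowth_mult a)).hasSum.mul_left (L a)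
        rw [hν a, mul_comm]
        simpa only [mul_comm] using h5
      refine (hasSum_sum h4).congr_fun fun x => ?_
      rw [sum_map_eq_sum_mult, Finset.mul_sum]
      exact Finset.sum_congr rfl fun a _ => by ring
    have h6 := (h1.add h3).sub h2
    rw [add_sub_cancel_right] at h6
    refine h6.congr_fun fun x => ?_
    rw [hH]; ring
  have h := tilt_le_relEnt h𝒬 h𝒬1 ν.2 hsub hsum.summable
  rwa [hsum.tsum_eq] at h

end Membership

section Finiteness

variable {𝒳 : Type*} [Fintype 𝒳] [DecidableEq 𝒳] {𝒬 : 𝒳 → List 𝒳 → ℝ}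
  {E : Type*} [NormedAddCommGroup E]

theorem norm_vsum_le {f : 𝒳 × List 𝒳 → E} {C : ℝ} (hC : 0 ≤ C)
    (hf : ∀ x, ‖f x‖ ≤ C * (1 + x.2.length)) (t : PTree 𝒳) :
    ‖t.vsum f‖ ≤ 2 * C * t.size := by
  have h1 : ‖t.vsum f‖ ≤ t.vsum (fun x => C * (1 + (x.2.length : ℝ))) := by
    unfold PTree.vsum
    induction t.subtrees with
    | nil => simp
    | cons s l ih =>
      rw [List.map_cons, List.sum_cons, List.map_cons, List.sum_cons]
      exact (norm_add_le _ _).trans (add_le_add (hf _) ih)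
  have h2 : t.vsum (fun x => C * (1 + (x.2.length : ℝ))) = C * (t.size + (t.size - 1)) := by
    rw [← PTree.vsum_length, ← PTree.vsum_one, ← PTree.vsum_add]
    exact (PTree.map_vsum (AddMonoidHom.mulLeft C) _ t).symm
  rw [h2] at h1
  linarith

theorem ballMass_le_one (h𝒬 : ∀ a c, 0 ≤ 𝒬 a c) (h𝒬1 : ∀ a, HasSum (𝒬 a) 1)
    (f : 𝒳 × List 𝒳 → E) (a : 𝒳) (n : ℕ) (Φ : E) (ρ : ℝ) :
    ballMass (offK 𝒬) f a n Φ ρ ≤ 1 := by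
  have h : ∀ a, ∑' c, offK 𝒬 a c ≤ 1 := fun a => by
    unfold offK
    rw [← ENNReal.ofReal_tsum_of_nonneg (h𝒬 a) (h𝒬1 a).summable, (h𝒬1 a).tsum_eq,
      ENNReal.ofReal_one]
  refine le_trans (ENNReal.tsum_le_tsum fun t => ?_) (treeSum_le_one (offK 𝒬) h a)
  split_ifs with h1 h2 h2
  · exact le_rfl
  · exact absurd h1.1 h2
  · simp
  · simp

variable [NormedSpace ℝ E]

theorem exists_ballMass_lt {m : ℕ → E → ℝ → ℝ≥0∞} (hm1 : ∀ n Φ ρ, m n Φ ρ ≤ 1) {y : E} {r : ℝ}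
    (h : (y, r) ∉ achievable m) :
    ∃ ε > 0, ∃ N : ℕ, ∀ n ≥ N,
      m n ((n : ℝ) • y) (ε * n) ≤ ENNReal.ofReal (Real.exp (-(n * (r + ε)))) := by
  by_cases hr : 0 ≤ r
  · have h1 : ¬ ∀ ε > 0, ∀ N : ℕ, ∃ n ≥ N,
        ENNReal.ofReal (Real.exp (-(n * (r + ε)))) ≤ m n ((n : ℝ) • y) (ε * n) :=
      fun h2 => h ⟨hr, h2⟩
    push Not at h1
    obtain ⟨ε, hε, N, hN⟩ := h1
    exact ⟨ε, hε, N, fun n hn => (hN n hn).le⟩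
  · refine ⟨-r, by linarith, 0, fun n _ => (hm1 _ _ _).trans ?_⟩
    simp

/-- The part of a tilted tree sum coming from the trees with `n` vertices. -/
theorem tilted_size_sum_le [ProperSpace E] (h𝒬 : ∀ a c, 0 ≤ 𝒬 a c)
    (h𝒬1 : ∀ a, HasSum (𝒬 a) 1) {f : 𝒳 × List 𝒳 → E} {C : ℝ} (hC : 0 ≤ C)
    (hf : ∀ x, ‖f x‖ ≤ C * (1 + x.2.length)) (a : 𝒳) (l : E →L[ℝ] ℝ) {c c' : ℝ}
    (h : ∀ p ∈ achievable (ballMass (offK 𝒬) f a), l p.1 - p.2 ≤ c) (hc : c < c') :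
    ∃ N k : ℕ, ∀ n ≥ N,
      ∑' t : PTree 𝒳, (if t.root = a ∧ t.size = n then
        t.vprod (offK 𝒬) * ENNReal.ofReal (Real.exp (l (t.vsum f))) else 0)
      ≤ k * ENNReal.ofReal (Real.exp (n * c')) := by
  have hy : ∀ y : E, ∃ ε > 0, ∃ N : ℕ, ∀ n ≥ N, ballMass (offK 𝒬) f a n ((n : ℝ) • y) (ε * n)
      ≤ ENNReal.ofReal (Real.exp (-(n * (l y - c' + ε)))) := by
    refine fun y => exists_ballMass_lt (ballMass_le_one h𝒬 h𝒬1 f a) fun hy => ?_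
    have := h _ hy
    simp only at this
    linarith
  choose ε hε N hN using hy
  have hδ : ∀ y, 0 < ε y / (1 + ‖l‖) := fun y => div_pos (hε y) (by positivity)
  obtain ⟨Y, -, hY⟩ := (isCompact_closedBall (0 : E) (2 * C)).elim_nhds_subcover
    (fun y => Metric.ball y (ε y / (1 + ‖l‖))) fun y _ => Metric.ball_mem_nhds y (hδ y)
  refine ⟨Y.sup N + 1, Y.card, fun n hn => ?_⟩
  have hn0 : (0 : ℝ) < n := by exact_mod_cast (by omega : 0 < n)
  calc ∑' t : PTree 𝒳, (if t.root = a ∧ t.size = n then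
        t.vprod (offK 𝒬) * ENNReal.ofReal (Real.exp (l (t.vsum f))) else 0)
      ≤ ∑' t : PTree 𝒳, ∑ y ∈ Y, ENNReal.ofReal (Real.exp (n * (l y + ε y))) *
          (if t.root = a ∧ t.size = n ∧ ‖t.vsum f - (n : ℝ) • y‖ ≤ ε y * n
            then t.vprod (offK 𝒬) else 0) := by
        refine ENNReal.tsum_le_tsum fun t => ?_
        split_ifs with ht
        swap
        · exact zero_le
        have hnorm := norm_vsum_le hC hf t
        rw [ht.2] at hnorm
        have hmem : (n : ℝ)⁻¹ • t.vsum f ∈ Metric.closedBall (0 : E) (2 * C) := by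
          rw [mem_closedBall_zero_iff, norm_smul, norm_inv, Real.norm_natCast, inv_mul_le_iff₀ hn0]
          linarith
        obtain ⟨y, hyY, hyb⟩ := Set.mem_iUnion₂.1 (hY hmem)
        rw [Metric.mem_ball, dist_eq_norm, lt_div_iff₀ (by positivity)] at hyb
        have hd : t.vsum f - (n : ℝ) • y = (n : ℝ) • ((n : ℝ)⁻¹ • t.vsum f - y) := by
          rw [smul_sub, smul_inv_smul₀ hn0.ne']
        set z := (n : ℝ)⁻¹ • t.vsum f - y with hz
        have hz0 := norm_nonneg z
        have hl0 := norm_nonneg l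
        have hz1 : ‖z‖ ≤ ε y := by nlinarith [mul_nonneg hz0 hl0]
        have hz2 : l z ≤ ε y := by
          refine ((le_abs_self _).trans (l.le_opNorm z)).trans ?_
          nlinarith
        refine le_trans ?_ (Finset.single_le_sum (fun _ _ => zero_le) hyY)
        rw [if_pos, mul_comm]
        · gcongr
          have : t.vsum f = (n : ℝ) • y + (n : ℝ) • z := by rw [← hd]; abel
          rw [this, map_add, map_smul, map_smul, smul_eq_mul, smul_eq_mul, mul_add]
          gcongr
        · refine ⟨ht.1, ht.2, ?_⟩
          rw [hd, norm_smul, Real.norm_natCast, mul_comm]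
          gcongr
    _ = ∑ y ∈ Y, ENNReal.ofReal (Real.exp (n * (l y + ε y))) *
          ballMass (offK 𝒬) f a n ((n : ℝ) • y) (ε y * n) := by
        rw [Summable.tsum_finsetSum fun _ _ => ENNReal.summable]
        refine Finset.sum_congr rfl fun y _ => ?_
        rw [ENNReal.tsum_mul_left]
        rfl
    _ ≤ ∑ y ∈ Y, ENNReal.ofReal (Real.exp (n * c')) := by
        refine Finset.sum_le_sum fun y hyY => ?_
        have h1 := Finset.le_sup (f := N) hyY
        refine (mul_le_mul_right (hN y n (by omega)) _).trans ?_
        rw [ofReal_exp_mul_ofReal_exp]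
        apply ofReal_exp_le
        linarith
    _ = Y.card * ENNReal.ofReal (Real.exp (n * c')) := by
        rw [Finset.sum_const, nsmul_eq_mul]

theorem tilted_treeSum_ne_top [ProperSpace E] (h𝒬 : ∀ a c, 0 ≤ 𝒬 a c)
    (h𝒬1 : ∀ a, HasSum (𝒬 a) 1) {f : 𝒳 × List 𝒳 → E} {C : ℝ} (hC : 0 ≤ C)
    (hf : ∀ x, ‖f x‖ ≤ C * (1 + x.2.length)) (a : 𝒳) (l : E →L[ℝ] ℝ) {c s : ℝ}
    (h : ∀ p ∈ achievable (ballMass (offK 𝒬) f a), l p.1 - p.2 ≤ c) (hs : s < -c) :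
    treeSum (fun a c => offK 𝒬 a c * ENNReal.ofReal (Real.exp (s + l (f (a, c))))) a ≠ ∞ := by
  obtain ⟨c', hc, hc'⟩ := exists_between (show c < -s by linarith)
  obtain ⟨N, k, hN⟩ := tilted_size_sum_le h𝒬 h𝒬1 hC hf a l h hc
  set A : ℕ → ℝ≥0∞ := fun n => ∑' t : PTree 𝒳, (if t.root = a ∧ t.size = n then
        t.vprod (offK 𝒬) * ENNReal.ofReal (Real.exp (l (t.vsum f))) else 0)
  have hA1 : ∀ n, A n ≤ ENNReal.ofReal (Real.exp (‖l‖ * (2 * C * n))) := by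
    intro n
    calc A n ≤ ENNReal.ofReal (Real.exp (‖l‖ * (2 * C * n))) *
          ballMass (offK 𝒬) f a n 0 (2 * C * n) := by
          unfold ballMass
          rw [← ENNReal.tsum_mul_left]
          refine ENNReal.tsum_le_tsum fun t => ?_
          split_ifs with h1 h2 h2
          · rw [mul_comm]
            gcongr
            refine ((le_abs_self _).trans (l.le_opNorm _)).trans ?_
            gcongr
            rw [← h1.2]
            exact norm_vsum_le hC hf t
          · refine absurd ⟨h1.1, h1.2, ?_⟩ h2
            rw [sub_zero, ← h1.2]
            exact norm_vsum_le hC hf t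
          · simp
          · simp
      _ ≤ _ := mul_le_of_le_one_right (zero_le) (ballMass_le_one h𝒬 h𝒬1 f a _ _ _)
  have heq : treeSum (fun a c => offK 𝒬 a c * ENNReal.ofReal (Real.exp (s + l (f (a, c))))) a
      = ∑' n : ℕ, ENNReal.ofReal (Real.exp (n * s)) * A n := by
    rw [treeSum_offK_mul_exp (fun x => s + l (f x))]
    simp only [A, ← ENNReal.tsum_mul_left]
    rw [ENNReal.tsum_comm]
    refine tsum_congr fun t => ?_
    rw [tsum_eq_single t.size]
    · split_ifs with h1 h2 h2
      · rw [PTree.vsum_add, PTree.vsum_const, ← PTree.map_vsum l, mul_left_comm,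
          ofReal_exp_mul_ofReal_exp]
      · exact absurd ⟨h1, rfl⟩ h2
      · exact absurd h2.1 h1
      · simp
    · intro n hn
      rw [if_neg (fun h1 => hn h1.2.symm), mul_zero]
  rw [heq]
  refine ne_top_of_le_ne_top (b := (∑' n : ℕ, if n < N then ENNReal.ofReal (Real.exp (n * s)) *
      ENNReal.ofReal (Real.exp (‖l‖ * (2 * C * n))) else 0)
    + ∑' n : ℕ, k * ENNReal.ofReal (Real.exp (s + c')) ^ n) ?_ ?_
  · refine ENNReal.add_ne_top.2 ⟨?_, ?_⟩
    · rw [tsum_eq_sum (s := Finset.range N)]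
      · refine ENNReal.sum_ne_top.2 fun n _ => ?_
        split_ifs
        · exact ENNReal.mul_ne_top ENNReal.ofReal_ne_top ENNReal.ofReal_ne_top
        · exact ENNReal.zero_ne_top
      · intro n hn
        rw [if_neg (by simpa using hn)]
    · rw [ENNReal.tsum_mul_left, ENNReal.tsum_geometric]
      refine ENNReal.mul_ne_top (ENNReal.natCast_ne_top k) (ENNReal.inv_ne_top.2 ?_)
      rw [ne_eq, tsub_eq_zero_iff_le, not_le, ← ENNReal.ofReal_one]
      rw [ENNReal.ofReal_lt_ofReal_iff one_pos, Real.exp_lt_one_iff]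
      linarith
  · rw [← ENNReal.tsum_add]
    refine ENNReal.tsum_le_tsum fun n => ?_
    split_ifs with hn
    · exact (mul_le_mul_right (hA1 n) _).trans le_self_add
    · refine (mul_le_mul_right (hN n (by omega)) _).trans ?_
      rw [zero_add, mul_left_comm, ofReal_exp_mul_ofReal_exp,
        ← ENNReal.ofReal_pow (Real.exp_pos _).le, ← Real.exp_nat_mul]
      apply le_of_eq
      ring_nf

end Finiteness

section Membership

open MSpace

variable {𝒳 : Type*} [Fintype 𝒳] [DecidableEq 𝒳] {𝒬 : 𝒳 → List 𝒳 → ℝ}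

/-- Shift-invariant measures of finite relative entropy are achievable. -/
theorem WeaklyIrred.mem_achievable {Xr Xt : Finset 𝒳}
    (hWI : WeaklyIrred (meanMat 𝒬) Xr Xt) (hterm : ∀ a, Terminable 𝒬 a)
    (htwo : ∃ b ∈ Xr, ∃ c, offK 𝒬 b c ≠ 0 ∧ 2 ≤ c.countP (fun a => decide (a ∈ Xr)))
    (h𝒬 : ∀ a c, 0 ≤ 𝒬 a c) (h𝒬1 : ∀ a, HasSum (𝒬 a) 1) {ι : Type*} [Fintype ι]
    (f : ι → 𝒳 × List 𝒳 → ℝ) {C : ℝ} (hC : 0 ≤ C) (hf : ∀ i, LinGrowth C (f i))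
    {a : 𝒳} (ha : a ∈ Xr) {ν : MSpace 𝒳} (hν : offRate 𝒬 ν.1 ≠ ∞) :
    ((fun i => pair (f i) ν : ι → ℝ), (offRate 𝒬 ν.1).toReal)
      ∈ achievable (ballMass (offK 𝒬) (fun x i => f i x) a) := by
  have hsi : ShiftInv ν.1 := by
    by_contra h
    exact hν (by rw [offRate, if_neg h])
  have hrate : offRate 𝒬 ν.1 = relEnt ν.1 (fun x => marg1 ν.1 x.1 * 𝒬 x.1 x.2) := by
    rw [offRate, if_pos hsi]
  set F : 𝒳 × List 𝒳 → ι → ℝ := fun x i => f i x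
  have hF : ∀ x, ‖F x‖ ≤ C * (1 + x.2.length) := fun x =>
    (pi_norm_le_iff_of_nonneg (by positivity)).2 fun i => hf i x
  by_contra hx
  have hm := hWI.superMult hterm htwo F ha
  obtain ⟨l, c, hl, hlt⟩ := exists_nonvertical_separation hm.isClosed_achievable
    hm.convex_achievable (fun _ _ _ => achievable_mono) (fun p hp => hp.1) hx
  simp only at hlt
  set J := (offRate 𝒬 ν.1).toReal
  obtain ⟨s, hs1, hs2⟩ := exists_between
    (show J - l (fun i => pair (f i) ν) < -c by linarith)
  set G : 𝒳 × List 𝒳 → ℝ := fun x => s + l (F x)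
  have hG : LinGrowth (|s| + ‖l‖ * C) G := by
    intro x
    have h1 : |l (F x)| ≤ ‖l‖ * (C * (1 + x.2.length)) :=
      (l.le_opNorm _).trans (mul_le_mul_of_nonneg_left (hF x) (norm_nonneg _))
    have h2 : |s| ≤ |s| * (1 + x.2.length) :=
      le_mul_of_one_le_right (abs_nonneg _) (by simp)
    have h3 := abs_add_le s (l (F x))
    simp only [G]
    linarith
  have hpair : pair G ν = s + l (fun i => pair (f i) ν) := by
    have h1 : HasSum (fun x => ν.1 x • F x) (fun i => pair (f i) ν) :=
      Pi.hasSum.2 fun i => (ν.2.summable_mul (hf i)).hasSum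
    have h2 := (ν.2.hasSum.mul_right s).add (l.hasSum h1)
    rw [one_mul] at h2
    refine Eq.trans (tsum_congr fun x => ?_) h2.tsum_eq
    simp only [G, map_smul, smul_eq_mul]
    ring
  have hfa := tilted_treeSum_ne_top h𝒬 h𝒬1 hC hF a l hl hs2
  have hfin : ∀ b, treeSum (fun a c => offK 𝒬 a c * ENNReal.ofReal (Real.exp (G (a, c)))) b
      ≠ ∞ := by
    intro b htop
    obtain ⟨u, Ψ, ω, φ, hω, hφ⟩ := exists_treeContext_of_transGen hterm G (hWI.transGen ha b)
    have hφ' : IsTreeContext (fun a c => offK 𝒬 a c * ENNReal.ofReal (Real.exp (G (a, c)))) G b a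
        u Ψ (ω * ENNReal.ofReal (Real.exp Ψ)) φ := by
      refine ⟨hφ.inj, hφ.root, hφ.size, hφ.vsum, fun t ht => ?_⟩
      rw [PTree.vprod_mul, PTree.vprod_mul, PTree.vprod_exp, PTree.vprod_exp, hφ.vprod t ht,
        hφ.vsum t ht, add_comm, ← ofReal_exp_mul_ofReal_exp]
      ring
    have h1 := hφ'.treeSum_le
    rw [htop, ENNReal.mul_top (mul_ne_zero hω (by simp [Real.exp_pos])), top_le_iff] at h1
    exact hfa h1
  have hne : ∀ b, treeSum (fun a c => offK 𝒬 a c * ENNReal.ofReal (Real.exp (G (a, c)))) b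
      ≠ 0 := by
    intro b
    obtain ⟨t, ht, ht0⟩ := hterm b
    rw [treeSum_offK_mul_exp, ne_eq, ENNReal.tsum_eq_zero, not_forall]
    refine ⟨t, ?_⟩
    rw [if_pos ht]
    exact mul_ne_zero ht0 (by simp [Real.exp_pos])
  have h1 := pair_le_relEnt_of_treeSum h𝒬 h𝒬1 hsi hG hfin hne
  rw [← hrate, hpair, ENNReal.ofReal_le_iff_le_toReal hν] at h1
  linarith

end Membership

section ExtendedLog

theorem le_elog {x : ℝ} {c : ℝ≥0∞} (h : ENNReal.ofReal (Real.exp x) ≤ c) : (x : EReal) ≤ elog c := by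
  unfold elog
  have h0 : 0 < c := (ENNReal.ofReal_pos.2 (Real.exp_pos x)).trans_le h
  rw [if_neg h0.ne']
  split_ifs with h1
  · exact le_top
  · rw [EReal.coe_le_coe_iff, Real.le_log_iff_exp_le (ENNReal.toReal_pos h0.ne' h1)]
    exact (ENNReal.ofReal_le_iff_le_toReal h1).1 h

theorem elog_le {x : ℝ} {c : ℝ≥0∞} (h : c ≤ ENNReal.ofReal (Real.exp x)) : elog c ≤ (x : EReal) := by
  unfold elog
  split_ifs with h0 h1
  · exact bot_le
  · exact absurd (h1 ▸ h) (by simp)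
  · rw [EReal.coe_le_coe_iff, Real.log_le_iff_le_exp (ENNReal.toReal_pos h0 h1)]
    exact ENNReal.toReal_le_of_le_ofReal (Real.exp_pos x).le h

theorem inv_mul_coe_mul {n : ℕ} (hn : 0 < n) (x : ℝ) :
    (((n : ℝ)⁻¹ : ℝ) : EReal) * ((n * x : ℝ) : EReal) = (x : EReal) := by
  rw [← EReal.coe_mul, inv_mul_cancel_left₀ (by positivity)]

theorem le_inv_mul_elog {n : ℕ} (hn : 0 < n) {x : ℝ} {c : ℝ≥0∞}
    (h : ENNReal.ofReal (Real.exp (n * x)) ≤ c) :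
    (x : EReal) ≤ (((n : ℝ)⁻¹ : ℝ) : EReal) * elog c := by
  rw [← inv_mul_coe_mul hn x]
  exact mul_le_mul_of_nonneg_left (le_elog h) (EReal.coe_nonneg.2 (by positivity))

theorem inv_mul_elog_le {n : ℕ} (hn : 0 < n) {x : ℝ} {c : ℝ≥0∞}
    (h : c ≤ ENNReal.ofReal (Real.exp (n * x))) :
    (((n : ℝ)⁻¹ : ℝ) : EReal) * elog c ≤ (x : EReal) := by
  rw [← inv_mul_coe_mul hn x]
  exact mul_le_mul_of_nonneg_left (elog_le h) (EReal.coe_nonneg.2 (by positivity))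

end ExtendedLog

section LargeDeviations

variable {𝒳 : Type*} [Fintype 𝒳] [DecidableEq 𝒳] {𝒬 : 𝒳 → List 𝒳 → ℝ}

/-- The rate function vanishes at the stationary measure `π ⊗ 𝒬`, with `π` proportional to the
Perron-Frobenius eigenvector. -/
theorem exists_offRate_eq_zero [Nonempty 𝒳] (h𝒬 : ∀ a c, 0 ≤ 𝒬 a c) (h𝒬1 : ∀ a, HasSum (𝒬 a) 1)
    (hexp : ∀ (a : 𝒳) (η : ℝ), 0 < η →
      Summable (fun c : List 𝒳 => 𝒬 a c * Real.exp (η * c.length)))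
    (hcrit : CriticalKernel 𝒬) : ∃ ν : MSpace 𝒳, offRate 𝒬 ν.1 = 0 := by
  obtain ⟨u, hu0, hu⟩ := hcrit
  have hU : 0 < ∑ a, u a := Finset.sum_pos (fun a _ => hu0 a) Finset.univ_nonempty
  set p : 𝒳 → ℝ := fun a => u a / ∑ b, u b with hp
  have hp0 : ∀ a, 0 ≤ p a := fun a => (div_pos (hu0 a) hU).le
  have hp1 : ∑ a, p a = 1 := by rw [hp, ← Finset.sum_div, div_self hU.ne']
  have hlen : ∀ b, Summable fun c : List 𝒳 => 𝒬 b c * (c.length : ℝ) := by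
    intro b
    refine Summable.of_nonneg_of_le (fun c => mul_nonneg (h𝒬 b c) (Nat.cast_nonneg _))
      (fun c => mul_le_mul_of_nonneg_left ?_ (h𝒬 b c)) (hexp b 1 one_pos)
    have h2 := Real.add_one_le_exp (1 * (c.length : ℝ))
    linarith
  have hmult : ∀ a b, Summable fun c : List 𝒳 => 𝒬 b c * (mult a c : ℝ) := by
    intro a b
    refine Summable.of_nonneg_of_le (fun c => mul_nonneg (h𝒬 b c) (Nat.cast_nonneg _))
      (fun c => mul_le_mul_of_nonneg_left ?_ (h𝒬 b c)) (hlen b)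
    exact_mod_cast List.count_le_length
  set ν : 𝒳 × List 𝒳 → ℝ := fun x => p x.1 * 𝒬 x.1 x.2 with hν
  have hν0 : IsOffMeasure ν := by
    refine ⟨fun x => mul_nonneg (hp0 _) (h𝒬 _ _), ?_, ?_⟩
    · have := hasSum_prod_fintype (g := ν) fun a => (h𝒬1 a).mul_left (p a)
      simpa [hp1] using this
    · refine (hasSum_prod_fintype (s := fun a => p a * ∑' c : List 𝒳, 𝒬 a c * (c.length : ℝ))
        fun a => ?_).summable
      exact ((hlen a).hasSum.mul_left (p a)).congr_fun fun c => by simp only [hν]; ring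
  have hmarg : ∀ a, marg1 ν a = p a := fun a => by
    have := (h𝒬1 a).mul_left (p a)
    rw [mul_one] at this
    exact this.tsum_eq
  have hsi : ShiftInv ν := by
    intro a
    have h1 : HasSum (fun x : 𝒳 × List 𝒳 => (mult a x.2 : ℝ) * ν x)
        (∑ b, p b * meanMatR 𝒬 a b) := hasSum_prod_fintype fun b =>
      ((hmult a b).hasSum.mul_left (p b)).congr_fun fun c => by simp only [hν]; ring
    rw [h1.tsum_eq, hmarg]
    simp only [hp]
    rw [← hu a, Finset.sum_div]
    exact Finset.sum_congr rfl fun b _ => by ring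
  refine ⟨⟨ν, hν0⟩, ?_⟩
  have hρ : (fun x : 𝒳 × List 𝒳 => marg1 ν x.1 * 𝒬 x.1 x.2) = ν := by
    funext x
    rw [hmarg]
  simp only [offRate, if_pos hsi, hρ]
  rw [relEnt, if_pos fun _ h => h, ENNReal.tsum_eq_zero]
  intro x
  rcases eq_or_ne (ν x) 0 with h | h
  · simp [h]
  · simp [div_self h]

theorem treeMass_le_one (h𝒬 : ∀ a c, 0 ≤ 𝒬 a c) (h𝒬1 : ∀ a, HasSum (𝒬 a) 1)
    {μ0 : 𝒳 → ℝ} (hμ0 : ∀ a, 0 ≤ μ0 a) (hμ1 : ∑ a, μ0 a = 1) (n : ℕ) :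
    treeMass (mgwWeight μ0 𝒬) n ≤ 1 := by
  have hH : SubTilt 𝒬 (fun _ => 0) := by
    intro a
    simp only [Real.exp_zero, ENNReal.ofReal_one, mul_one]
    rw [← ENNReal.ofReal_tsum_of_nonneg (h𝒬 a) (h𝒬1 a).summable, (h𝒬1 a).tsum_eq,
      ENNReal.ofReal_one]
  have h := empMass_le_exp h𝒬 hμ0 hμ1 hH (s := Set.univ) (α := 0)
    (fun ν _ => by simp [MSpace.pair]) n
  simpa [empMass, treeMass] using h

theorem WeaklyIrred.empMass_lower_bound {Xr Xt : Finset 𝒳}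
    (hWI : WeaklyIrred (meanMat 𝒬) Xr Xt) (htrans : BoundedTransient 𝒬 Xt)
    (hterm : ∀ a, Terminable 𝒬 a)
    (htwo : ∃ b ∈ Xr, ∃ c, offK 𝒬 b c ≠ 0 ∧ 2 ≤ c.countP (fun a => decide (a ∈ Xr)))
    (h𝒬 : ∀ a c, 0 ≤ 𝒬 a c) (h𝒬1 : ∀ a, HasSum (𝒬 a) 1)
    {μ0 : 𝒳 → ℝ} (hμ0 : ∀ a, 0 ≤ μ0 a) {O : Set (MSpace 𝒳)} {ν : MSpace 𝒳}
    (hO : O ∈ nhds ν) (hν : offRate 𝒬 ν.1 ≠ ∞) {ε : ℝ} (hε : 0 < ε) :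
    ∀ᶠ n : ℕ in atTop ⊓ 𝓟 (sizeSupport (mgwWeight μ0 𝒬)),
      ENNReal.ofReal (Real.exp (-(n * ((offRate 𝒬 ν.1).toReal + ε))))
        ≤ empMass (mgwWeight μ0 𝒬) n O := by
  obtain ⟨a, ha⟩ := hWI.npty
  obtain ⟨I, δ, hδ, hI⟩ := MSpace.exists_tests hO
  choose D hD using fun f : offTests 𝒳 => exists_linGrowth f.2
  set f : I → 𝒳 × List 𝒳 → ℝ := fun i => i.1.1 with hf
  have hC : ∀ i : I, LinGrowth (∑ j : I, |D j.1|) (f i) := by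
    intro i x
    refine (hD i.1 x).trans (mul_le_mul_of_nonneg_right ?_ (by positivity))
    exact (le_abs_self _).trans
      (Finset.single_le_sum (f := fun j : I => |D j.1|) (fun j _ => abs_nonneg _)
        (Finset.mem_univ i))
  have hach := hWI.mem_achievable hterm htwo h𝒬 h𝒬1 f
    (Finset.sum_nonneg fun j _ => abs_nonneg _) hC ha hν
  have hη : 0 < min ε (δ / 2) := lt_min hε (half_pos hδ)
  have hev := hWI.eventually_exp_le htrans hterm htwo h𝒬 hμ0 _ ha hach hη
  filter_upwards [hev, mem_inf_of_left (eventually_gt_atTop 0)] with n hn hn0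
  refine le_trans (ENNReal.ofReal_le_ofReal (Real.exp_le_exp.2 ?_)) (hn.trans ?_)
  · have := min_le_left ε (δ / 2)
    gcongr
  · refine ENNReal.tsum_le_tsum fun t => ?_
    by_cases h : t.size = n ∧ ‖t.vsum (fun x (i : I) => f i x)
        - (n : ℝ) • (fun i => MSpace.pair (f i) ν : I → ℝ)‖ ≤ min ε (δ / 2) * n
    · rw [if_pos h, if_pos]
      refine ⟨h.1, hI _ fun g hg => ?_⟩
      have h1 := (norm_le_pi_norm _ (⟨g, hg⟩ : I)).trans h.2
      have h2 : (t.vsum (fun x (i : I) => f i x)) (⟨g, hg⟩ : I) = n * MSpace.pair g.1 (empM t) := by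
        rw [← h.1, ← vsum_eq_size_mul_pair]
        exact PTree.map_vsum (Pi.evalAddMonoidHom (fun _ : I => ℝ) ⟨g, hg⟩)
          (fun x i => f i x) t
      have hn0' : (0 : ℝ) < n := Nat.cast_pos.2 hn0
      rw [Pi.sub_apply, Pi.smul_apply, h2, smul_eq_mul, ← mul_sub, Real.norm_eq_abs, abs_mul,
        abs_of_pos hn0', mul_comm] at h1
      have h3 := le_of_mul_le_mul_right h1 hn0'
      have := min_le_right ε (δ / 2)
      change |MSpace.pair g.1 (empM t) - MSpace.pair g.1 ν| < δ
      have h4 : |MSpace.pair g.1 (empM t) - MSpace.pair g.1 ν| ≤ min ε (δ / 2) := h3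
      linarith
    · rw [if_neg h]
      exact zero_le

theorem WeaklyIrred.terminable_of_neBot {Xr Xt : Finset 𝒳}
    (hWI : WeaklyIrred (meanMat 𝒬) Xr Xt) (htrans : BoundedTransient 𝒬 Xt)
    (h𝒬 : ∀ a c, 0 ≤ 𝒬 a c) (h𝒬1 : ∀ a, HasSum (𝒬 a) 1)
    (hexp : ∀ (a : 𝒳) (η : ℝ), 0 < η →
      Summable (fun c : List 𝒳 => 𝒬 a c * Real.exp (η * c.length)))
    (hcrit : CriticalKernel 𝒬) {μ0 : 𝒳 → ℝ} (hμ0 : ∀ a, 0 ≤ μ0 a)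
    (h : (atTop ⊓ 𝓟 (sizeSupport (mgwWeight μ0 𝒬))).NeBot) (a : 𝒳) : Terminable 𝒬 a := by
  obtain ⟨N, hN⟩ := hWI.exists_size_le htrans
  obtain ⟨n, hn, hnS⟩ : ∃ n, N < n ∧ n ∈ sizeSupport (mgwWeight μ0 𝒬) :=
    h.nonempty_of_mem (inter_mem (mem_inf_of_left (eventually_gt_atTop N))
      (mem_inf_of_right (mem_principal_self _)))
  obtain ⟨t, rfl, -, ht⟩ := exists_tree_of_mem_sizeSupport h𝒬 hμ0 hnS
  refine hWI.terminable h𝒬 h𝒬1 hexp hcrit (b := t.root) ?_ ⟨t, rfl, ht⟩ a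
  by_contra h'
  exact absurd (hN t (by by_contra h''; exact h' ((hWI.compl _).2 h'')) ht) (by omega)

theorem coe_ennreal_eq_coe_toReal {c : ℝ≥0∞} (h : c ≠ ∞) : (c : EReal) = (c.toReal : EReal) := by
  conv_lhs => rw [← ENNReal.ofReal_toReal h]
  rw [EReal.coe_ennreal_ofReal, max_eq_left ENNReal.toReal_nonneg]

theorem WeaklyIrred.ldp_lower_bound {Xr Xt : Finset 𝒳}
    (hWI : WeaklyIrred (meanMat 𝒬) Xr Xt) (htrans : BoundedTransient 𝒬 Xt)
    (hterm : ∀ a, Terminable 𝒬 a)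
    (htwo : ∃ b ∈ Xr, ∃ c, offK 𝒬 b c ≠ 0 ∧ 2 ≤ c.countP (fun a => decide (a ∈ Xr)))
    (h𝒬 : ∀ a c, 0 ≤ 𝒬 a c) (h𝒬1 : ∀ a, HasSum (𝒬 a) 1)
    {μ0 : 𝒳 → ℝ} (hμ0 : ∀ a, 0 ≤ μ0 a) (hμ1 : ∑ a, μ0 a = 1) {O : Set (MSpace 𝒳)}
    (hO : IsOpen O) :
    - ⨅ ν ∈ O, (offRate 𝒬 ν.1 : EReal) ≤
      Filter.liminf
        (fun n : ℕ => (((n : ℝ)⁻¹ : ℝ) : EReal) *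
          elog (empMass (mgwWeight μ0 𝒬) n O / treeMass (mgwWeight μ0 𝒬) n))
        (atTop ⊓ 𝓟 (sizeSupport (mgwWeight μ0 𝒬))) := by
  rw [EReal.neg_le]
  refine le_iInf₂ fun ν hν => ?_
  by_cases hJ : offRate 𝒬 ν.1 = ∞
  · rw [hJ]
    exact le_top
  rw [coe_ennreal_eq_coe_toReal hJ, EReal.neg_le]
  by_contra! hlt
  obtain ⟨x, h1, h2⟩ := EReal.lt_iff_exists_real_btwn.1 hlt
  refine absurd h1 (not_lt.2 ?_)
  rw [← EReal.coe_neg, EReal.coe_lt_coe_iff] at h2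
  have hev := hWI.empMass_lower_bound htrans hterm htwo h𝒬 h𝒬1 hμ0 (hO.mem_nhds hν) hJ
    (ε := -(offRate 𝒬 ν.1).toReal - x) (by linarith)
  refine le_liminf_of_le (by isBoundedDefault) ?_
  filter_upwards [hev, mem_inf_of_left (eventually_gt_atTop 0)] with n hn hn0
  refine le_inv_mul_elog hn0 ?_
  rw [show (n : ℝ) * x = -(n * ((offRate 𝒬 ν.1).toReal + (-(offRate 𝒬 ν.1).toReal - x))) by ring]
  refine hn.trans ?_
  calc _ = empMass (mgwWeight μ0 𝒬) n O / 1 := (div_one _).symm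
    _ ≤ _ := ENNReal.div_le_div_left (treeMass_le_one h𝒬 h𝒬1 hμ0 hμ1 n) _

theorem WeaklyIrred.ldp_upper_bound {Xr Xt : Finset 𝒳}
    (hWI : WeaklyIrred (meanMat 𝒬) Xr Xt) (htrans : BoundedTransient 𝒬 Xt)
    (hterm : ∀ a, Terminable 𝒬 a)
    (htwo : ∃ b ∈ Xr, ∃ c, offK 𝒬 b c ≠ 0 ∧ 2 ≤ c.countP (fun a => decide (a ∈ Xr)))
    (h𝒬 : ∀ a c, 0 ≤ 𝒬 a c) (h𝒬1 : ∀ a, HasSum (𝒬 a) 1)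
    (hexp : ∀ (a : 𝒳) (η : ℝ), 0 < η →
      Summable (fun c : List 𝒳 => 𝒬 a c * Real.exp (η * c.length)))
    (hcrit : CriticalKernel 𝒬)
    {μ0 : 𝒳 → ℝ} (hμ0 : ∀ a, 0 ≤ μ0 a) (hμ1 : ∑ a, μ0 a = 1) {F : Set (MSpace 𝒳)}
    (hF : IsClosed F) :
      Filter.limsup
        (fun n : ℕ => (((n : ℝ)⁻¹ : ℝ) : EReal) *
          elog (empMass (mgwWeight μ0 𝒬) n F / treeMass (mgwWeight μ0 𝒬) n))
        (atTop ⊓ 𝓟 (sizeSupport (mgwWeight μ0 𝒬)))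
      ≤ - ⨅ ν ∈ F, (offRate 𝒬 ν.1 : EReal) := by
  by_contra! hlt
  obtain ⟨x, h1, h2⟩ := EReal.lt_iff_exists_real_btwn.1 hlt
  obtain ⟨y, h3, h4⟩ := EReal.lt_iff_exists_real_btwn.1 h1
  rw [EReal.coe_lt_coe_iff] at h4
  refine absurd h2 (not_lt.2 (limsup_le_of_le (by isBoundedDefault) ?_))
  rcases lt_or_ge 0 y with hy | hy
  · filter_upwards [mem_inf_of_left (eventually_gt_atTop 0)] with n hn0
    refine inv_mul_elog_le hn0 (le_trans (ENNReal.div_le_of_le_mul ?_)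
      (ENNReal.one_le_ofReal.2 (Real.one_le_exp (by have := hy.trans h4; positivity))))
    rw [one_mul]
    exact empMass_le_treeMass _ n F
  · have hFα : ∀ ν ∈ F, ENNReal.ofReal (-y) < offRate 𝒬 ν.1 := by
      intro ν hν
      have h5 : ((-y : ℝ) : EReal) < (offRate 𝒬 ν.1 : EReal) := by
        rw [EReal.coe_neg]
        exact (EReal.neg_lt_comm.1 h3).trans_le (iInf₂_le ν hν)
      rw [← EReal.coe_ennreal_lt_coe_ennreal_iff, EReal.coe_ennreal_ofReal,
        max_eq_left (by linarith)]
      exact h5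
    obtain ⟨C, hC⟩ := empMass_upper_bound h𝒬 h𝒬1 hexp hμ0 hμ1 (by linarith) hF hFα
    have : Nonempty 𝒳 := hWI.npty.to_type
    obtain ⟨ν₀, hν₀⟩ := exists_offRate_eq_zero h𝒬 h𝒬1 hexp hcrit
    set ε := (x - y) / 2 with hε
    have hε0 : 0 < ε := by rw [hε]; linarith
    have hev := hWI.empMass_lower_bound htrans hterm htwo h𝒬 h𝒬1 hμ0 (O := Set.univ)
      (ν := ν₀) univ_mem (by simp [hν₀]) hε0
    have hCe : ∀ᶠ n : ℕ in atTop, (C : ℝ) ≤ Real.exp (n * ε) :=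
      (Real.tendsto_exp_atTop.comp
        (tendsto_natCast_atTop_atTop.atTop_mul_const hε0)).eventually_ge_atTop _
    filter_upwards [mem_inf_of_left (eventually_gt_atTop 0), mem_inf_of_left hC, hev,
      mem_inf_of_left hCe] with n hn0 hn1 hn2 hn3
    refine inv_mul_elog_le hn0 (ENNReal.div_le_of_le_mul (hn1.trans ?_))
    have hn4 := hn2.trans (empMass_le_treeMass _ n Set.univ)
    rw [hν₀, ENNReal.toReal_zero, zero_add] at hn4
    have hn5 : (C : ℝ≥0∞) ≤ ENNReal.ofReal (Real.exp (n * ε)) := by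
      rw [← ENNReal.ofReal_natCast]
      exact ENNReal.ofReal_le_ofReal hn3
    refine le_trans (mul_le_mul' hn5 le_rfl) (le_trans (le_of_eq ?_) (mul_le_mul' le_rfl hn4))
    rw [ofReal_exp_mul_ofReal_exp, ofReal_exp_mul_ofReal_exp]
    congr 2
    rw [hε]
    ring

end LargeDeviations

section Statement4

variable {𝒳 : Type*} [Fintype 𝒳] [DecidableEq 𝒳]

theorem ldp_empirical_offspring_measure
    (𝒬 : 𝒳 → List 𝒳 → ℝ) (h𝒬_nonneg : ∀ a c, 0 ≤ 𝒬 a c) (h𝒬_sum : ∀ a, HasSum (𝒬 a) 1)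
    (hexp : ∀ (a : 𝒳) (η : ℝ), 0 < η →
      Summable (fun c : List 𝒳 => 𝒬 a c * Real.exp (η * c.length)))
    (Xr Xt : Finset 𝒳) (hWI : WeaklyIrred (meanMat 𝒬) Xr Xt)
    (htrans : BoundedTransient 𝒬 Xt)
    (hcrit : CriticalKernel 𝒬)
    (μ0 : 𝒳 → ℝ) (hμ0_nonneg : ∀ a, 0 ≤ μ0 a) (hμ0_sum : ∑ a, μ0 a = 1)
    (hμ0r : 0 < ∑ a ∈ Xr, μ0 a)
    (J : MSpace 𝒳 → ℝ≥0∞) (hJ : ∀ ν, J ν = offRate 𝒬 ν.1)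
    (S : Set ℕ) (hS : S = sizeSupport (mgwWeight μ0 𝒬)) :
    -- `J` is convex
    (∀ (ν ν' : MSpace 𝒳) (θ : ℝ), 0 ≤ θ → θ ≤ 1 →
      ∀ h : IsOffMeasure (fun x => θ * ν.1 x + (1 - θ) * ν'.1 x),
        J ⟨fun x => θ * ν.1 x + (1 - θ) * ν'.1 x, h⟩
          ≤ ENNReal.ofReal θ * J ν + ENNReal.ofReal (1 - θ) * J ν') ∧
    -- `J` is a good rate function
    LowerSemicontinuous J ∧
    (∀ c : ℝ≥0∞, c ≠ ∞ → IsCompact {ν : MSpace 𝒳 | J ν ≤ c}) ∧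
    -- large deviation upper bound, conditionally on `{|T| = n}`, along `n ∈ S`
    (∀ F : Set (MSpace 𝒳), IsClosed F →
      Filter.limsup
        (fun n : ℕ => (((n : ℝ)⁻¹ : ℝ) : EReal) *
          elog (condP (mgwWeight μ0 𝒬) n
            {t | ∃ h : IsOffMeasure (empOff t), (⟨empOff t, h⟩ : MSpace 𝒳) ∈ F}))
        (Filter.atTop ⊓ Filter.principal S)
        ≤ - ⨅ ν ∈ F, (J ν : EReal)) ∧
    -- large deviation lower bound
    (∀ O : Set (MSpace 𝒳), IsOpen O →
      - ⨅ ν ∈ O, (J ν : EReal) ≤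
      Filter.liminf
        (fun n : ℕ => (((n : ℝ)⁻¹ : ℝ) : EReal) *
          elog (condP (mgwWeight μ0 𝒬) n
            {t | ∃ h : IsOffMeasure (empOff t), (⟨empOff t, h⟩ : MSpace 𝒳) ∈ O}))
        (Filter.atTop ⊓ Filter.principal S)) := by
  obtain rfl : J = fun ν => offRate 𝒬 ν.1 := funext hJ
  subst hS
  simp only [condP_eq]
  refine ⟨fun ν ν' θ h0 h1 h => offRate_convex h𝒬_nonneg h𝒬_sum ν ν' θ h0 h1 h, ?_,
    fun c hc => isCompact_offRate_le h𝒬_nonneg h𝒬_sum hexp hc, ?_⟩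
  · exact lowerSemicontinuous_iff_isClosed_preimage.2
      fun c => isClosed_offRate_le h𝒬_nonneg h𝒬_sum c
  rcases (atTop ⊓ 𝓟 (sizeSupport (mgwWeight μ0 𝒬))).eq_or_neBot with hbot | hne
  · rw [hbot]
    simp
  · have hterm := hWI.terminable_of_neBot htrans h𝒬_nonneg h𝒬_sum hexp hcrit hμ0_nonneg hne
    have htwo := hWI.exists_two_recurrent h𝒬_nonneg h𝒬_sum hexp hcrit hterm
    exact ⟨fun F hF => hWI.ldp_upper_bound htrans hterm htwo h𝒬_nonneg h𝒬_sum hexp hcrit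
        hμ0_nonneg hμ0_sum hF,
      fun O hO => hWI.ldp_lower_bound htrans hterm htwo h𝒬_nonneg h𝒬_sum hμ0_nonneg hμ0_sum hO⟩


end Statement4
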